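/- arXiv:1505.04646 — 4 statements merged into one kernel-verified Lean document; each statement's English description precedes it below -/
import Mathlib

section
/- Let ω : ℕ → ℝ be a sequence with ω(n) → +∞, and let p(n) = (log n + log log n + ω(n))/n (assume 0 ≤ p(n) ≤ 1 for all large n). Then the Erdős–Rényi random graph G(n, p(n)) is Hamiltonian with high probability; that is, the probability that G(n, p(n)) contains a Hamiltonian cycle tends to 1 as n tends to infinity. -/
open Classical in
/-- The probability that the Erdős–Rényi random graph `G(n,p)` lies in the event `A`:
each graph `G` on `Fin n` has probability `p^(#edges of G) * (1-p)^((n choose 2) - #edges of G)`. -/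
noncomputable def erProb (n : ℕ) (p : ℝ) (A : Set (SimpleGraph (Fin n))) : ℝ :=
  ∑ G : SimpleGraph (Fin n),
    if G ∈ A then p ^ G.edgeSet.ncard * (1 - p) ^ (n.choose 2 - G.edgeSet.ncard) else 0

namespace ErdosRenyi

section BernoulliExpectation

open Finset

variable {α : Type*}

/-- The expectation of `g` at a random subset of `E` that contains each element of `E`
independently with probability `p`. -/
def bernExp (E : Finset α) (p : ℝ) (g : Finset α → ℝ) : ℝ :=
  ∑ S ∈ E.powerset, p ^ #S * (1 - p) ^ (#E - #S) * g S

open Classical in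
/-- The probability that a `p`-random subset of `E` satisfies `Q`. -/
noncomputable def bernProb (E : Finset α) (p : ℝ) (Q : Finset α → Prop) : ℝ :=
  bernExp E p fun S => if Q S then 1 else 0

lemma bernProb_eq_bernExp (E : Finset α) (p : ℝ) (Q : Finset α → Prop) [DecidablePred Q] :
    bernProb E p Q = bernExp E p fun S => if Q S then 1 else 0 := by
  unfold bernProb
  congr!

lemma bernExp_empty (p : ℝ) (g : Finset α → ℝ) : bernExp ∅ p g = g ∅ := by
  simp [bernExp]

lemma bernExp_insert [DecidableEq α] {a : α} {E : Finset α} (ha : a ∉ E) (p : ℝ)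
    (g : Finset α → ℝ) :
    bernExp (insert a E) p g =
      (1 - p) * bernExp E p g + p * bernExp E p fun S => g (insert a S) := by
  unfold bernExp
  rw [sum_powerset_insert ha, mul_sum, mul_sum]
  congr 1 <;> refine sum_congr rfl fun S hS => ?_
  · have hle := card_le_card (mem_powerset.1 hS)
    rw [card_insert_of_notMem ha, Nat.sub_add_comm hle, pow_succ]
    ring
  · rw [card_insert_of_notMem ha, card_insert_of_notMem fun h => ha (mem_powerset.1 hS h),
      Nat.add_sub_add_right, pow_succ]
    ring

lemma bernExp_const (E : Finset α) (p c : ℝ) : bernExp E p (fun _ => c) = c := by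
  classical
  induction E using Finset.induction_on with
  | empty => simp [bernExp_empty]
  | insert a E ha ih => rw [bernExp_insert ha, ih]; ring

lemma bernExp_add (E : Finset α) (p : ℝ) (g h : Finset α → ℝ) :
    bernExp E p (fun S => g S + h S) = bernExp E p g + bernExp E p h := by
  simp [bernExp, mul_add, sum_add_distrib]

lemma bernExp_const_mul (E : Finset α) (p c : ℝ) (g : Finset α → ℝ) :
    bernExp E p (fun S => c * g S) = c * bernExp E p g := by
  simp only [bernExp, mul_sum]
  exact sum_congr rfl fun _ _ => by ring

lemma bernExp_sum {ι : Type*} (I : Finset ι) (E : Finset α) (p : ℝ) (g : ι → Finset α → ℝ) :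
    bernExp E p (fun S => ∑ i ∈ I, g i S) = ∑ i ∈ I, bernExp E p (g i) := by
  simp only [bernExp, mul_sum]
  exact sum_comm

lemma bernExp_mono {E : Finset α} {p : ℝ} (h0 : 0 ≤ p) (h1 : p ≤ 1) {g h : Finset α → ℝ}
    (hgh : ∀ S ⊆ E, g S ≤ h S) : bernExp E p g ≤ bernExp E p h :=
  sum_le_sum fun S hS => mul_le_mul_of_nonneg_left (hgh S (mem_powerset.1 hS))
    (mul_nonneg (pow_nonneg h0 _) (pow_nonneg (sub_nonneg.2 h1) _))

lemma bernExp_union [DecidableEq α] (E : Finset α) (p q : ℝ) (g : Finset α → ℝ) :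
    bernExp E p (fun S => bernExp E q fun T => g (S ∪ T)) =
      bernExp E (1 - (1 - p) * (1 - q)) g := by
  induction E using Finset.induction_on generalizing g with
  | empty => simp [bernExp_empty]
  | insert a E ha ih =>
    simp only [bernExp_insert ha, bernExp_add, bernExp_const_mul, union_insert, insert_union,
      insert_idem]
    rw [ih, ih fun S => g (insert a S)]
    ring

lemma bernProb_insert [DecidableEq α] {a : α} {E : Finset α} (ha : a ∉ E) (p : ℝ)
    (Q : Finset α → Prop) :
    bernProb (insert a E) p Q =
      (1 - p) * bernProb E p Q + p * bernProb E p fun S => Q (insert a S) :=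
  bernExp_insert ha p _

lemma bernProb_congr {E : Finset α} {p : ℝ} {Q R : Finset α → Prop}
    (h : ∀ S ⊆ E, Q S ↔ R S) : bernProb E p Q = bernProb E p R :=
  sum_congr rfl fun S hS => by by_cases hR : R S <;> simp [h S (mem_powerset.1 hS), hR]

lemma bernProb_eq_zero {E : Finset α} {p : ℝ} {Q : Finset α → Prop} (h : ∀ S ⊆ E, ¬ Q S) :
    bernProb E p Q = 0 :=
  sum_eq_zero fun S hS => by simp [h S (mem_powerset.1 hS)]

lemma bernProb_cylinder [DecidableEq α] {E A B : Finset α} (hA : A ⊆ E) (hB : B ⊆ E)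
    (hAB : Disjoint A B) (p : ℝ) :
    bernProb E p (fun S => A ⊆ S ∧ Disjoint B S) = p ^ #A * (1 - p) ^ #B := by
  induction E using Finset.induction_on generalizing A B with
  | empty =>
    simp [subset_empty.1 hA, subset_empty.1 hB, bernProb, bernExp_empty]
  | insert a E ha ih =>
    rw [bernProb_insert ha]
    by_cases haA : a ∈ A
    · have haB : a ∉ B := disjoint_left.1 hAB haA
      rw [bernProb_eq_zero fun S hS h => ha (hS (h.1 haA)),
        bernProb_congr (R := fun S => A.erase a ⊆ S ∧ Disjoint B S)
          fun S _ => by simp [haB, subset_insert_iff],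
        ih (subset_insert_iff.1 hA) ((subset_insert_iff_of_notMem haB).1 hB)
          (hAB.mono_left (erase_subset a A)), ← card_erase_add_one haA, pow_succ]
      ring
    · have hA' : A ⊆ E := (subset_insert_iff_of_notMem haA).1 hA
      by_cases haB : a ∈ B
      · have hB' : ∀ S ⊆ E, Disjoint B S ↔ Disjoint (B.erase a) S := fun S hS => by
          rw [disjoint_left, disjoint_left]
          exact ⟨fun h x hx => h (mem_of_mem_erase hx), fun h x hx hxS =>
            h (mem_erase.2 ⟨fun e => ha (e ▸ hS hxS), hx⟩) hxS⟩
        rw [bernProb_eq_zero (Q := fun S => A ⊆ insert a S ∧ Disjoint B (insert a S))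
            fun S hS h => disjoint_left.1 h.2 haB (mem_insert_self a S),
          bernProb_congr (R := fun S => A ⊆ S ∧ Disjoint (B.erase a) S)
            fun S hS => and_congr_right' (hB' S hS),
          ih hA' (subset_insert_iff.1 hB) (hAB.mono_right (erase_subset a B)),
          ← card_erase_add_one haB, pow_succ]
        ring
      · rw [bernProb_congr (Q := fun S => A ⊆ insert a S ∧ Disjoint B (insert a S))
            (R := fun S => A ⊆ S ∧ Disjoint B S)
            fun S _ => by simp [haB, subset_insert_iff_of_notMem haA],
          ih hA' ((subset_insert_iff_of_notMem haB).1 hB) hAB]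
        ring

section Prob

variable {E : Finset α} {p : ℝ}

lemma bernProb_mono (h0 : 0 ≤ p) (h1 : p ≤ 1) {Q R : Finset α → Prop} (h : ∀ S ⊆ E, Q S → R S) :
    bernProb E p Q ≤ bernProb E p R := by
  refine bernExp_mono h0 h1 fun S hS => ?_
  have := h S hS
  split_ifs <;> simp_all

lemma bernProb_nonneg (h0 : 0 ≤ p) (h1 : p ≤ 1) (Q : Finset α → Prop) : 0 ≤ bernProb E p Q := by
  classical
  rw [← bernExp_const E p 0]
  refine bernExp_mono h0 h1 fun S _ => ?_
  split_ifs <;> simp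

lemma bernProb_exists_le (h0 : 0 ≤ p) (h1 : p ≤ 1) {ι : Type*}
    (I : Finset ι) (Q : ι → Finset α → Prop) :
    bernProb E p (fun S => ∃ i ∈ I, Q i S) ≤ ∑ i ∈ I, bernProb E p (Q i) := by
  classical
  unfold bernProb
  rw [← bernExp_sum]
  refine bernExp_mono h0 h1 fun S _ => ?_
  split_ifs with h
  · obtain ⟨i, hi, hQ⟩ := h
    calc (1 : ℝ) = if Q i S then 1 else 0 := by simp [hQ]
      _ ≤ _ := single_le_sum (f := fun i => if Q i S then (1 : ℝ) else 0)
        (fun _ _ => by positivity) hi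
  · positivity

lemma bernProb_exists_le_card_mul (h0 : 0 ≤ p) (h1 : p ≤ 1) {ι : Type*}
    (I : Finset ι) (Q : ι → Finset α → Prop) {c : ℝ}
    (hc : ∀ i ∈ I, bernProb E p (Q i) ≤ c) :
    bernProb E p (fun S => ∃ i ∈ I, Q i S) ≤ #I * c := by
  refine (bernProb_exists_le h0 h1 I Q).trans ?_
  simpa using sum_le_card_nsmul I _ c hc

end Prob

lemma bernProb_not (E : Finset α) (p : ℝ) (Q : Finset α → Prop) :
    bernProb E p (fun S => ¬ Q S) = 1 - bernProb E p Q := by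
  classical
  rw [eq_sub_iff_add_eq, ← bernExp_const E p 1]
  unfold bernProb
  rw [← bernExp_add]
  congr 1
  funext S
  by_cases h : Q S <;> simp [h]

/-- The probability of a decreasing event decreases with `p`. -/
lemma bernProb_antitone [DecidableEq α] {E : Finset α} {p q : ℝ} (h0 : 0 ≤ p) (hpq : p ≤ q)
    (h1 : q ≤ 1) {Q : Finset α → Prop} (hQ : ∀ S T, Q (S ∪ T) → Q S) :
    bernProb E q Q ≤ bernProb E p Q := by
  classical
  rcases hpq.eq_or_lt with rfl | hlt
  · rfl
  have hp : 0 < 1 - p := by linarith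
  obtain ⟨r, hr⟩ : ∃ r, r = 1 - (1 - q) / (1 - p) := ⟨_, rfl⟩
  have hq : q = 1 - (1 - p) * (1 - r) := by rw [hr]; field_simp; ring
  have hr0 : 0 ≤ r := by rw [hr, sub_nonneg, div_le_one hp]; linarith
  have hr1 : r ≤ 1 := by
    rw [hr]; linarith [div_nonneg (sub_nonneg.2 h1) hp.le]
  unfold bernProb
  rw [hq, ← bernExp_union]
  refine bernExp_mono h0 (by linarith) fun S _ => ?_
  rw [← bernExp_const E r (if Q S then 1 else 0)]
  refine bernExp_mono hr0 hr1 fun T _ => ?_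
  by_cases h : Q (S ∪ T)
  · simp [h, hQ S T h]
  · rw [if_neg h]
    split_ifs <;> simp

end BernoulliExpectation

section Rotation

open Finset

variable {V : Type*} {G : SimpleGraph V}

/-- The list `l` is the sequence of vertices of a path of `G`. -/
def IsPathList (G : SimpleGraph V) (l : List V) : Prop :=
  l.Nodup ∧ l.IsChain G.Adj

/-- `l'` is obtained from `l` by a Pósa rotation moving the first vertex. -/
def Rotates (G : SimpleGraph V) (l l' : List V) : Prop :=
  ∃ a b A B, l = (a :: A) ++ (b :: B) ∧ G.Adj a b ∧ l' = (a :: A).reverse ++ (b :: B)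

lemma isChain_rotation {D : V → V → Prop} (hD : ∀ x y, D x y → D y x) {a b : V} {A B : List V}
    (h : ((a :: A) ++ (b :: B)).IsChain D) (hab : D a b) :
    ((a :: A).reverse ++ (b :: B)).IsChain D := by
  rw [List.isChain_append] at h ⊢
  refine ⟨List.isChain_reverse.2 (h.1.imp hD), h.2.1, ?_⟩
  rw [List.getLast?_reverse]
  simpa using hab

lemma Rotates.isPathList {l l' : List V} (h : Rotates G l l') (hl : IsPathList G l) :
    IsPathList G l' := by
  obtain ⟨a, b, A, B, rfl, hab, rfl⟩ := h
  exact ⟨(List.Perm.append_right _ (List.reverse_perm _)).nodup_iff.2 hl.1,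
    isChain_rotation (fun _ _ h => h.symm) hl.2 hab⟩

lemma Rotates.perm {l l' : List V} (h : Rotates G l l') : l'.Perm l := by
  obtain ⟨a, b, A, B, rfl, -, rfl⟩ := h
  exact List.Perm.append_right _ (List.reverse_perm _)

lemma Rotates.getLast? {l l' : List V} (h : Rotates G l l') : l'.getLast? = l.getLast? := by
  obtain ⟨a, b, A, B, rfl, -, rfl⟩ := h
  rw [List.getLast?_append_of_ne_nil _ (by simp), List.getLast?_append_of_ne_nil _ (by simp)]

/-- `l'` is obtained from `l` by a sequence of rotations. -/
def RotReach (G : SimpleGraph V) (l l' : List V) : Prop :=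
  Relation.ReflTransGen (Rotates G) l l'

lemma RotReach.invariants {l l' : List V} (h : RotReach G l l') (hl : IsPathList G l) :
    IsPathList G l' ∧ l'.Perm l ∧ l'.getLast? = l.getLast? := by
  induction h with
  | refl => exact ⟨hl, .refl _, rfl⟩
  | tail _ h ih => exact ⟨h.isPathList ih.1, h.perm.trans ih.2.1, h.getLast?.trans ih.2.2⟩

/-- `y` and `z` are consecutive entries of `l`, in some order. -/
def Consecutive (l : List V) (y z : V) : Prop :=
  ∃ (i : ℕ) (_ : i + 1 < l.length), (y = l[i] ∧ z = l[i + 1]) ∨ (z = l[i] ∧ y = l[i + 1])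

lemma Consecutive.symm {l : List V} {y z : V} (h : Consecutive l y z) : Consecutive l z y := by
  obtain ⟨i, hi, h⟩ := h
  exact ⟨i, hi, h.symm⟩

lemma isChain_consecutive (l : List V) : l.IsChain (Consecutive l) :=
  List.isChain_iff_getElem.2 fun i hi => ⟨i, hi, .inl ⟨rfl, rfl⟩⟩

/-- The edges of `G` that meet `S`. -/
def touching (G : SimpleGraph V) (S : Finset V) : SimpleGraph V where
  Adj u v := G.Adj u v ∧ (u ∈ S ∨ v ∈ S)
  symm := ⟨fun _ _ h => ⟨h.1.symm, h.2.symm⟩⟩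
  loopless := ⟨fun _ h => G.loopless.irrefl _ h.1⟩

variable [Fintype V]

open Classical in
/-- The vertices outside `S` with a neighbour in `S`. -/
noncomputable def outNbhd (G : SimpleGraph V) (S : Finset V) : Finset V :=
  univ.filter fun v => v ∉ S ∧ ∃ u ∈ S, G.Adj u v

lemma mem_outNbhd {S : Finset V} {v : V} : v ∈ outNbhd G S ↔ v ∉ S ∧ ∃ u ∈ S, G.Adj u v := by
  simp [outNbhd]

/-- Every set of at most `k` vertices which is connected through the edges that meet it has an
outer neighbourhood of at least twice its size. -/
def Expands (G : SimpleGraph V) (k : ℕ) : Prop :=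
  ∀ S : Finset V, #S ≤ k → ∀ r ∈ S, (∀ v ∈ S, (touching G S).Reachable r v) →
    2 * #S ≤ #(outNbhd G S)

open Classical in
/-- The first vertices of the paths obtained from `l` by rotations. -/
noncomputable def rotEnds (G : SimpleGraph V) (l : List V) : Finset V :=
  univ.filter fun v => ∃ t, RotReach G l (v :: t)

lemma mem_rotEnds {l : List V} {v : V} : v ∈ rotEnds G l ↔ ∃ t, RotReach G l (v :: t) := by
  simp [rotEnds]

lemma Rotates.head_mem {l l' : List V} (hr : RotReach G l l') {a b : V} {A B : List V}
    (hl' : l' = (a :: A) ++ (b :: B)) (hab : G.Adj a b) :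
    (a :: A).getLast (by simp) ∈ rotEnds G l := by
  have h1 : Rotates G l' ((a :: A).reverse ++ (b :: B)) := ⟨a, b, A, B, hl', hab, rfl⟩
  rw [mem_rotEnds]
  refine ⟨(a :: A).reverse.tail ++ (b :: B), ?_⟩
  have h2 : (a :: A).reverse = (a :: A).getLast (by simp) :: (a :: A).reverse.tail := by
    have := List.cons_head_tail (l := (a :: A).reverse) (by simp)
    rw [List.head_reverse] at this
    exact this.symm
  rw [← List.cons_append, ← h2]
  exact hr.tail h1

lemma touching_reachable_of_mem_rotEnds {a : V} {t : List V} (hl : IsPathList G (a :: t)) {v : V}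
    (hv : v ∈ rotEnds G (a :: t)) :
    (touching G (rotEnds G (a :: t))).Reachable a v := by
  have key : ∀ l', RotReach G (a :: t) l' → ∀ v s, l' = v :: s →
      (touching G (rotEnds G (a :: t))).Reachable a v := by
    intro l' h
    induction h with
    | refl => rintro v s ⟨⟩; exact .refl _
    | @tail l₁ l₂ hr hstep ih =>
      rintro v s hs
      obtain ⟨b, c, A, B, h1, hbc, h2⟩ := hstep
      have hb : b ∈ rotEnds G (a :: t) := mem_rotEnds.2 ⟨A ++ (c :: B), by
        rw [← List.cons_append, ← h1]; exact hr⟩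
      have hlast := Rotates.head_mem hr h1 hbc
      have hv : v = (b :: A).getLast (by simp) := by
        have h3 := congrArg List.head? (hs.symm.trans h2)
        rw [List.head?_append, List.head?_reverse, List.getLast?_eq_getLast_of_ne_nil (by simp)]
          at h3
        simpa using h3
      have hchain := (RotReach.invariants hr hl).1.2
      rw [h1, List.isChain_append] at hchain
      have hvc : G.Adj v c := hchain.2.2 v (by
        rw [hv, List.getLast?_eq_getLast_of_ne_nil (by simp)]; rfl) c (by simp)
      refine (ih b (A ++ (c :: B)) h1).trans ?_
      have e1 : (touching G (rotEnds G (a :: t))).Adj b c := ⟨hbc, .inl hb⟩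
      have e2 : (touching G (rotEnds G (a :: t))).Adj c v := ⟨hvc.symm, .inr (hv ▸ hlast)⟩
      exact e1.reachable.trans e2.reachable
  obtain ⟨s, hs⟩ := mem_rotEnds.1 hv
  exact key _ hs v s rfl

lemma exists_consecutive_of_mem_outNbhd {l : List V} (hl : IsPathList G l)
    (hmax : ∀ l', IsPathList G l' → l'.length ≤ l.length) {x : V}
    (hx : x ∈ outNbhd G (rotEnds G l)) : ∃ y ∈ rotEnds G l, Consecutive l y x := by
  set R := rotEnds G l with hR
  obtain ⟨D, hD⟩ : ∃ D : V → V → Prop, ∀ y z, D y z ↔ Consecutive l y z ∨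
      ((y ∈ R ∨ ∃ w ∈ R, Consecutive l w y) ∧ (z ∈ R ∨ ∃ w ∈ R, Consecutive l w z)) :=
    ⟨_, fun _ _ => Iff.rfl⟩
  have hDsymm : ∀ y z, D y z → D z y := by
    intro y z h
    rw [hD] at h ⊢
    exact h.imp Consecutive.symm And.symm
  have hDR : ∀ y z, y ∈ R → D y z → z ∈ R ∨ ∃ w ∈ R, Consecutive l w z := by
    intro y z hy h
    rcases (hD y z).1 h with h | h
    · exact .inr ⟨y, hy, h⟩
    · exact h.2
  have hlast : ∀ l', RotReach G l l' → l'.IsChain D → ∀ a b A B, l' = (a :: A) ++ (b :: B) →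
      G.Adj a b → b ∈ R ∨ ∃ w ∈ R, Consecutive l w b := by
    intro l' hr hch a b A B h hab
    refine hDR _ b (Rotates.head_mem hr h hab) ?_
    rw [h, List.isChain_append] at hch
    exact hch.2.2 _ (by rw [List.getLast?_eq_getLast_of_ne_nil (by simp)]; rfl) b (by simp)
  have hchain : ∀ l', RotReach G l l' → l'.IsChain D := by
    intro l' h
    induction h with
    | refl => exact (isChain_consecutive l).imp fun y z h => (hD y z).2 (.inl h)
    | @tail l₁ l₂ hr hstep ih =>
      obtain ⟨a, b, A, B, h1, hab, rfl⟩ := hstep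
      have ha : a ∈ R := mem_rotEnds.2 ⟨A ++ (b :: B), by rw [← List.cons_append, ← h1]; exact hr⟩
      refine isChain_rotation hDsymm (h1 ▸ ih) ?_
      exact (hD a b).2 (.inr ⟨.inl ha, hlast l₁ hr ih a b A B h1 hab⟩)
  obtain ⟨hxR, u, hu, hux⟩ := mem_outNbhd.1 hx
  obtain ⟨t, ht⟩ := mem_rotEnds.1 hu
  have hinv := ht.invariants hl
  have hxt : x ∈ t := by
    by_contra hxt
    have h1 : IsPathList G (x :: u :: t) :=
      ⟨List.nodup_cons.2 ⟨by simp [hux.ne', hxt], hinv.1.1⟩,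
        List.isChain_cons_cons.2 ⟨hux.symm, hinv.1.2⟩⟩
    have h2 := hmax _ h1
    have h3 := hinv.2.1.length_eq
    simp only [List.length_cons] at h2 h3
    omega
  obtain ⟨A, B, rfl⟩ := List.append_of_mem hxt
  exact (hlast _ ht (hchain _ ht) u x A B rfl hux).resolve_left hxR

/-- **Pósa's lemma**: a longest path of an expanding graph has many rotation endpoints. -/
lemma lt_card_rotEnds {k : ℕ} (hG : Expands G k) {l : List V} (hne : l ≠ [])
    (hl : IsPathList G l) (hmax : ∀ l', IsPathList G l' → l'.length ≤ l.length) :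
    k < #(rotEnds G l) := by
  classical
  by_contra! hk
  obtain ⟨a, t, rfl⟩ := List.exists_cons_of_ne_nil hne
  have ha : a ∈ rotEnds G (a :: t) := mem_rotEnds.2 ⟨t, .refl⟩
  have h1 := hG _ hk a ha fun v hv => touching_reachable_of_mem_rotEnds hl hv
  set R := rotEnds G (a :: t)
  set l := a :: t
  have hsub : outNbhd G R ⊆ R.image (fun y => l.getD (l.idxOf y + 1) y) ∪
      (R.erase a).image fun y => l.getD (l.idxOf y - 1) y := by
    intro x hx
    obtain ⟨y, hy, i, hi, ⟨rfl, rfl⟩ | ⟨rfl, rfl⟩⟩ := exists_consecutive_of_mem_outNbhd hl hmax hx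
    · refine mem_union_left _ (mem_image.2 ⟨_, hy, ?_⟩)
      rw [hl.1.idxOf_getElem, List.getD_eq_getElem]
    · refine mem_union_right _ (mem_image.2 ⟨_, mem_erase.2 ⟨fun h => ?_, hy⟩, ?_⟩)
      · have : l[i + 1] = l[0] := h
        have := (hl.1.getElem_inj_iff).1 this
        omega
      · rw [hl.1.idxOf_getElem, Nat.add_sub_cancel, List.getD_eq_getElem]
  have h2 := (card_le_card hsub).trans (card_union_le _ _)
  have h3 := card_image_le (s := R) (f := fun y => l.getD (l.idxOf y + 1) y)
  have h4 := card_image_le (s := R.erase a) (f := fun y => l.getD (l.idxOf y - 1) y)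
  have h5 := card_erase_add_one ha
  omega

end Rotation

section Boosters

open Finset

variable {V : Type*} {G : SimpleGraph V}

lemma IsPathList.mono {H : SimpleGraph V} (h : G ≤ H) {l : List V} (hl : IsPathList G l) :
    IsPathList H l :=
  ⟨hl.1, hl.2.imp fun _ _ hab => h hab⟩

lemma IsPathList.reverse {l : List V} (hl : IsPathList G l) : IsPathList G l.reverse :=
  ⟨List.nodup_reverse.2 hl.1, List.isChain_reverse.2 (hl.2.imp fun _ _ h => h.symm)⟩

/-- A cycle, given as a closed list, with an edge leaving it can be opened to a longer path. -/
lemma exists_longer_of_closed {l : List V} (hl : IsPathList G l)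
    (hclosed : ∀ b ∈ l.getLast?, ∀ c ∈ l.head?, G.Adj b c) {x y : V} (hx : x ∉ l) (hy : y ∈ l)
    (hxy : G.Adj x y) : ∃ l', IsPathList G l' ∧ l.length < l'.length := by
  obtain ⟨A, B, rfl⟩ := List.append_of_mem hy
  have hperm : (A ++ y :: B).Perm ((y :: B) ++ A) := List.perm_append_comm
  refine ⟨x :: ((y :: B) ++ A), ⟨List.nodup_cons.2 ⟨fun h => hx (hperm.mem_iff.2 h),
    hperm.nodup_iff.1 hl.1⟩, ?_⟩, by simp; omega⟩
  have hch := hl.2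
  rw [List.isChain_append] at hch
  rw [List.cons_append, List.isChain_cons_cons, ← List.cons_append, List.isChain_append]
  refine ⟨hxy, hch.2.1, hch.1, fun b hb c hc => hclosed b ?_ c ?_⟩
  · rw [List.getLast?_append_of_ne_nil _ (by simp)]; exact hb
  · rw [List.head?_append, Option.mem_def.1 hc]; rfl

lemma isHamiltonian_of_closed [Fintype V] [DecidableEq V] {l : List V} (hl : IsPathList G l)
    (hclosed : ∀ b ∈ l.getLast?, ∀ c ∈ l.head?, G.Adj b c) (h3 : 3 ≤ l.length)
    (hall : ∀ v, v ∈ l) : G.IsHamiltonian := by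
  intro _
  obtain ⟨c, d, m, rfl⟩ : ∃ c d m, l = c :: d :: m := by
    match l, h3 with
    | c :: d :: m, _ => exact ⟨c, d, m, rfl⟩
  have hch := hl.2
  have hcd : G.Adj c d := (List.isChain_cons_cons.1 hch).1
  have hnd := List.nodup_cons.1 hl.1
  have hm : m ≠ [] := by rintro rfl; simp at h3
  set p : G.Walk d ((d :: m).getLast (by simp)) :=
    SimpleGraph.Walk.ofSupport (d :: m) (by simp) (List.isChain_cons_cons.1 hch).2 with hp
  have hps : p.support = d :: m := SimpleGraph.Walk.support_ofSupport _ _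
  have hadj : G.Adj ((d :: m).getLast (by simp)) c := by
    refine hclosed _ ?_ c (by simp)
    rw [List.getLast?_eq_getLast_of_ne_nil (by simp), List.getLast_cons (by simp)]
    rfl
  have hpath : (SimpleGraph.Walk.cons hcd p).IsPath := by
    rw [SimpleGraph.Walk.isPath_def, SimpleGraph.Walk.support_cons, hps]
    exact hl.1
  refine ⟨_, SimpleGraph.Walk.cons hadj (SimpleGraph.Walk.cons hcd p), ?_, ?_⟩
  · rw [SimpleGraph.Walk.cons_isCycle_iff]
    refine ⟨hpath, ?_⟩
    rw [SimpleGraph.Walk.edges_cons, List.mem_cons, not_or]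
    refine ⟨fun h => ?_, fun h => hnd.1 ?_⟩
    · have h1 : (d :: m).getLast (by simp) = d := by
        rcases Sym2.eq_iff.1 h with h | h
        · exact absurd (h.1 ▸ List.getLast_mem (by simp)) hnd.1
        · exact h.1
      rw [List.getLast_cons hm] at h1
      exact (List.nodup_cons.1 hnd.2).1 (h1 ▸ List.getLast_mem hm)
    · rw [← hps]
      exact p.snd_mem_support_of_mem_edges h
  · refine SimpleGraph.Walk.IsPath.isHamiltonian_of_mem ?_ ?_
    · simpa using hpath
    · intro w
      have := hall w
      simpa [hps] using this

lemma exists_adj_of_expands [Fintype V] {k : ℕ} (hG : Expands G k) {l : List V}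
    (hl : l.Nodup) (hlt : l.length < Fintype.card V) (hk : Fintype.card V - l.length ≤ k) :
    ∃ x y, x ∉ l ∧ y ∈ l ∧ G.Adj x y := by
  classical
  by_contra! hno
  obtain ⟨r, hr⟩ : ∃ r, r ∉ l := by
    by_contra! h
    have := card_le_card (fun v _ => List.mem_toFinset.2 (h v) : univ ⊆ l.toFinset)
    rw [List.toFinset_card_of_nodup hl, card_univ] at this
    omega
  have hclosed : ∀ v, G.Reachable r v → v ∉ l := by
    rintro v ⟨w⟩
    induction w with
    | nil => exact hr
    | cons h w ih => exact ih fun hv => hno _ _ hr hv h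
  set S : Finset V := univ.filter fun v => G.Reachable r v with hS
  have hmem : ∀ v, v ∈ S ↔ G.Reachable r v := by simp [hS]
  have hcard : #S ≤ k := by
    have h1 : S ⊆ univ \ l.toFinset := fun v hv => by
      simpa using hclosed v ((hmem v).1 hv)
    have h2 := card_le_card h1
    rw [card_sdiff_of_subset (subset_univ _), List.toFinset_card_of_nodup hl, card_univ] at h2
    omega
  have hreach : ∀ v ∈ S, (touching G S).Reachable r v := by
    intro v hv
    obtain ⟨w⟩ := (hmem v).1 hv
    have : ∀ {a b : V}, G.Walk a b → a ∈ S → (touching G S).Reachable a b := by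
      intro a b w ha
      induction w with
      | nil => exact .refl _
      | cons h w ih =>
        have e : (touching G S).Adj _ _ := ⟨h, .inl ha⟩
        exact e.reachable.trans (ih ((hmem _).2 (((hmem _).1 ha).trans h.reachable)))
    exact this w ((hmem r).2 (.refl _))
  have h1 := hG S hcard r ((hmem r).2 (.refl _)) hreach
  have h2 : outNbhd G S = ∅ := by
    refine eq_empty_of_forall_notMem fun v hv => ?_
    obtain ⟨hv, u, hu, huv⟩ := mem_outNbhd.1 hv
    exact hv ((hmem v).2 (((hmem u).1 hu).trans huv.reachable))
  have h3 : 0 < #S := card_pos.2 ⟨r, (hmem r).2 (.refl _)⟩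
  rw [h2, card_empty] at h1
  omega

/-- `H` is Hamiltonian or has a path with more vertices than `l`. -/
def Improves [DecidableEq V] [Fintype V] (l : List V) (H : SimpleGraph V) : Prop :=
  H.IsHamiltonian ∨ ∃ l', IsPathList H l' ∧ l.length < l'.length

/-- In an expanding graph there are quadratically many pairs of vertices whose addition as an
edge makes the graph Hamiltonian or creates a longer path. -/
theorem exists_boosters [Fintype V] [DecidableEq V] {k : ℕ} (hG : Expands G k) (hk : 2 ≤ k)
    {l : List V} (hne : l ≠ []) (hl : IsPathList G l)
    (hmax : ∀ l', IsPathList G l' → l'.length ≤ l.length) :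
    ∃ B : Finset (Sym2 V), (∀ e ∈ B, ¬ e.IsDiag) ∧ k ^ 2 ≤ 2 * #B ∧
      ∀ e ∈ B, ∀ H, G ≤ H → e ∈ H.edgeSet → Improves l H := by
  have hR := lt_card_rotEnds hG hne hl hmax
  have hRsub : rotEnds G l ⊆ l.toFinset := by
    intro v hv
    obtain ⟨t, ht⟩ := mem_rotEnds.1 hv
    exact List.mem_toFinset.2 ((ht.invariants hl).2.1.mem_iff.1 (by simp))
  have hlen : k < l.length := by
    rw [← List.toFinset_card_of_nodup hl.1]
    exact hR.trans_le (card_le_card hRsub)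
  have hle : l.length ≤ Fintype.card V := hl.1.length_le_card
  have hfiber : ∀ D : Finset (V × V), #D ≤ 2 * #(D.image fun x => s(x.1, x.2)) := by
    intro D
    refine card_le_mul_card_image D 2 fun e _ => ?_
    induction e using Sym2.ind with
    | _ a b =>
      refine (card_le_card (t := {(a, b), (b, a)}) fun x hx => ?_).trans card_le_two
      have := (mem_filter.1 hx).2
      rw [Sym2.eq_iff] at this
      simpa [Prod.ext_iff] using this
  suffices h : ∃ D : Finset (V × V), k ^ 2 ≤ #D ∧ ∀ x ∈ D, x.1 ≠ x.2 ∧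
      ∀ H, G ≤ H → H.Adj x.1 x.2 → Improves l H by
    obtain ⟨D, hD, h⟩ := h
    refine ⟨D.image fun x => s(x.1, x.2), ?_, hD.trans (hfiber D), ?_⟩
    · simp only [mem_image]
      rintro e ⟨x, hx, rfl⟩
      simpa using (h x hx).1
    · simp only [mem_image]
      rintro e ⟨x, hx, rfl⟩ H hH he
      exact (h x hx).2 H hH he
  by_cases hcase : k ≤ Fintype.card V - l.length
  · refine ⟨rotEnds G l ×ˢ (univ \ l.toFinset), ?_, ?_⟩
    · rw [card_product, card_sdiff_of_subset (subset_univ _), List.toFinset_card_of_nodup hl.1,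
        card_univ, sq]
      exact Nat.mul_le_mul hR.le hcase
    · rintro ⟨v, x⟩ hx
      obtain ⟨hv, hx⟩ := mem_product.1 hx
      have hx : x ∉ l := by simpa using hx
      refine ⟨fun h => hx ((show v = x from h) ▸ List.mem_toFinset.1 (hRsub hv)),
        fun H hH hadj => .inr ?_⟩
      obtain ⟨t, ht⟩ := mem_rotEnds.1 hv
      obtain ⟨h1, h2, -⟩ := ht.invariants hl
      refine ⟨x :: v :: t, ⟨List.nodup_cons.2 ⟨fun h => hx (h2.mem_iff.1 h), h1.1⟩,
        List.isChain_cons_cons.2 ⟨hadj.symm, (h1.mono hH).2⟩⟩, ?_⟩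
      rw [← h2.length_eq]
      simp
  · have hpath : ∀ b ∈ rotEnds G l, ∃ m, IsPathList G m ∧ m.Perm l ∧ m.getLast? = some b := by
      intro b hb
      obtain ⟨t, ht⟩ := mem_rotEnds.1 hb
      obtain ⟨h1, h2, -⟩ := ht.invariants hl
      exact ⟨(b :: t).reverse, h1.reverse, (List.reverse_perm _).trans h2, by
        rw [List.getLast?_reverse]; rfl⟩
    choose! m hm1 hm2 hm3 using hpath
    refine ⟨(rotEnds G l).sigma (fun b => rotEnds G (m b)) |>.image fun x => (x.1, x.2), ?_, ?_⟩
    · rw [card_image_of_injective, card_sigma]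
      · calc k ^ 2 = k * k := sq k
          _ ≤ #(rotEnds G l) * k := Nat.mul_le_mul_right k hR.le
          _ ≤ _ := by
            rw [← smul_eq_mul]
            refine card_nsmul_le_sum _ _ _ fun b hb => (lt_card_rotEnds hG ?_ (hm1 b hb) ?_).le
            · intro h
              have := hm3 b hb
              simp [h] at this
            · rw [(hm2 b hb).length_eq]
              exact hmax
      · rintro ⟨a, b⟩ ⟨c, d⟩ h
        simpa using h
    · rintro x hx
      obtain ⟨⟨b, c⟩, hbc, rfl⟩ := mem_image.1 hx
      obtain ⟨hb, hc⟩ := mem_sigma.1 hbc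
      simp only at hb hc ⊢
      obtain ⟨t, ht⟩ := mem_rotEnds.1 hc
      obtain ⟨h1, h2, h3⟩ := ht.invariants (hm1 b hb)
      rw [hm3 b hb] at h3
      have h4 := h2.trans (hm2 b hb)
      have h5 := h4.length_eq
      have ht0 : t ≠ [] := by
        rintro rfl
        rw [List.length_singleton] at h5
        omega
      refine ⟨?_, fun H hH hadj => ?_⟩
      · rintro rfl
        refine (List.nodup_cons.1 h1.1).1 (List.mem_of_getLast? ?_)
        rw [← h3, List.getLast?_cons_of_ne_nil ht0]
      · have hclosed : ∀ y ∈ (c :: t).getLast?, ∀ z ∈ (c :: t).head?, H.Adj y z := by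
          intro y hy z hz
          rw [h3] at hy
          simp only [Option.mem_def, Option.some.injEq, List.head?_cons] at hy hz
          exact hy ▸ hz ▸ hadj
        rcases hle.eq_or_lt with heq | hlt
        · refine .inl (isHamiltonian_of_closed (h1.mono hH) hclosed (by omega) fun v => ?_)
          have : (c :: t).toFinset = univ := by
            refine eq_univ_of_card _ ?_
            rw [List.toFinset_card_of_nodup h1.1, h5, heq]
          exact List.mem_toFinset.1 (this ▸ mem_univ v)
        · obtain ⟨x, y, hx, hy, hxy⟩ := exists_adj_of_expands hG hl.1 hlt (by omega)
          have := exists_longer_of_closed (h1.mono hH) hclosed (fun h => hx (h4.mem_iff.1 h))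
            (h4.mem_iff.2 hy) (hH hxy)
          rw [h5] at this
          exact .inr this

end Boosters

section FirstMoment

open Finset

variable {V : Type*} [Fintype V] [DecidableEq V]

/-- A set of few vertices violating expansion yields a spanning tree of its closed neighbourhood,
encoded by a parent function. -/
lemma exists_parent_of_not_expands {G : SimpleGraph V} {k : ℕ} (hG : ¬ Expands G k) :
    ∃ (S W : Finset V) (r : V) (f : V → V), #S ≤ k ∧ #W < 2 * #S ∧ Disjoint S W ∧ r ∈ S ∧
      (∀ v ∈ (S ∪ W).erase r, f v ∈ S ∪ W ∧ G.Adj v (f v)) ∧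
      (∀ v ∉ (S ∪ W).erase r, f v = v) ∧
      Set.InjOn (fun v => s(v, f v)) ((S ∪ W).erase r) ∧
      ∀ a ∈ S, ∀ b ∉ S ∪ W, ¬ G.Adj a b := by
  classical
  simp only [Expands, not_forall, not_le] at hG
  obtain ⟨S, hS, r, hr, hconn, hW⟩ := hG
  set W := outNbhd G S with hWdef
  set T := touching G S with hT
  have hout : ∀ a ∈ S, ∀ b, G.Adj a b → b ∈ S ∪ W := by
    intro a ha b hab
    by_cases hb : b ∈ S
    · exact mem_union_left _ hb
    · exact mem_union_right _ (mem_outNbhd.2 ⟨hb, a, ha, hab⟩)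
  have hreach : ∀ v ∈ S ∪ W, T.Reachable v r := by
    intro v hv
    rcases mem_union.1 hv with hv | hv
    · exact (hconn v hv).symm
    · obtain ⟨-, u, hu, huv⟩ := mem_outNbhd.1 hv
      have e : T.Adj v u := ⟨huv.symm, .inr hu⟩
      exact e.reachable.trans (hconn u hu).symm
  have hpar : ∀ v ∈ (S ∪ W).erase r, ∃ u, T.Adj v u ∧ T.dist u r < T.dist v r := by
    intro v hv
    obtain ⟨hvr, hv⟩ := mem_erase.1 hv
    obtain ⟨w, hw⟩ := (hreach v hv).exists_walk_length_eq_dist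
    cases w with
    | nil => exact absurd rfl hvr
    | cons h w =>
      rw [SimpleGraph.Walk.length_cons] at hw
      exact ⟨_, h, by have := SimpleGraph.dist_le w; omega⟩
  choose! g hg1 hg2 using hpar
  set f : V → V := fun v => if v ∈ (S ∪ W).erase r then g v else v with hf
  have hfg : ∀ v ∈ (S ∪ W).erase r, f v = g v := fun v hv => if_pos hv
  refine ⟨S, W, r, f, hS, hW, ?_, hr, ?_, fun v hv => if_neg hv, ?_,
    fun a ha b hb hab => hb (hout a ha b hab)⟩
  · rw [disjoint_left]
    exact fun v hv hv' => (mem_outNbhd.1 hv').1 hv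
  · intro v hv
    rw [hfg v hv]
    have h := hg1 v hv
    refine ⟨?_, h.1⟩
    rcases h.2 with h' | h'
    · exact hout v h' _ h.1
    · exact mem_union_left _ h'
  · intro v hv v' hv' h
    rw [mem_coe] at hv hv'
    rcases Sym2.eq_iff.1 h with h | h
    · exact h.1
    · have h1 := hg2 v hv
      have h2 := hg2 v' hv'
      rw [← hfg v hv, h.2] at h1
      rw [← hfg v' hv', ← h.1] at h2
      omega

lemma bernProb_tree_le {p : ℝ} (h0 : 0 ≤ p) (h1 : p ≤ 1) {S W : Finset V} {r : V} {f : V → V}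
    (hr : r ∈ S) (hf : ∀ v ∈ S ∪ W, f v ∈ S ∪ W) :
    bernProb (⊤ : SimpleGraph V).edgeFinset p (fun F => Disjoint S W ∧
        Set.InjOn (fun v => s(v, f v)) ((S ∪ W).erase r) ∧
        ((S ∪ W).erase r).image (fun v => s(v, f v)) ⊆ F ∧
        Disjoint ((S ×ˢ (S ∪ W)ᶜ).image fun x => s(x.1, x.2)) F) ≤
      p ^ (#S + #W - 1) * (1 - p) ^ (#S * (Fintype.card V - (#S + #W))) := by
  set A := ((S ∪ W).erase r).image (fun v => s(v, f v)) with hA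
  set B := (S ×ˢ (S ∪ W)ᶜ).image fun x => s(x.1, x.2) with hB
  by_cases hcond : Disjoint S W ∧ Set.InjOn (fun v => s(v, f v)) ((S ∪ W).erase r) ∧
      A ⊆ (⊤ : SimpleGraph V).edgeFinset
  swap
  · rw [bernProb_eq_zero]
    · have := sub_nonneg.2 h1
      positivity
    · exact fun F hF h => hcond ⟨h.1, h.2.1, h.2.2.1.trans hF⟩
  obtain ⟨hSW, hinj, hAE⟩ := hcond
  have hcardA : #A = #S + #W - 1 := by
    rw [hA, card_image_of_injOn hinj, card_erase_of_mem (mem_union_left _ hr),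
      card_union_of_disjoint hSW]
  have hBmem : ∀ x ∈ S ×ˢ (S ∪ W)ᶜ, x.1 ∈ S ∪ W ∧ x.2 ∉ S ∪ W := fun x hx =>
    ⟨mem_union_left _ (mem_product.1 hx).1, mem_compl.1 (mem_product.1 hx).2⟩
  have hcardB : #B = #S * (Fintype.card V - (#S + #W)) := by
    rw [hB, card_image_of_injOn, card_product, card_compl, card_union_of_disjoint hSW]
    intro x hx y hy h
    have hx' := hBmem x hx
    have hy' := hBmem y hy
    rcases Sym2.eq_iff.1 h with h | h
    · exact Prod.ext h.1 h.2
    · exact absurd (h.2 ▸ hy'.1) hx'.2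
  have hBE : B ⊆ (⊤ : SimpleGraph V).edgeFinset := by
    intro e he
    obtain ⟨x, hx, rfl⟩ := mem_image.1 he
    have hx' := hBmem x hx
    rw [SimpleGraph.mem_edgeFinset, SimpleGraph.mem_edgeSet, SimpleGraph.top_adj]
    exact fun h => hx'.2 (h ▸ hx'.1)
  have hAB : Disjoint A B := by
    rw [disjoint_left]
    intro e he he'
    obtain ⟨v, hv, rfl⟩ := mem_image.1 he
    obtain ⟨x, hx, h⟩ := mem_image.1 he'
    have hx' := hBmem x hx
    have hv' := mem_of_mem_erase hv
    rcases Sym2.eq_iff.1 h with h | h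
    · exact hx'.2 (h.2 ▸ hf v hv')
    · exact hx'.2 (h.2 ▸ hv')
  rw [← hcardA, ← hcardB, ← bernProb_cylinder hAE hBE hAB]
  exact bernProb_mono h0 h1 fun F _ h => h.2.2

/-- First moment bound for the failure of expansion. -/
theorem bernProb_not_expands_le {p : ℝ} (h0 : 0 ≤ p) (h1 : p ≤ 1) (k : ℕ) :
    bernProb (⊤ : SimpleGraph V).edgeFinset p
        (fun F => ¬ Expands (SimpleGraph.fromEdgeSet (F : Set (Sym2 V))) k) ≤
      ∑ s ∈ Icc 1 k, ∑ w ∈ range (2 * s),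
        ((Fintype.card V).choose s : ℝ) * ((Fintype.card V).choose w * (s * ((s + w : ℕ) ^
          (s + w - 1) * (p ^ (s + w - 1) * (1 - p) ^ (s * (Fintype.card V - (s + w))))))) := by
  set E := (⊤ : SimpleGraph V).edgeFinset with hE
  calc _ ≤ bernProb E p (fun F => ∃ s ∈ Icc 1 k, ∃ w ∈ range (2 * s),
        ∃ S ∈ powersetCard s (univ : Finset V), ∃ W ∈ powersetCard w (univ : Finset V),
        ∃ r ∈ S, ∃ f ∈ Fintype.piFinset
          (fun v => if v ∈ (S ∪ W).erase r then S ∪ W else {v}),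
        Disjoint S W ∧ Set.InjOn (fun v => s(v, f v)) ((S ∪ W).erase r) ∧
        ((S ∪ W).erase r).image (fun v => s(v, f v)) ⊆ F ∧
        Disjoint ((S ×ˢ (S ∪ W)ᶜ).image fun x => s(x.1, x.2)) F) := by
        refine bernProb_mono h0 h1 fun F _ hF => ?_
        obtain ⟨S, W, r, f, hS, hW, hSW, hr, hf, hf', hinj, hno⟩ := exists_parent_of_not_expands hF
        refine ⟨#S, mem_Icc.2 ⟨card_pos.2 ⟨r, hr⟩, hS⟩, #W, mem_range.2 hW, S, by simp, W, by simp,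
          r, hr, f, ?_, hSW, hinj, ?_, ?_⟩
        · rw [Fintype.mem_piFinset]
          intro v
          split_ifs with hv
          · exact (hf v hv).1
          · exact mem_singleton.2 (hf' v hv)
        · intro e he
          obtain ⟨v, hv, rfl⟩ := mem_image.1 he
          exact ((SimpleGraph.fromEdgeSet_adj _).1 (hf v hv).2).1
        · rw [disjoint_left]
          intro e he heF
          obtain ⟨⟨a, b⟩, hab, rfl⟩ := mem_image.1 he
          obtain ⟨ha, hb⟩ := mem_product.1 hab
          have hb := mem_compl.1 hb
          exact hno a ha b hb ((SimpleGraph.fromEdgeSet_adj _).2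
            ⟨heF, fun h => hb (mem_union_left _ (h ▸ ha))⟩)
    _ ≤ _ := by
        refine (bernProb_exists_le h0 h1 _ _).trans (sum_le_sum fun s hs => ?_)
        refine (bernProb_exists_le h0 h1 _ _).trans (sum_le_sum fun w hw => ?_)
        have hp : 0 ≤ 1 - p := sub_nonneg.2 h1
        refine (bernProb_exists_le_card_mul h0 h1 _ _ fun S hS => ?_).trans_eq
          (by rw [card_powersetCard, card_univ])
        refine (bernProb_exists_le_card_mul h0 h1 _ _ fun W hW => ?_).trans_eq
          (by rw [card_powersetCard, card_univ])
        have hS := (mem_powersetCard.1 hS).2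
        have hW := (mem_powersetCard.1 hW).2
        refine (bernProb_exists_le_card_mul h0 h1 _ _ fun r hr => ?_).trans_eq (by rw [hS])
        by_cases hSW : Disjoint S W
        swap
        · rw [bernProb_eq_zero]
          · positivity
          · rintro F - ⟨f, -, h, -⟩
            exact hSW h
        refine (bernProb_exists_le_card_mul h0 h1 _ _ fun f hf => ?_).trans_eq
          (b := (#(Fintype.piFinset (fun v => if v ∈ (S ∪ W).erase r then S ∪ W else {v})) : ℝ) *
            (p ^ (s + w - 1) * (1 - p) ^ (s * (Fintype.card V - (s + w))))) ?_
        · rw [← hS, ← hW]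
          refine bernProb_tree_le h0 h1 hr fun v hv => ?_
          have := Fintype.mem_piFinset.1 hf v
          split_ifs at this with h
          · exact this
          · rwa [mem_singleton.1 this]
        · congr 1
          rw [Fintype.card_piFinset]
          have : ∀ v, #(if v ∈ (S ∪ W).erase r then S ∪ W else {v}) =
              if v ∈ (S ∪ W).erase r then s + w else 1 := by
            intro v
            split_ifs
            · rw [card_union_of_disjoint hSW, hS, hW]
            · simp
          simp_rw [this]
          rw [prod_ite_mem, univ_inter, prod_const, card_erase_of_mem (mem_union_left _ hr),
            card_union_of_disjoint hSW, hS, hW]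
          push_cast
          rfl

end FirstMoment

section Sprinkling

open Finset

lemma IsPathList.length_le {V : Type*} [Fintype V] {G : SimpleGraph V} {l : List V}
    (hl : IsPathList G l) : l.length ≤ Fintype.card V :=
  hl.1.length_le_card

variable {V : Type*} [Fintype V] [DecidableEq V]

open Classical in
/-- Zero for Hamiltonian graphs, and otherwise one more than the number of vertices missed by a
longest path. -/
noncomputable def deficit (G : SimpleGraph V) : ℕ :=
  if G.IsHamiltonian then 0 else
    Fintype.card V + 1 -
      Nat.findGreatest (fun m => ∃ l, IsPathList G l ∧ l.length = m) (Fintype.card V)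

lemma deficit_le (G : SimpleGraph V) : deficit G ≤ Fintype.card V + 1 := by
  unfold deficit
  split_ifs <;> omega

lemma exists_longest (G : SimpleGraph V) (hG : ¬ G.IsHamiltonian) :
    ∃ l, IsPathList G l ∧ (∀ l', IsPathList G l' → l'.length ≤ l.length) ∧
      deficit G = Fintype.card V + 1 - l.length := by
  classical
  have h0 : ∃ l, IsPathList G l ∧ l.length = 0 := ⟨[], ⟨by simp, by simp⟩, rfl⟩
  obtain ⟨l, hl, hlen⟩ := Nat.findGreatest_spec
    (P := fun m => ∃ l, IsPathList G l ∧ l.length = m) (Nat.zero_le (Fintype.card V)) h0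
  refine ⟨l, hl, fun l' hl' => ?_, by rw [deficit, if_neg hG, hlen]⟩
  rw [hlen]
  exact Nat.le_findGreatest hl'.length_le ⟨l', hl', rfl⟩

lemma deficit_le_of_isPathList {G : SimpleGraph V} {l : List V} (hl : IsPathList G l) :
    deficit G ≤ Fintype.card V + 1 - l.length := by
  by_cases hG : G.IsHamiltonian
  · simp [deficit, hG]
  · obtain ⟨l', -, hmax, h⟩ := exists_longest G hG
    rw [h]
    exact Nat.sub_le_sub_left (hmax l hl) _

lemma deficit_anti {G H : SimpleGraph V} (h : G ≤ H) : deficit H ≤ deficit G := by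
  by_cases hG : G.IsHamiltonian
  · simp [deficit, hG.mono h]
  · obtain ⟨l, hl, -, hd⟩ := exists_longest G hG
    exact hd ▸ deficit_le_of_isPathList (hl.mono h)

lemma Improves.deficit_lt {G H : SimpleGraph V} {l : List V} (hG : IsPathList G l)
    (hd : deficit G = Fintype.card V + 1 - l.length) (h : Improves l H) :
    deficit H < deficit G := by
  have := hG.length_le
  rcases h with h | ⟨l', hl', hlt⟩
  · simp only [deficit, h, if_true] at hd ⊢
    omega
  · have := deficit_le_of_isPathList hl'
    have := hl'.length_le
    omega

/-- Sprinkling edges on an expanding non-Hamiltonian graph lowers its expected deficit. -/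
lemma bernExp_deficit_le [Nonempty V] {k : ℕ} {q : ℝ} (h0 : 0 ≤ q) (h1 : q ≤ 1) (hk : 2 ≤ k)
    (hq : ∀ m, k ^ 2 ≤ 2 * m → (1 - q) ^ m ≤ 1 / 2) {S : Finset (Sym2 V)}
    (hS : Expands (SimpleGraph.fromEdgeSet (S : Set (Sym2 V))) k)
    (hH : ¬ (SimpleGraph.fromEdgeSet (S : Set (Sym2 V))).IsHamiltonian) :
    bernExp (⊤ : SimpleGraph V).edgeFinset q
        (fun T => deficit (SimpleGraph.fromEdgeSet ((S ∪ T : Finset (Sym2 V)) : Set (Sym2 V)))) ≤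
      deficit (SimpleGraph.fromEdgeSet (S : Set (Sym2 V))) - 1 / 2 := by
  classical
  obtain ⟨l, hl, hmax, hd⟩ := exists_longest _ hH
  have hne : l ≠ [] := by
    rintro rfl
    have := hmax [Classical.arbitrary V] ⟨by simp, by simp⟩
    simp at this
  obtain ⟨B, hB, hcard, hboost⟩ := exists_boosters hS hk hne hl hmax
  have hBE : B ⊆ (⊤ : SimpleGraph V).edgeFinset := fun e he => by simpa using hB e he
  have hprob : bernProb (⊤ : SimpleGraph V).edgeFinset q (fun T => ∅ ⊆ T ∧ Disjoint B T) ≤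
      1 / 2 := by
    rw [bernProb_cylinder (empty_subset _) hBE (disjoint_empty_left _)]
    simpa using hq _ hcard
  calc _ ≤ bernExp (⊤ : SimpleGraph V).edgeFinset q (fun T =>
        ((deficit (SimpleGraph.fromEdgeSet (S : Set (Sym2 V))) : ℝ) - 1) +
          if ∅ ⊆ T ∧ Disjoint B T then 1 else 0) := by
        refine bernExp_mono h0 h1 fun T hT => ?_
        have hle : SimpleGraph.fromEdgeSet (S : Set (Sym2 V)) ≤
            SimpleGraph.fromEdgeSet ((S ∪ T : Finset (Sym2 V)) : Set (Sym2 V)) :=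
          SimpleGraph.fromEdgeSet_mono (by simp)
        split_ifs with h
        · have := deficit_anti hle
          rw [sub_add_cancel]
          exact_mod_cast this
        · obtain ⟨e, heB, heT⟩ : ∃ e ∈ B, e ∈ T := by
            simpa [disjoint_left] using h
          have : deficit (SimpleGraph.fromEdgeSet ((S ∪ T : Finset (Sym2 V)) : Set (Sym2 V))) <
              deficit (SimpleGraph.fromEdgeSet (S : Set (Sym2 V))) :=
            (hboost e heB _ hle (by
              rw [SimpleGraph.edgeSet_fromEdgeSet]
              exact ⟨by simp [heT], hB e heB⟩)).deficit_lt hl hd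
          rw [add_zero, le_sub_iff_add_le]
          exact_mod_cast this
    _ ≤ _ := by
        rw [bernExp_add, bernExp_const, ← bernProb_eq_bernExp]
        linarith

/-- After `t` rounds of sprinkling with probability `q`, a set of density `p` has this density. -/
def sprinkled (p q : ℝ) (t : ℕ) : ℝ := 1 - (1 - p) * (1 - q) ^ t

section

variable {p q : ℝ}

lemma sprinkled_succ (p q : ℝ) (t : ℕ) :
    sprinkled p q (t + 1) = 1 - (1 - sprinkled p q t) * (1 - q) := by
  unfold sprinkled
  ring

lemma sprinkled_le_one (hp : p ≤ 1) (hq : q ≤ 1) (t : ℕ) : sprinkled p q t ≤ 1 := by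
  have := mul_nonneg (sub_nonneg.2 hp) (pow_nonneg (sub_nonneg.2 hq) t)
  unfold sprinkled
  linarith

lemma sprinkled_mono (hp : p ≤ 1) (h0 : 0 ≤ q) (h1 : q ≤ 1) : Monotone (sprinkled p q) := by
  refine monotone_nat_of_le_succ fun t => ?_
  rw [sprinkled_succ]
  nlinarith [sprinkled_le_one hp h1 t]

lemma le_sprinkled (hp : p ≤ 1) (h0 : 0 ≤ q) (h1 : q ≤ 1) (t : ℕ) : p ≤ sprinkled p q t := by
  simpa [sprinkled] using sprinkled_mono hp h0 h1 (Nat.zero_le t)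

lemma sprinkled_le (h : 0 ≤ p) (hp : p ≤ 1) (h0 : 0 ≤ q) (h1 : q ≤ 1) (t : ℕ) :
    sprinkled p q t ≤ p + t * q := by
  induction t with
  | zero => simp [sprinkled]
  | succ t ih =>
    rw [sprinkled_succ]
    push_cast
    nlinarith [le_sprinkled hp h0 h1 t]

end

/-- The probability of not being Hamiltonian after `T` rounds of sprinkling. -/
theorem bernProb_not_isHamiltonian_le [Nonempty V] {k T : ℕ} {p q η : ℝ} (hT : 0 < T)
    (hp0 : 0 ≤ p) (hp1 : p ≤ 1) (h0 : 0 ≤ q) (h1 : q ≤ 1) (hk : 2 ≤ k)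
    (hq : ∀ m, k ^ 2 ≤ 2 * m → (1 - q) ^ m ≤ 1 / 2)
    (hη : ∀ t < T, bernProb (⊤ : SimpleGraph V).edgeFinset (sprinkled p q t)
      (fun F => ¬ Expands (SimpleGraph.fromEdgeSet (F : Set (Sym2 V))) k) ≤ η) :
    bernProb (⊤ : SimpleGraph V).edgeFinset (sprinkled p q T)
        (fun F => ¬ (SimpleGraph.fromEdgeSet (F : Set (Sym2 V))).IsHamiltonian) ≤
      η + 2 * (Fintype.card V + 1) / T := by
  classical
  set E := (⊤ : SimpleGraph V).edgeFinset
  set g : Finset (Sym2 V) → SimpleGraph V := fun F => SimpleGraph.fromEdgeSet (F : Set (Sym2 V))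
  set A : ℕ → ℝ := fun t => bernExp E (sprinkled p q t) fun F => deficit (g F)
  have hs0 : ∀ t, 0 ≤ sprinkled p q t := fun t => hp0.trans (le_sprinkled hp1 h0 h1 t)
  have hs1 : ∀ t, sprinkled p q t ≤ 1 := sprinkled_le_one hp1 h1
  set P : ℝ := bernProb E (sprinkled p q T) fun F => ¬ (g F).IsHamiltonian with hP
  have hstep : ∀ t < T, A (t + 1) ≤ A t - 1 / 2 * (P - η) := by
    intro t ht
    have hanti : P ≤ bernProb E (sprinkled p q t) fun F => ¬ (g F).IsHamiltonian :=
      bernProb_antitone (hs0 t) (sprinkled_mono hp1 h0 h1 ht.le) (hs1 T) fun S S' hSS' hS =>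
        hSS' (hS.mono (SimpleGraph.fromEdgeSet_mono (by simp)))
    have hdrift : A (t + 1) ≤ bernExp E (sprinkled p q t) fun F => deficit (g F) +
        ((-1 / 2) * (if ¬ (g F).IsHamiltonian then 1 else 0) +
          1 / 2 * (if ¬ Expands (g F) k then 1 else 0)) := by
      change bernExp _ _ _ ≤ _
      rw [sprinkled_succ, ← bernExp_union]
      refine bernExp_mono (hs0 t) (hs1 t) fun F _ => ?_
      have hmono : bernExp E q (fun T => deficit (g (F ∪ T))) ≤ deficit (g F) := by
        rw [← bernExp_const E q (deficit (g F))]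
        refine bernExp_mono h0 h1 fun T _ => ?_
        exact_mod_cast deficit_anti (SimpleGraph.fromEdgeSet_mono (by simp))
      by_cases hH : (g F).IsHamiltonian
      · rw [if_neg (not_not.2 hH)]
        refine hmono.trans ?_
        split_ifs <;> norm_num
      · rw [if_pos hH]
        by_cases hE : Expands (g F) k
        · rw [if_neg (not_not.2 hE)]
          refine (bernExp_deficit_le h0 h1 hk hq hE hH).trans_eq ?_
          ring
        · rw [if_pos hE]
          linarith
    rw [bernExp_add, bernExp_add, bernExp_const_mul, bernExp_const_mul,
      ← bernProb_eq_bernExp, ← bernProb_eq_bernExp] at hdrift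
    have hηt := hη t ht
    change A (t + 1) ≤ A t + _ at hdrift
    linarith
  have hsum : ∀ t ≤ T, A t ≤ A 0 - t * (1 / 2 * (P - η)) := by
    intro t ht
    induction t with
    | zero => simp
    | succ t ih =>
      have := hstep t ht
      have := ih (by omega)
      push_cast
      linarith
  have hA0 : A 0 ≤ Fintype.card V + 1 := by
    rw [← bernExp_const E (sprinkled p q 0) (Fintype.card V + 1)]
    exact bernExp_mono (hs0 0) (hs1 0) fun F _ => by exact_mod_cast deficit_le _
  have hAT : 0 ≤ A T := by
    rw [← bernExp_const E (sprinkled p q T) 0]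
    exact bernExp_mono (hs0 T) (hs1 T) fun F _ => by positivity
  have := hsum T le_rfl
  have hT' : (0 : ℝ) < T := by exact_mod_cast hT
  rw [← sub_le_iff_le_add', le_div_iff₀ hT']
  linarith

end Sprinkling

section Asymptotics

open Finset

lemma choose_mul_choose_mul_pow_le (n s w : ℕ) :
    (n.choose s : ℝ) * n.choose w * ((s + w : ℕ) : ℝ) ^ (s + w) ≤ (6 * n) ^ (s + w) := by
  have h1 : (n.choose s : ℝ) ≤ n ^ s / s.factorial := Nat.choose_le_pow_div s n
  have h2 : (n.choose w : ℝ) ≤ n ^ w / w.factorial := Nat.choose_le_pow_div w n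
  have h3 : ((s + w : ℕ) : ℝ) ^ (s + w) / (s + w).factorial ≤ 3 ^ (s + w) := by
    refine (Real.pow_div_factorial_le_exp _ (Nat.cast_nonneg _) _).trans ?_
    rw [← mul_one ((s + w : ℕ) : ℝ), Real.exp_nat_mul]
    exact pow_le_pow_left₀ (Real.exp_pos _).le (Real.exp_one_lt_d9.le.trans (by norm_num)) _
  have h4 : ((s + w).factorial : ℝ) / (s.factorial * w.factorial) ≤ 2 ^ (s + w) := by
    rw [← Nat.cast_add_choose ℝ]
    exact_mod_cast Nat.choose_le_two_pow _ _
  calc _ ≤ (n : ℝ) ^ s / s.factorial * (n ^ w / w.factorial) *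
        ((s + w : ℕ) : ℝ) ^ (s + w) := by gcongr
    _ = n ^ (s + w) * (((s + w).factorial : ℝ) / (s.factorial * w.factorial)) *
        (((s + w : ℕ) : ℝ) ^ (s + w) / (s + w).factorial) := by
      have := Nat.factorial_ne_zero (s + w)
      field_simp
      ring
    _ ≤ n ^ (s + w) * 2 ^ (s + w) * 3 ^ (s + w) := by gcongr
    _ = _ := by
      rw [← mul_pow, ← mul_pow]
      ring

lemma first_moment_term_le {n s w : ℕ} {p : ℝ} (h0 : 0 ≤ p) (h1 : p ≤ 1) (hd : 1 ≤ n * p)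
    (hs : 1 ≤ s) (hw : w < 2 * s) (hn : 3 * s ≤ n) :
    (n.choose s : ℝ) * (n.choose w * (s * ((s + w : ℕ) ^ (s + w - 1) *
        (p ^ (s + w - 1) * (1 - p) ^ (s * (n - (s + w))))))) ≤
      216 ^ s * n * (n * p) ^ (3 * s - 2) * Real.exp (-(p * (s * (n - 3 * s)))) := by
  obtain ⟨m, hm⟩ : ∃ m, s + w = m + 1 := ⟨s + w - 1, by omega⟩
  have hexp : (1 - p) ^ (s * (n - (s + w))) ≤ Real.exp (-(p * (s * (n - 3 * s)))) := by
    calc (1 - p) ^ (s * (n - (s + w))) ≤ Real.exp (-p) ^ (s * (n - (s + w))) :=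
          pow_le_pow_left₀ (sub_nonneg.2 h1) (Real.one_sub_le_exp_neg p) _
      _ = Real.exp (-(p * (s * (n - (s + w) : ℕ)))) := by
          rw [← Real.exp_nat_mul]
          push_cast
          ring_nf
      _ ≤ _ := by
          rw [Real.exp_le_exp, neg_le_neg_iff]
          have : (n : ℝ) - 3 * s ≤ (n - (s + w) : ℕ) := by
            rw [sub_le_iff_le_add]
            exact_mod_cast (by omega : n ≤ n - (s + w) + 3 * s)
          gcongr
  have hchoose := choose_mul_choose_mul_pow_le n s w
  have hsw : (s : ℝ) ≤ (s + w : ℕ) := by exact_mod_cast Nat.le_add_right s w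
  rw [hm] at hexp hchoose hsw ⊢
  rw [Nat.add_sub_cancel]
  have hp' := sub_nonneg.2 h1
  calc _ = ((n.choose s : ℝ) * n.choose w * (s * ((m + 1 : ℕ) : ℝ) ^ m)) *
        (p ^ m * (1 - p) ^ (s * (n - (m + 1)))) := by ring
    _ ≤ ((n.choose s : ℝ) * n.choose w * (((m + 1 : ℕ) : ℝ) * ((m + 1 : ℕ) : ℝ) ^ m)) *
        (p ^ m * Real.exp (-(p * (s * (n - 3 * s))))) := by gcongr
    _ ≤ (6 * n) ^ (m + 1) * (p ^ m * Real.exp (-(p * (s * (n - 3 * s))))) := by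
        rw [← pow_succ']
        gcongr
    _ = 6 ^ (m + 1) * n * (n * p) ^ m * Real.exp (-(p * (s * (n - 3 * s)))) := by
        rw [mul_pow, mul_pow]
        ring
    _ ≤ 6 ^ (3 * s) * n * (n * p) ^ (3 * s - 2) * Real.exp (-(p * (s * (n - 3 * s)))) := by
        gcongr
        · norm_num
        · omega
        · omega
    _ = _ := by rw [pow_mul]; norm_num

/-- The upper bound for the ratio of the geometric series dominating the first moment. -/
noncomputable def momentRatio (L : ℝ) : ℝ := 11664 * (L ^ 3 * Real.exp (-(3 / 4 * L)))

lemma first_moment_row_le {n s : ℕ} {p : ℝ} (h0 : 0 ≤ p) (h1 : p ≤ 1)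
    (hd : 1 ≤ n * p) (hL : Real.log n ≤ n * p) (hU : n * p ≤ 3 * Real.log n)
    (hs : 1 ≤ s) (hn : 12 * s ≤ n) :
    ∑ w ∈ range (2 * s), (n.choose s : ℝ) * (n.choose w * (s * ((s + w : ℕ) ^ (s + w - 1) *
        (p ^ (s + w - 1) * (1 - p) ^ (s * (n - (s + w))))))) ≤
      n * momentRatio (Real.log n) ^ s := by
  have hlog : 0 ≤ Real.log n := Real.log_natCast_nonneg n
  have hsn : (12 : ℝ) * s ≤ n := by exact_mod_cast hn
  have h2s : ((2 * s : ℕ) : ℝ) ≤ 2 ^ s := by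
    exact_mod_cast Nat.mul_le_pow (by norm_num) s
  calc _ ≤ ∑ w ∈ range (2 * s),
        216 ^ s * n * (n * p) ^ (3 * s - 2) * Real.exp (-(p * (s * (n - 3 * s)))) :=
        sum_le_sum fun w hw =>
          first_moment_term_le h0 h1 hd hs (mem_range.1 hw) (by omega)
    _ = (2 * s : ℕ) *
        (216 ^ s * n * (n * p) ^ (3 * s - 2) * Real.exp (-(p * (s * (n - 3 * s))))) := by
        rw [sum_const, card_range, nsmul_eq_mul]
    _ ≤ 2 ^ s * (216 ^ s * n * (3 * Real.log n) ^ (3 * s) *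
        Real.exp (s * -(3 / 4 * Real.log n))) := by
        gcongr
        · calc (n * p) ^ (3 * s - 2) ≤ (n * p) ^ (3 * s) := pow_le_pow_right₀ hd (by omega)
            _ ≤ _ := by gcongr
        · have : p * (s * (3 / 4 * n)) ≤ p * (s * (n - 3 * s)) := by gcongr; linarith
          have : (s : ℝ) * Real.log n ≤ s * (n * p) := by gcongr
          linarith
    _ = _ := by
        rw [Real.exp_nat_mul, momentRatio, pow_mul,
          show (11664 : ℝ) = 2 * 216 * 27 by norm_num]
        simp only [mul_pow]
        norm_num
        ring

lemma first_moment_row_one_le {n : ℕ} {p Ω : ℝ} (h0 : 0 ≤ p) (h1 : p ≤ 1) (hn0 : 3 ≤ n)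
    (hd : 1 ≤ n * p) (hL : Real.log n + Real.log (Real.log n) + Ω ≤ n * p)
    (hU : n * p ≤ 3 * Real.log n) :
    ∑ w ∈ range (2 * 1), (n.choose 1 : ℝ) * (n.choose w * ((1 : ℕ) *
        ((1 + w : ℕ) ^ (1 + w - 1) *
        (p ^ (1 + w - 1) * (1 - p) ^ (1 * (n - (1 + w))))))) ≤
      1296 * Real.exp 3 * Real.exp (-Ω) := by
  have hn : (0 : ℝ) < n := by exact_mod_cast (by omega : 0 < n)
  have hlog : 0 < Real.log n := Real.log_pos (by exact_mod_cast (by omega : 1 < n))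
  calc _ ≤ ∑ w ∈ range (2 * 1),
        216 ^ 1 * n * (n * p) ^ (3 * 1 - 2) * Real.exp (-(p * ((1 : ℕ) * (n - 3 * (1 : ℕ))))) :=
        sum_le_sum fun w hw =>
          first_moment_term_le h0 h1 hd le_rfl (mem_range.1 hw) (by omega)
    _ = 432 * (n * (n * p) * Real.exp (-(p * (n - 3)))) := by
        rw [sum_const, card_range, nsmul_eq_mul]
        norm_num
        ring
    _ ≤ 432 * (n * (3 * Real.log n) *
        Real.exp (3 + -Ω - Real.log n - Real.log (Real.log n))) := by
        gcongr
        linarith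
    _ = _ := by
        rw [Real.exp_sub, Real.exp_sub, Real.exp_add, Real.exp_log hlog, Real.exp_log hn]
        field_simp
        norm_num

variable {V : Type*} [Fintype V] [DecidableEq V]

lemma bernProb_not_expands_le_momentRatio {n k : ℕ} (hV : Fintype.card V = n) {p Ω : ℝ} (h0 : 0 ≤ p)
    (h1 : p ≤ 1) (hn : 3 ≤ n) (hk : 12 * k ≤ n) (hd : 1 ≤ n * p) (hL' : Real.log n ≤ n * p)
    (hL : Real.log n + Real.log (Real.log n) + Ω ≤ n * p)
    (hU : n * p ≤ 3 * Real.log n) (hx : momentRatio (Real.log n) ≤ 1 / 2) :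
    bernProb (⊤ : SimpleGraph V).edgeFinset p
        (fun F => ¬ Expands (SimpleGraph.fromEdgeSet (F : Set (Sym2 V))) k) ≤
      1296 * Real.exp 3 * Real.exp (-Ω) + 2 * (n * momentRatio (Real.log n) ^ 2) := by
  have hx0 : 0 ≤ momentRatio (Real.log n) := by
    have := Real.log_natCast_nonneg n
    unfold momentRatio
    positivity
  refine (bernProb_not_expands_le h0 h1 k).trans ?_
  rw [hV]
  calc _ ≤ ∑ s ∈ Icc 1 k, ((if s = 1 then 1296 * Real.exp 3 * Real.exp (-Ω) else 0) +
        if 2 ≤ s then n * momentRatio (Real.log n) ^ s else 0) := by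
        refine sum_le_sum fun s hs => ?_
        obtain ⟨hs1, hsk⟩ := mem_Icc.1 hs
        rcases hs1.eq_or_lt with rfl | hs2
        · simpa using first_moment_row_one_le h0 h1 hn hd hL hU
        · rw [if_neg (by omega), if_pos (show 2 ≤ s from hs2), zero_add]
          exact first_moment_row_le h0 h1 hd hL' hU hs1 (by omega)
    _ ≤ _ := by
        rw [sum_add_distrib]
        gcongr
        · rw [sum_ite_eq']
          split_ifs
          · rfl
          · positivity
        · rw [← sum_filter]
          calc _ = n * ∑ s ∈ Ico 2 (k + 1), momentRatio (Real.log n) ^ s := by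
                rw [mul_sum]
                refine sum_congr ?_ fun _ _ => rfl
                ext s
                simp only [mem_filter, mem_Icc, mem_Ico]
                omega
            _ ≤ n * (momentRatio (Real.log n) ^ 2 / (1 - momentRatio (Real.log n))) := by
                gcongr
                exact geom_sum_Ico_le_of_lt_one hx0 (by linarith)
            _ ≤ n * (momentRatio (Real.log n) ^ 2 / (1 / 2)) := by
                gcongr
                linarith
            _ = _ := by ring

lemma tendsto_momentRatio :
    Filter.Tendsto (fun n : ℕ => momentRatio (Real.log n)) Filter.atTop (nhds 0) := by
  have h := (tendsto_rpow_mul_exp_neg_mul_atTop_nhds_zero 3 (3 / 4) (by norm_num)).const_mul 11664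
  rw [mul_zero] at h
  refine (h.comp (Real.tendsto_log_atTop.comp tendsto_natCast_atTop_atTop)).congr fun n => ?_
  simp [momentRatio]

lemma tendsto_mul_momentRatio_sq :
    Filter.Tendsto (fun n : ℕ => 2 * (n * momentRatio (Real.log n) ^ 2)) Filter.atTop
      (nhds 0) := by
  have h := (tendsto_rpow_mul_exp_neg_mul_atTop_nhds_zero 6 (1 / 2) (by norm_num)).const_mul
    (2 * 11664 ^ 2)
  rw [mul_zero] at h
  refine (h.comp (Real.tendsto_log_atTop.comp tendsto_natCast_atTop_atTop)).congr' ?_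
  filter_upwards [Filter.eventually_gt_atTop 0] with n hn
  have hn : (0 : ℝ) < n := by exact_mod_cast hn
  have he : Real.exp (-(1 / 2) * Real.log n) = n * Real.exp (-(3 / 4 * Real.log n)) ^ 2 := by
    nth_rw 2 [← Real.exp_log hn]
    rw [← Real.exp_nat_mul, ← Real.exp_add]
    push_cast
    ring_nf
  have h6 : Real.log n ^ (6 : ℝ) = Real.log n ^ 6 := by exact_mod_cast Real.rpow_natCast _ 6
  simp only [Function.comp_apply, momentRatio, he, h6]
  ring

end Asymptotics

section Main

open Finset Filter

lemma erProb_eq_bernProb (n : ℕ) (p : ℝ) (A : Set (SimpleGraph (Fin n))) :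
    erProb n p A = bernProb (⊤ : SimpleGraph (Fin n)).edgeFinset p
      (fun F => SimpleGraph.fromEdgeSet (F : Set (Sym2 (Fin n))) ∈ A) := by
  classical
  rw [bernProb_eq_bernExp]
  unfold erProb bernExp
  refine sum_nbij' (fun G => G.edgeFinset)
    (fun S => SimpleGraph.fromEdgeSet (S : Set (Sym2 (Fin n))))
    (fun G _ => mem_powerset.2 (SimpleGraph.edgeFinset_mono le_top)) (fun _ _ => mem_univ _)
    (fun G _ => by simp) (fun S hS => ?_) (fun G _ => ?_)
  · ext e
    have he : e ∈ S → ¬ e.IsDiag := fun h => by simpa using mem_powerset.1 hS h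
    simpa using he
  · have hcard : G.edgeSet.ncard = #G.edgeFinset := by
      rw [← SimpleGraph.coe_edgeFinset, Set.ncard_coe_finset]
    simp only [SimpleGraph.coe_edgeFinset, SimpleGraph.fromEdgeSet_edgeSet,
      SimpleGraph.card_edgeFinset_top_eq_card_choose_two, Fintype.card_fin, hcard]
    split_ifs <;> simp

lemma sprinkle_pow_le {n m : ℕ} (hn : 1000 ≤ n) (hm : (n / 12) ^ 2 ≤ 2 * m) :
    (1 - 1000 / (n : ℝ) ^ 2) ^ m ≤ 1 / 2 := by
  have hn' : (1000 : ℝ) ≤ n := by exact_mod_cast hn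
  have hk : (n : ℝ) / 13 ≤ (n / 12 : ℕ) := by
    rw [div_le_iff₀ (by norm_num)]
    exact_mod_cast (by omega : n ≤ n / 12 * 13)
  have hm' : ((n / 12 : ℕ) : ℝ) ^ 2 ≤ 2 * m := by exact_mod_cast hm
  have hmn : (n : ℝ) ^ 2 / 338 ≤ m := by
    have : ((n : ℝ) / 13) ^ 2 ≤ ((n / 12 : ℕ) : ℝ) ^ 2 := by gcongr
    linarith
  have h1 : 1000 / (n : ℝ) ^ 2 ≤ 1 := by
    rw [div_le_one (by positivity)]
    nlinarith
  calc _ ≤ Real.exp (-(1000 / (n : ℝ) ^ 2)) ^ m :=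
        pow_le_pow_left₀ (sub_nonneg.2 h1) (Real.one_sub_le_exp_neg _) _
    _ = Real.exp (-(m * (1000 / (n : ℝ) ^ 2))) := by
        rw [← Real.exp_nat_mul]
        ring_nf
    _ ≤ Real.exp (-1) := by
        rw [Real.exp_le_exp, neg_le_neg_iff]
        calc (1 : ℝ) ≤ n ^ 2 / 338 * (1000 / n ^ 2) := by
              field_simp
              norm_num
          _ ≤ _ := by gcongr
    _ ≤ 1 / 2 := by
        rw [Real.exp_neg, one_div]
        gcongr
        linarith [Real.add_one_le_exp 1]

lemma eventually_not_isHamiltonian_le {ω : ℕ → ℝ} (hω : Tendsto ω atTop atTop)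
    (hp : ∀ᶠ n : ℕ in atTop, (Real.log n + Real.log (Real.log n) + ω n) / n ≤ 1)
    {ε : ℝ} (hε : 0 < ε) :
    ∀ᶠ n : ℕ in atTop, bernProb (⊤ : SimpleGraph (Fin n)).edgeFinset
      ((Real.log n + Real.log (Real.log n) + ω n) / n)
      (fun F => ¬ (SimpleGraph.fromEdgeSet (F : Set (Sym2 (Fin n)))).IsHamiltonian) < ε := by
  obtain ⟨M, hM⟩ := exists_nat_gt (8 / ε)
  have hM0 : (0 : ℝ) < M := (by positivity : (0 : ℝ) < 8 / ε).trans hM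
  obtain ⟨Ω, hΩ, hΩ0⟩ : ∃ Ω : ℝ, 1296 * Real.exp 3 * Real.exp (-Ω) < ε / 4 ∧ 0 ≤ Ω := by
    have h := (Real.tendsto_exp_neg_atTop_nhds_zero).const_mul (1296 * Real.exp 3)
    rw [mul_zero] at h
    exact ((h.eventually_lt_const (by positivity)).and (eventually_ge_atTop 0)).exists
  have hlog : Tendsto (fun n : ℕ => Real.log n) atTop atTop :=
    Real.tendsto_log_atTop.comp tendsto_natCast_atTop_atTop
  have hloglog : Tendsto (fun n : ℕ => Real.log (Real.log n)) atTop atTop :=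
    Real.tendsto_log_atTop.comp hlog
  filter_upwards [hp, eventually_ge_atTop 1000, hω.eventually_ge_atTop (Ω + 2000 * M),
    hlog.eventually_ge_atTop (Ω + 2000 * M + 1), hloglog.eventually_ge_atTop 0,
    tendsto_momentRatio.eventually_le_const (by norm_num : (0 : ℝ) < 1 / 2),
    tendsto_mul_momentRatio_sq.eventually_lt_const (by positivity : 0 < ε / 4)]
    with n hp1 hn hωn hlogn hllogn hx hx2
  have hn0 : (0 : ℝ) < n := by exact_mod_cast (by omega : 0 < n)
  have hn1 : (1000 : ℝ) ≤ n := by exact_mod_cast hn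
  have : Nonempty (Fin n) := ⟨⟨0, by omega⟩⟩
  have hll : Real.log (Real.log n) ≤ Real.log n := Real.log_le_self (Real.log_natCast_nonneg n)
  set L := Real.log n with hL
  set LL := Real.log L with hLL
  set p : ℝ := (L + LL + ω n) / n with hp
  set p₀ : ℝ := (L + LL + Ω) / n with hp₀
  set q : ℝ := 1000 / (n : ℝ) ^ 2 with hq
  set T : ℕ := M * (n + 1) with hT
  have hq0 : 0 ≤ q := by positivity
  have hq1 : q ≤ 1 := by
    rw [hq, div_le_one (by positivity)]
    nlinarith
  have hnp : n * p = L + LL + ω n := by rw [hp]; field_simp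
  have hnp₀ : n * p₀ = L + LL + Ω := by rw [hp₀]; field_simp
  have hp₀0 : 0 ≤ p₀ := div_nonneg (by linarith) hn0.le
  have hp₀p : p₀ ≤ p := by
    rw [hp, hp₀]
    gcongr
    linarith
  have hp₀1 := hp₀p.trans hp1
  have hTq : n * (T * q) ≤ 2000 * M := by
    have : (n : ℝ) * (T * q) = 1000 * M * ((n + 1) / n) := by
      rw [hq, hT]
      push_cast
      field_simp
    rw [this]
    have : ((n : ℝ) + 1) / n ≤ 2 := by
      rw [div_le_iff₀ hn0]
      linarith
    nlinarith
  have hs : ∀ t ≤ T, n * sprinkled p₀ q t ≤ L + LL + Ω + 2000 * M := by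
    intro t ht
    calc (n : ℝ) * sprinkled p₀ q t ≤ n * (p₀ + T * q) := by
          gcongr
          refine (sprinkled_le hp₀0 hp₀1 hq0 hq1 t).trans ?_
          gcongr
      _ ≤ _ := by rw [mul_add, hnp₀]; linarith
  have hpT : sprinkled p₀ q T ≤ p := by
    refine le_of_mul_le_mul_left ?_ hn0
    rw [hnp]
    linarith [hs T le_rfl]
  have hTpos : 0 < T := by
    have : 0 < M := by exact_mod_cast hM0
    positivity
  have hη : ∀ t < T, bernProb (⊤ : SimpleGraph (Fin n)).edgeFinset (sprinkled p₀ q t)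
      (fun F => ¬ Expands (SimpleGraph.fromEdgeSet (F : Set (Sym2 (Fin n)))) (n / 12)) ≤
      ε / 2 := by
    intro t ht
    have hle := le_sprinkled hp₀1 hq0 hq1 t
    have hlow : L + LL + Ω ≤ n * sprinkled p₀ q t := by
      rw [← hnp₀]
      gcongr
    have hup := hs t ht.le
    refine (bernProb_not_expands_le_momentRatio (Ω := Ω) (Fintype.card_fin n) (hp₀0.trans hle)
      (sprinkled_le_one hp₀1 hq1 t) (by omega) (by omega) (by linarith) (by linarith) hlow
      (by linarith) hx).trans ?_
    linarith
  have hmain := bernProb_not_isHamiltonian_le hTpos hp₀0 hp₀1 hq0 hq1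
    (by omega : 2 ≤ n / 12) (fun m hm => sprinkle_pow_le hn hm) hη
  calc _ ≤ bernProb (⊤ : SimpleGraph (Fin n)).edgeFinset (sprinkled p₀ q T)
        (fun F => ¬ (SimpleGraph.fromEdgeSet (F : Set (Sym2 (Fin n)))).IsHamiltonian) :=
        bernProb_antitone (hp₀0.trans (le_sprinkled hp₀1 hq0 hq1 T)) hpT hp1
          fun S S' hSS' hS => hSS' (hS.mono (SimpleGraph.fromEdgeSet_mono (by simp)))
    _ ≤ _ := hmain
    _ = ε / 2 + 2 / M := by
        rw [Fintype.card_fin, hT]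
        push_cast
        field_simp
    _ < ε := by
        have : 2 / (M : ℝ) < ε / 2 := by
          rw [div_lt_iff₀ hε] at hM
          rw [div_lt_iff₀ hM0]
          linarith
        linarith

end Main

end ErdosRenyi

/-- If `ω n → +∞` and `p n = (log n + log log n + ω n) / n` (with `0 ≤ p n ≤ 1` for large
`n`), then `G(n, p n)` is Hamiltonian with high probability. -/
theorem er_hamiltonian_whp (ω : ℕ → ℝ) (hω : Filter.Tendsto ω Filter.atTop Filter.atTop)
    (hp : ∀ᶠ n : ℕ in Filter.atTop,
      0 ≤ (Real.log n + Real.log (Real.log n) + ω n) / n ∧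
      (Real.log n + Real.log (Real.log n) + ω n) / n ≤ 1) :
    Filter.Tendsto
      (fun n : ℕ => erProb n ((Real.log n + Real.log (Real.log n) + ω n) / n)
        {G | G.IsHamiltonian})
      Filter.atTop (nhds 1) := by
  rw [Metric.tendsto_nhds]
  intro ε hε
  filter_upwards [hp, ErdosRenyi.eventually_not_isHamiltonian_le hω (hp.mono fun _ h => h.2) hε]
    with n ⟨h0, h1⟩ hn
  have hnonneg := ErdosRenyi.bernProb_nonneg (E := (⊤ : SimpleGraph (Fin n)).edgeFinset) h0 h1
    fun F => ¬ (SimpleGraph.fromEdgeSet (F : Set (Sym2 (Fin n)))).IsHamiltonian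
  rw [ErdosRenyi.bernProb_not] at hn hnonneg
  rw [ErdosRenyi.erProb_eq_bernProb, dist_comm, Real.dist_eq]
  exact (abs_of_nonneg hnonneg).trans_lt hn
end

section
/- Let α : ℕ → ℝ be a sequence with α(n) → +∞, and let p : ℕ → [0,1] satisfy p(n) ≥ (log n + α(n))/n for all large n. Then with high probability the Erdős–Rényi random graph G(n, p(n)) has proper connection number at most 2; that is, the probability that G(n, p(n)) admits an edge-coloring with 2 colors in which every pair of distinct vertices is connected by a proper path tends to 1 as n tends to infinity. -/
/-- An edge-coloring `c` (on unordered pairs of vertices) makes `G` properly connected if every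
pair of distinct vertices is joined by a path whose consecutive edges receive different colors. -/
def IsProperPathColoring {V : Type*} (G : SimpleGraph V) (c : Sym2 V → ℕ) : Prop :=
  ∀ u v : V, u ≠ v → ∃ p : G.Walk u v, p.IsPath ∧ (p.edges.map c).Chain' (· ≠ ·)

/-- The proper connection number of `G`: the least `k` such that some edge-coloring using at most
`k` colors is a proper-path coloring of `G`. -/
noncomputable def properConnectionNumber {V : Type*} (G : SimpleGraph V) : ℕ :=
  sInf {k | ∃ c : Sym2 V → ℕ, (∀ e, c e < k) ∧ IsProperPathColoring G c}

/-- The edges of `G` that advance the residue of the vertex label modulo 4 by one. -/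
def Forward {n : ℕ} (G : SimpleGraph (Fin n)) (u v : Fin n) : Prop :=
  G.Adj u v ∧ v.val % 4 = (u.val + 1) % 4

/-- The color of the pair `u, v`, relative to a set `Γ` of good vertices. Inside `Γ` a forward edge
receives the parity of its source and an edge between vertices of equal parity receives that
parity; an edge leaving `Γ` receives the parity opposite to that of its end in `Γ`. -/
def endpointColor {n : ℕ} (Γ : Finset (Fin n)) (u v : Fin n) : ℕ :=
  if u ∈ Γ then
    if v ∈ Γ then
      if u.val % 2 = v.val % 2 then u.val % 2
      else if v.val % 4 = (u.val + 1) % 4 then u.val % 2 else v.val % 2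
    else 1 - u.val % 2
  else if v ∈ Γ then 1 - v.val % 2 else 0

theorem endpointColor_comm {n : ℕ} (Γ : Finset (Fin n)) (u v : Fin n) :
    endpointColor Γ u v = endpointColor Γ v u := by
  unfold endpointColor
  split_ifs <;> omega

/-- The 2-coloring of pairs of vertices determined by a set `Γ` of good vertices. -/
def pairColor {n : ℕ} (Γ : Finset (Fin n)) : Sym2 (Fin n) → ℕ :=
  Sym2.lift ⟨endpointColor Γ, endpointColor_comm Γ⟩

theorem pairColor_lt_two {n : ℕ} (Γ : Finset (Fin n)) (e : Sym2 (Fin n)) :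
    pairColor Γ e < 2 := by
  induction e using Sym2.ind with
  | _ u v =>
    simp only [pairColor, Sym2.lift_mk, endpointColor]
    split_ifs <;> omega

theorem pairColor_forward {n : ℕ} {G : SimpleGraph (Fin n)} {Γ : Finset (Fin n)} {u v : Fin n}
    (hu : u ∈ Γ) (hv : v ∈ Γ) (h : Forward G u v) : pairColor Γ s(u, v) = u.val % 2 := by
  simp only [pairColor, Sym2.lift_mk, endpointColor, if_pos hu, if_pos hv, if_pos h.2, ite_self]

theorem pairColor_of_parity_eq {n : ℕ} {Γ : Finset (Fin n)} {u v : Fin n}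
    (hu : u ∈ Γ) (hv : v ∈ Γ) (h : u.val % 2 = v.val % 2) :
    pairColor Γ s(u, v) = u.val % 2 := by
  simp only [pairColor, Sym2.lift_mk, endpointColor, if_pos hu, if_pos hv, if_pos h]

theorem pairColor_pendant {n : ℕ} {Γ : Finset (Fin n)} {b x : Fin n}
    (hb : b ∉ Γ) (hx : x ∈ Γ) : pairColor Γ s(b, x) = 1 - x.val % 2 := by
  simp only [pairColor, Sym2.lift_mk, endpointColor, if_pos hx, if_neg hb]

/-- `a` is reached from `x` by a path inside `R` whose colors alternate, even when the color
opposite to the parity of `x` is put in front and the parity of `a` is appended. -/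
def ReachIn {n : ℕ} (G : SimpleGraph (Fin n)) (Γ R : Finset (Fin n)) (x a : Fin n) : Prop :=
  ∃ p : G.Walk x a, p.IsPath ∧ (∀ w ∈ p.support, w ∈ R) ∧
    List.IsChain (· ≠ ·) ((1 - x.val % 2) :: p.edges.map (pairColor Γ) ++ [a.val % 2])

theorem ReachIn.mono {n : ℕ} {G : SimpleGraph (Fin n)} {Γ R R' : Finset (Fin n)} {x a : Fin n}
    (h : ReachIn G Γ R x a) (hR : R ⊆ R') : ReachIn G Γ R' x a := by
  obtain ⟨p, hp, hs, hc⟩ := h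
  exact ⟨p, hp, fun w hw => hR (hs w hw), hc⟩

theorem ReachIn.refl {n : ℕ} (G : SimpleGraph (Fin n)) (Γ : Finset (Fin n)) (x : Fin n) :
    ReachIn G Γ {x} x x := by
  refine ⟨SimpleGraph.Walk.nil, SimpleGraph.Walk.IsPath.nil, by simp, ?_⟩
  simp only [SimpleGraph.Walk.edges_nil, List.map_nil, List.cons_append, List.nil_append,
    List.isChain_cons_cons, List.isChain_singleton, and_true]
  omega

theorem ReachIn.step {n : ℕ} {G : SimpleGraph (Fin n)} {Γ R : Finset (Fin n)} {x a w : Fin n}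
    (h : ReachIn G Γ R x a) (ha : a ∈ Γ) (hw : w ∈ Γ) (hwR : w ∉ R) (hf : Forward G a w) :
    ReachIn G Γ (insert w R) x w := by
  obtain ⟨p, hp, hs, hc⟩ := h
  refine ⟨p.concat hf.1, hp.concat (fun h => hwR (hs _ h)) hf.1, ?_, ?_⟩
  · intro z hz
    rw [SimpleGraph.Walk.support_concat] at hz
    simp only [List.mem_append, List.mem_singleton] at hz
    rcases hz with hz | rfl
    · exact Finset.mem_insert_of_mem (hs _ hz)
    · exact Finset.mem_insert_self _ _
  · rw [SimpleGraph.Walk.edges_concat]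
    simp only [List.concat_eq_append, List.map_append, List.map_cons, List.map_nil,
      pairColor_forward ha hw hf]
    have h2 : List.IsChain (· ≠ ·) ([a.val % 2] ++ [w.val % 2]) := by
      simp only [List.cons_append, List.nil_append, List.isChain_cons_cons,
        List.isChain_singleton, and_true]
      have := hf.2
      omega
    have := List.IsChain.append_overlap hc h2 (by simp)
    simpa using this

theorem exists_path_of_reachIn {n : ℕ} {G : SimpleGraph (Fin n)} {Γ R R' : Finset (Fin n)}
    {x y a a' : Fin n} (hR : R ⊆ Γ) (hR' : R' ⊆ Γ) (hd : Disjoint R R')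
    (h : ReachIn G Γ R x a) (h' : ReachIn G Γ R' y a') (hadj : G.Adj a a')
    (hpar : a.val % 2 = a'.val % 2) :
    ∃ r : G.Walk x y, r.IsPath ∧ (∀ w ∈ r.support, w ∈ Γ) ∧
      List.IsChain (· ≠ ·)
        ((1 - x.val % 2) :: r.edges.map (pairColor Γ) ++ [1 - y.val % 2]) := by
  obtain ⟨p, hp, hs, hc⟩ := h
  obtain ⟨q, hq, hs', hc'⟩ := h'
  have haΓ : a ∈ Γ := hR (hs _ p.end_mem_support)
  have haΓ' : a' ∈ Γ := hR' (hs' _ q.end_mem_support)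
  have hsup : (p.append (SimpleGraph.Walk.cons hadj q.reverse)).support
      = p.support ++ q.support.reverse := by
    rw [SimpleGraph.Walk.support_append]; simp
  refine ⟨p.append (SimpleGraph.Walk.cons hadj q.reverse), ?_, ?_, ?_⟩
  · rw [SimpleGraph.Walk.isPath_def, hsup, List.nodup_append]
    refine ⟨hp.support_nodup, by simpa using hq.support_nodup, ?_⟩
    intro u hu v hv huv
    subst huv
    exact Finset.disjoint_left.mp hd (hs _ hu) (hs' _ (by simpa using hv))
  · intro w hw
    rw [hsup, List.mem_append, List.mem_reverse] at hw
    rcases hw with hw | hw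
    · exact hR (hs _ hw)
    · exact hR' (hs' _ hw)
  · have hrev : List.IsChain (· ≠ ·)
        ((1 - y.val % 2) :: q.edges.map (pairColor Γ) ++ [a'.val % 2]).reverse := by
      rw [List.isChain_reverse]
      exact hc'.imp fun _ _ h => h.symm
    simp only [List.cons_append, List.reverse_cons, List.reverse_append, List.reverse_nil,
      List.nil_append] at hrev
    rw [← hpar] at hrev
    have := List.IsChain.append_overlap hc
      (l₃ := (q.edges.map (pairColor Γ)).reverse ++ [1 - y.val % 2]) (by simpa using hrev)
      (by simp)
    simpa [SimpleGraph.Walk.edges_append, pairColor_of_parity_eq haΓ haΓ' hpar] using this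

/-- A reachable set that expands can absorb a further good vertex outside a given small set. -/
theorem exists_reachIn_insert {n : ℕ} {G : SimpleGraph (Fin n)} {Γ R Q : Finset (Fin n)}
    {x : Fin n} (hR : R ⊆ Γ) (hreach : ∀ a ∈ R, ReachIn G Γ R x a)
    (hexp : ∃ W ⊆ Γ, (∀ w ∈ W, ∃ v ∈ R, Forward G v w) ∧ R.card + Q.card < W.card) :
    ∃ w ∈ Γ, w ∉ R ∧ w ∉ Q ∧ ∀ a ∈ insert w R, ReachIn G Γ (insert w R) x a := by
  obtain ⟨W, hW, hWf, hcard⟩ := hexp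
  have hlt : (R ∪ Q).card < W.card := lt_of_le_of_lt (Finset.card_union_le _ _) hcard
  obtain ⟨w, hwW, hw⟩ := Finset.exists_mem_notMem_of_card_lt_card hlt
  rw [Finset.mem_union, not_or] at hw
  obtain ⟨v, hv, hf⟩ := hWf w hwW
  refine ⟨w, hW hwW, hw.1, hw.2, fun a ha => ?_⟩
  rcases Finset.mem_insert.mp ha with rfl | ha
  · exact (hreach v hv).step (hR hv) (hW hwW) hw.1 hf
  · exact (hreach a ha).mono (Finset.subset_insert _ _)

/-- The good vertices expand by a factor 16 along forward edges, up to size `s`. -/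
def ForwardExpands {n : ℕ} (G : SimpleGraph (Fin n)) (Γ : Finset (Fin n)) (s : ℕ) : Prop :=
  ∀ S ⊆ Γ, S.Nonempty → S.card ≤ s →
    ∃ W ⊆ Γ, (∀ w ∈ W, ∃ v ∈ S, Forward G v w) ∧ 16 * S.card ≤ W.card

theorem exists_disjoint_reachIn {n : ℕ} {G : SimpleGraph (Fin n)} {Γ : Finset (Fin n)} {s : ℕ}
    (hexp : ForwardExpands G Γ s) {x y : Fin n} (hx : x ∈ Γ) (hy : y ∈ Γ) (hxy : x ≠ y)
    (k : ℕ) (hk : k < s) :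
    ∃ R R' : Finset (Fin n), R ⊆ Γ ∧ R' ⊆ Γ ∧ Disjoint R R' ∧ R.card = k + 1 ∧
      R'.card = k + 1 ∧ (∀ a ∈ R, ReachIn G Γ R x a) ∧ (∀ a ∈ R', ReachIn G Γ R' y a) := by
  induction k with
  | zero =>
    refine ⟨{x}, {y}, by simpa using hx, by simpa using hy, by simpa using hxy, by simp,
      by simp, ?_, ?_⟩
    · intro a ha
      obtain rfl := Finset.mem_singleton.mp ha
      exact ReachIn.refl _ _ _
    · intro a ha
      obtain rfl := Finset.mem_singleton.mp ha
      exact ReachIn.refl _ _ _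
  | succ k ih =>
    obtain ⟨R, R', hR, hR', hd, hc, hc', hr, hr'⟩ := ih (by omega)
    have extend : ∀ {z : Fin n} {S Q : Finset (Fin n)}, S ⊆ Γ → S.card = k + 1 →
        Q.card ≤ k + 2 → (∀ a ∈ S, ReachIn G Γ S z a) →
        ∃ w ∈ Γ, w ∉ S ∧ w ∉ Q ∧ ∀ a ∈ insert w S, ReachIn G Γ (insert w S) z a := by
      intro z S Q hS hcS hcQ hrS
      obtain ⟨W, hW, hWf, hWc⟩ := hexp S hS (Finset.card_pos.mp (by omega)) (by omega)
      exact exists_reachIn_insert hS hrS ⟨W, hW, hWf, by omega⟩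
    obtain ⟨w, hw, hwR, hwR', hrw⟩ := extend (Q := R') hR hc (by omega) hr
    have hcw : (insert w R).card = k + 2 := by rw [Finset.card_insert_of_notMem hwR, hc]
    obtain ⟨w', hw', hwR₂, hwR₂', hrw'⟩ := extend (Q := insert w R) hR' hc' (by omega) hr'
    refine ⟨insert w R, insert w' R', Finset.insert_subset hw hR, Finset.insert_subset hw' hR',
      ?_, hcw, by rw [Finset.card_insert_of_notMem hwR₂, hc'], hrw, hrw'⟩
    rw [Finset.disjoint_insert_right]
    refine ⟨hwR₂', ?_⟩
    rw [Finset.disjoint_insert_left]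
    exact ⟨hwR', hd⟩

theorem exists_large_residue_class {n s : ℕ} (R : Finset (Fin n)) (hR : R.card = s) :
    ∃ i < 4, s ≤ 4 * (R.filter (fun v => v.val % 4 = i)).card := by
  by_contra! hcon
  have h := Finset.card_eq_sum_card_fiberwise (s := R) (t := Finset.range 4)
    (f := fun v : Fin n => v.val % 4) (fun v _ => by simp; omega)
  simp only [Finset.sum_range_succ, Finset.sum_range_zero] at h
  have h0 := hcon 0 (by omega)
  have h1 := hcon 1 (by omega)
  have h2 := hcon 2 (by omega)
  have h3 := hcon 3 (by omega)
  omega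

theorem exists_proper_path_of_good {n : ℕ} {G : SimpleGraph (Fin n)} {Γ : Finset (Fin n)} {s : ℕ}
    (hs : 0 < s) (hexp : ForwardExpands G Γ s)
    (hedge : ∀ S T : Finset (Fin n), Disjoint S T → s ≤ 4 * S.card → s ≤ 4 * T.card →
      ∃ a ∈ S, ∃ b ∈ T, G.Adj a b)
    {x y : Fin n} (hx : x ∈ Γ) (hy : y ∈ Γ) (hxy : x ≠ y) :
    ∃ r : G.Walk x y, r.IsPath ∧ (∀ w ∈ r.support, w ∈ Γ) ∧
      List.IsChain (· ≠ ·)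
        ((1 - x.val % 2) :: r.edges.map (pairColor Γ) ++ [1 - y.val % 2]) := by
  obtain ⟨R, R', hR, hR', hd, hc, hc', hr, hr'⟩ :=
    exists_disjoint_reachIn hexp hx hy hxy (s - 1) (by omega)
  obtain ⟨i, hi, hRi⟩ := exists_large_residue_class R (s := s) (by omega)
  obtain ⟨j, hj, hRj⟩ := exists_large_residue_class R' (s := s) (by omega)
  by_cases hij : i % 2 = j % 2
  · obtain ⟨a, ha, b, hb, hab⟩ := hedge _ _
      (Finset.disjoint_filter_filter (p := fun v => v.val % 4 = i)
        (q := fun v => v.val % 4 = j) hd) hRi hRj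
    rw [Finset.mem_filter] at ha hb
    exact exists_path_of_reachIn hR hR' hd (hr a ha.1) (hr' b hb.1) hab (by omega)
  · obtain ⟨W, hW, hWf, hWc⟩ := hexp (R'.filter (fun v => v.val % 4 = j))
      ((Finset.filter_subset _ _).trans hR') (Finset.card_pos.mp (by omega))
      ((Finset.card_filter_le _ _).trans (by omega))
    have hcard : s ≤ 4 * (W \ (R ∪ R')).card := by
      have h1 := Finset.le_card_sdiff (R ∪ R') W
      have h2 := Finset.card_union_le R R'
      omega
    have hdisj : Disjoint (R.filter (fun v => v.val % 4 = i)) (W \ (R ∪ R')) := by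
      rw [Finset.disjoint_left]
      intro v hv hv'
      simp only [Finset.mem_sdiff, Finset.mem_union, not_or] at hv'
      exact hv'.2.1 (Finset.mem_filter.mp hv).1
    obtain ⟨a, ha, b, hb, hab⟩ := hedge _ _ hdisj hRi hcard
    rw [Finset.mem_filter] at ha
    simp only [Finset.mem_sdiff, Finset.mem_union, not_or] at hb
    obtain ⟨v, hv, hf⟩ := hWf b hb.1
    rw [Finset.mem_filter] at hv
    refine exists_path_of_reachIn hR (Finset.insert_subset (hW hb.1) hR') ?_ (hr a ha.1)
      ((hr' v hv.1).step (hR' hv.1) (hW hb.1) hb.2.2 hf) hab ?_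
    · rw [Finset.disjoint_insert_right]
      exact ⟨hb.2.1, hd⟩
    · have := hf.2
      omega

/-- A deterministic criterion for the proper connection number to be at most 2. -/
theorem exists_properPathColoring {n : ℕ} {G : SimpleGraph (Fin n)} {Γ : Finset (Fin n)} {s : ℕ}
    (hs : 0 < s) (hexp : ForwardExpands G Γ s)
    (hedge : ∀ S T : Finset (Fin n), Disjoint S T → s ≤ 4 * S.card → s ≤ 4 * T.card →
      ∃ a ∈ S, ∃ b ∈ T, G.Adj a b)
    (hbad : ∀ b ∉ Γ, ∃ x ∈ Γ, G.Adj b x)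
    (hbad₂ : ∀ b ∉ Γ, ∀ b' ∉ Γ, b ≠ b' → ∃ x ∈ Γ, ∃ x' ∈ Γ, x ≠ x' ∧ G.Adj b x ∧ G.Adj b' x') :
    ∃ c : Sym2 (Fin n) → ℕ, (∀ e, c e < 2) ∧ IsProperPathColoring G c := by
  have good := fun {x y : Fin n} => exists_proper_path_of_good hs hexp hedge (x := x) (y := y)
  refine ⟨pairColor Γ, pairColor_lt_two Γ, fun u v huv => ?_⟩
  show ∃ p : G.Walk u v, p.IsPath ∧ (p.edges.map (pairColor Γ)).IsChain (· ≠ ·)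
  have mixed : ∀ b ∉ Γ, ∀ z ∈ Γ,
      ∃ p : G.Walk b z, p.IsPath ∧ (p.edges.map (pairColor Γ)).IsChain (· ≠ ·) := by
    intro b hb z hz
    obtain ⟨x, hx, hbx⟩ := hbad b hb
    by_cases hxz : x = z
    · subst hxz
      refine ⟨SimpleGraph.Walk.cons hbx SimpleGraph.Walk.nil, ?_, by simp⟩
      simpa [SimpleGraph.Walk.cons_isPath_iff] using hbx.ne
    · obtain ⟨r, hr, hrs, hrc⟩ := good hx hz hxz
      refine ⟨SimpleGraph.Walk.cons hbx r, ?_, ?_⟩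
      · exact (SimpleGraph.Walk.cons_isPath_iff _ _).mpr ⟨hr, fun h => hb (hrs _ h)⟩
      · rw [SimpleGraph.Walk.edges_cons, List.map_cons, pairColor_pendant hb hx]
        exact hrc.left_of_append
  by_cases hu : u ∈ Γ
  · by_cases hv : v ∈ Γ
    · obtain ⟨r, hr, _, hrc⟩ := good hu hv huv
      exact ⟨r, hr, hrc.left_of_append.tail⟩
    · obtain ⟨p, hp, hpc⟩ := mixed v hv u hu
      refine ⟨p.reverse, hp.reverse, ?_⟩
      rw [SimpleGraph.Walk.edges_reverse, List.map_reverse, List.isChain_reverse]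
      exact hpc.imp fun _ _ h => h.symm
  · by_cases hv : v ∈ Γ
    · exact mixed u hu v hv
    · obtain ⟨x, hx, y, hy, hxy, hux, hvy⟩ := hbad₂ u hu v hv huv
      obtain ⟨r, hr, hrs, hrc⟩ := good hx hy hxy
      refine ⟨SimpleGraph.Walk.cons hux (r.concat hvy.symm), ?_, ?_⟩
      · refine (SimpleGraph.Walk.cons_isPath_iff _ _).mpr
          ⟨hr.concat (fun h => hv (hrs _ h)) hvy.symm, fun h => ?_⟩
        rw [SimpleGraph.Walk.support_concat] at h
        simp only [List.mem_append, List.mem_singleton] at h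
        rcases h with h | h
        · exact hu (hrs _ h)
        · exact huv h
      · rw [SimpleGraph.Walk.edges_cons, SimpleGraph.Walk.edges_concat, List.map_cons,
          pairColor_pendant hu hx, List.concat_eq_append, List.map_append, List.map_singleton,
          Sym2.eq_swap, pairColor_pendant hv hy]
        exact hrc

open Classical in
/-- The edges of a graph on `Fin n`, as a finset. -/
noncomputable def edgesOf {n : ℕ} (G : SimpleGraph (Fin n)) : Finset (Sym2 (Fin n)) :=
  Finset.univ.filter (fun e => e ∈ G.edgeSet)

theorem mem_edgesOf {n : ℕ} {G : SimpleGraph (Fin n)} {e : Sym2 (Fin n)} :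
    e ∈ edgesOf G ↔ e ∈ G.edgeSet := by
  simp [edgesOf]

theorem coe_edgesOf {n : ℕ} (G : SimpleGraph (Fin n)) : (edgesOf G : Set (Sym2 (Fin n))) =
    G.edgeSet := by
  ext e; exact mem_edgesOf

theorem card_edgesOf {n : ℕ} (G : SimpleGraph (Fin n)) :
    (edgesOf G).card = G.edgeSet.ncard := by
  rw [← coe_edgesOf, Set.ncard_coe_finset]

theorem edgesOf_subset_top {n : ℕ} (G : SimpleGraph (Fin n)) :
    edgesOf G ⊆ edgesOf (⊤ : SimpleGraph (Fin n)) := by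
  intro e he
  rw [mem_edgesOf] at he ⊢
  exact SimpleGraph.edgeSet_mono le_top he

theorem card_edgesOf_top (n : ℕ) : (edgesOf (⊤ : SimpleGraph (Fin n))).card = n.choose 2 := by
  rw [card_edgesOf, ← SimpleGraph.coe_edgeFinset, Set.ncard_coe_finset,
    SimpleGraph.card_edgeFinset_top_eq_card_choose_two, Fintype.card_fin]

theorem mem_edgesOf_top {n : ℕ} {u v : Fin n} :
    s(u, v) ∈ edgesOf (⊤ : SimpleGraph (Fin n)) ↔ u ≠ v := by
  rw [mem_edgesOf]; simp

theorem sum_simpleGraph_eq_sum_powerset {n : ℕ} (F : Finset (Sym2 (Fin n)) → ℝ) :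
    ∑ G : SimpleGraph (Fin n), F (edgesOf G)
      = ∑ t ∈ (edgesOf (⊤ : SimpleGraph (Fin n))).powerset, F t := by
  refine Finset.sum_bij' (fun G _ => edgesOf G)
    (fun t _ => SimpleGraph.fromEdgeSet (t : Set (Sym2 (Fin n)))) ?_ ?_ ?_ ?_ ?_
  · intro G _
    exact Finset.mem_powerset.mpr (edgesOf_subset_top G)
  · intro t _
    exact Finset.mem_univ _
  · intro G _
    simp only [coe_edgesOf, SimpleGraph.fromEdgeSet_edgeSet]
  · intro t ht
    ext e
    rw [mem_edgesOf, SimpleGraph.edgeSet_fromEdgeSet]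
    refine ⟨fun h => h.1, fun h => ⟨h, ?_⟩⟩
    have := Finset.mem_powerset.mp ht h
    rw [mem_edgesOf] at this
    exact SimpleGraph.not_isDiag_of_mem_edgeSet _ this
  · intro G _
    rfl

/-- The probability of a single graph in `G(n,p)`. -/
noncomputable def erWeight (n : ℕ) (p : ℝ) (G : SimpleGraph (Fin n)) : ℝ :=
  p ^ G.edgeSet.ncard * (1 - p) ^ (n.choose 2 - G.edgeSet.ncard)

theorem erWeight_nonneg {n : ℕ} {p : ℝ} (h0 : 0 ≤ p) (h1 : p ≤ 1) (G : SimpleGraph (Fin n)) :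
    0 ≤ erWeight n p G :=
  mul_nonneg (pow_nonneg h0 _) (pow_nonneg (sub_nonneg.mpr h1) _)

theorem sum_erWeight_mul_prod (n : ℕ) (p : ℝ) (f g : Sym2 (Fin n) → ℝ) :
    ∑ G : SimpleGraph (Fin n), erWeight n p G *
      ((∏ e ∈ edgesOf G, f e) * ∏ e ∈ edgesOf (⊤ : SimpleGraph (Fin n)) \ edgesOf G, g e)
      = ∏ e ∈ edgesOf (⊤ : SimpleGraph (Fin n)), (p * f e + (1 - p) * g e) := by
  rw [Finset.prod_add, ← sum_simpleGraph_eq_sum_powerset (fun t => (∏ e ∈ t, p * f e) *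
    ∏ e ∈ edgesOf (⊤ : SimpleGraph (Fin n)) \ t, (1 - p) * g e)]
  refine Finset.sum_congr rfl fun G _ => ?_
  simp only [Finset.prod_mul_distrib, Finset.prod_const, erWeight,
    Finset.card_sdiff_of_subset (edgesOf_subset_top G)]
  rw [card_edgesOf_top, card_edgesOf]
  ring

theorem sum_erWeight (n : ℕ) (p : ℝ) : ∑ G : SimpleGraph (Fin n), erWeight n p G = 1 := by
  have := sum_erWeight_mul_prod n p (fun _ => 1) (fun _ => 1)
  simpa using this

theorem erProb_mono {n : ℕ} {p : ℝ} (h0 : 0 ≤ p) (h1 : p ≤ 1) {A B : Set (SimpleGraph (Fin n))}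
    (h : A ⊆ B) : erProb n p A ≤ erProb n p B := by
  classical
  refine Finset.sum_le_sum fun G _ => ?_
  have := erWeight_nonneg h0 h1 G
  unfold erWeight at this
  by_cases hA : G ∈ A
  · simp [hA, h hA]
  · by_cases hB : G ∈ B <;> simp [hA, hB, this]

theorem erProb_nonneg {n : ℕ} {p : ℝ} (h0 : 0 ≤ p) (h1 : p ≤ 1) (A : Set (SimpleGraph (Fin n))) :
    0 ≤ erProb n p A := by
  classical
  refine Finset.sum_nonneg fun G _ => ?_
  have := erWeight_nonneg h0 h1 G
  unfold erWeight at this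
  split_ifs <;> simp [this]

theorem erProb_add_compl (n : ℕ) (p : ℝ) (A : Set (SimpleGraph (Fin n))) :
    erProb n p A + erProb n p Aᶜ = 1 := by
  classical
  rw [← sum_erWeight n p, erProb, erProb, ← Finset.sum_add_distrib]
  refine Finset.sum_congr rfl fun G _ => ?_
  by_cases hA : G ∈ A <;> simp [hA, erWeight]

theorem erProb_le_one {n : ℕ} {p : ℝ} (h0 : 0 ≤ p) (h1 : p ≤ 1) (A : Set (SimpleGraph (Fin n))) :
    erProb n p A ≤ 1 := by
  have := erProb_add_compl n p A
  have := erProb_nonneg h0 h1 Aᶜ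
  linarith

theorem erProb_le_sum {n : ℕ} {p : ℝ} (h0 : 0 ≤ p) (h1 : p ≤ 1) {ι : Type*} (I : Finset ι)
    (A : Set (SimpleGraph (Fin n))) (B : ι → Set (SimpleGraph (Fin n)))
    (hA : ∀ G ∈ A, ∃ i ∈ I, G ∈ B i) : erProb n p A ≤ ∑ i ∈ I, erProb n p (B i) := by
  classical
  simp only [erProb]
  rw [Finset.sum_comm]
  refine Finset.sum_le_sum fun G _ => ?_
  have hw := erWeight_nonneg h0 h1 G
  unfold erWeight at hw
  have hnn : ∀ i ∈ I, 0 ≤ (if G ∈ B i then p ^ G.edgeSet.ncard *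
      (1 - p) ^ (n.choose 2 - G.edgeSet.ncard) else 0) := by
    intro i _
    split_ifs <;> simp [hw]
  by_cases hG : G ∈ A
  · obtain ⟨i, hi, hGi⟩ := hA G hG
    refine le_trans ?_ (Finset.single_le_sum hnn hi)
    simp [hG, hGi]
  · simpa [hG] using Finset.sum_nonneg hnn

theorem erProb_le_card_mul {n : ℕ} {p : ℝ} (h0 : 0 ≤ p) (h1 : p ≤ 1) {ι : Type*} (I : Finset ι)
    (A : Set (SimpleGraph (Fin n))) (B : ι → Set (SimpleGraph (Fin n)))
    (hA : ∀ G ∈ A, ∃ i ∈ I, G ∈ B i) (b : ℝ) (hB : ∀ i ∈ I, erProb n p (B i) ≤ b) :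
    erProb n p A ≤ I.card * b := by
  refine (erProb_le_sum h0 h1 I A B hA).trans ?_
  simpa using Finset.sum_le_sum hB

theorem erProb_union_le {n : ℕ} {p : ℝ} (h0 : 0 ≤ p) (h1 : p ≤ 1)
    (A B : Set (SimpleGraph (Fin n))) : erProb n p (A ∪ B) ≤ erProb n p A + erProb n p B := by
  have := erProb_le_sum h0 h1 (Finset.univ : Finset Bool) (A ∪ B) (fun i => if i then A else B)
    (fun G hG => by
      rcases hG with h | h
      · exact ⟨true, by simp, by simpa using h⟩
      · exact ⟨false, by simp, by simpa using h⟩)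
  simpa using this

theorem sum_powerset_binomial_mono {α : Type*} [DecidableEq α] (s : Finset α) {p q : ℝ}
    (h0 : 0 ≤ p) (hpq : p ≤ q) (h1 : q ≤ 1) :
    ∀ F : Finset α → ℝ, (∀ t t', t ⊆ t' → F t ≤ F t') →
      ∑ t ∈ s.powerset, p ^ t.card * (1 - p) ^ (s.card - t.card) * F t
        ≤ ∑ t ∈ s.powerset, q ^ t.card * (1 - q) ^ (s.card - t.card) * F t := by
  induction s using Finset.induction_on with
  | empty => intro F _; simp
  | insert a s ha ih =>
    intro F hF
    have key : ∀ r : ℝ, ∑ t ∈ (insert a s).powerset,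
        r ^ t.card * (1 - r) ^ ((insert a s).card - t.card) * F t
        = (1 - r) * ∑ t ∈ s.powerset, r ^ t.card * (1 - r) ^ (s.card - t.card) * F t
          + r * ∑ t ∈ s.powerset, r ^ t.card * (1 - r) ^ (s.card - t.card) * F (insert a t) := by
      intro r
      rw [Finset.sum_powerset_insert ha, Finset.mul_sum, Finset.mul_sum]
      congr 1
      · refine Finset.sum_congr rfl fun t ht => ?_
        have := Finset.card_le_card (Finset.mem_powerset.mp ht)
        rw [Finset.card_insert_of_notMem ha, Nat.sub_add_comm this, pow_succ]
        ring
      · refine Finset.sum_congr rfl fun t ht => ?_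
        have hat : a ∉ t := fun h => ha (Finset.mem_powerset.mp ht h)
        rw [Finset.card_insert_of_notMem ha, Finset.card_insert_of_notMem hat,
          Nat.add_sub_add_right, pow_succ]
        ring
    rw [key, key]
    have ih1 := ih F hF
    have ih2 := ih (fun t => F (insert a t)) fun t t' h => hF _ _ (Finset.insert_subset_insert a h)
    have hle : ∑ t ∈ s.powerset, q ^ t.card * (1 - q) ^ (s.card - t.card) * F t
        ≤ ∑ t ∈ s.powerset, q ^ t.card * (1 - q) ^ (s.card - t.card) * F (insert a t) :=
      Finset.sum_le_sum fun t _ => mul_le_mul_of_nonneg_left (hF _ _ (Finset.subset_insert a t))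
        (mul_nonneg (pow_nonneg (h0.trans hpq) _) (pow_nonneg (sub_nonneg.mpr h1) _))
    nlinarith [mul_le_mul_of_nonneg_left ih1 (by linarith : 0 ≤ 1 - p),
      mul_le_mul_of_nonneg_left ih2 h0, mul_nonneg (sub_nonneg.mpr hpq) (sub_nonneg.mpr hle)]

/-- Increasing events are more likely for larger edge probabilities. -/
theorem erProb_le_of_le {n : ℕ} {p q : ℝ} (h0 : 0 ≤ p) (hpq : p ≤ q) (h1 : q ≤ 1)
    (A : Set (SimpleGraph (Fin n))) (hA : ∀ G H : SimpleGraph (Fin n), G ≤ H → G ∈ A → H ∈ A) :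
    erProb n p A ≤ erProb n q A := by
  classical
  have key : ∀ r : ℝ, erProb n r A = ∑ t ∈ (edgesOf (⊤ : SimpleGraph (Fin n))).powerset,
      r ^ t.card * (1 - r) ^ ((edgesOf (⊤ : SimpleGraph (Fin n))).card - t.card) *
        (if SimpleGraph.fromEdgeSet (t : Set (Sym2 (Fin n))) ∈ A then 1 else 0) := by
    intro r
    rw [← sum_simpleGraph_eq_sum_powerset (fun t : Finset (Sym2 (Fin n)) => r ^ t.card *
      (1 - r) ^ ((edgesOf (⊤ : SimpleGraph (Fin n))).card - t.card) *
        (if SimpleGraph.fromEdgeSet (t : Set (Sym2 (Fin n))) ∈ A then (1 : ℝ) else 0)), erProb]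
    refine Finset.sum_congr rfl fun G _ => ?_
    rw [card_edgesOf_top, card_edgesOf, coe_edgesOf, SimpleGraph.fromEdgeSet_edgeSet, mul_ite,
      mul_one, mul_zero]
  rw [key, key]
  refine sum_powerset_binomial_mono _ h0 hpq h1 _ fun t t' htt' => ?_
  by_cases ht : SimpleGraph.fromEdgeSet (t : Set (Sym2 (Fin n))) ∈ A
  · have := hA _ _ (SimpleGraph.fromEdgeSet_mono (by exact_mod_cast htt')) ht
    simp [ht, this]
  · rw [if_neg ht]
    split_ifs <;> norm_num

/-- Exponential moment bound: `F` is a set of required edges, and the number of edges in the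
disjoint set `H` is controlled through the weight `a`. -/
theorem erProb_le_of_edges {n : ℕ} {p : ℝ} (h0 : 0 ≤ p) (h1 : p ≤ 1)
    (A : Set (SimpleGraph (Fin n))) (F H : Finset (Sym2 (Fin n)))
    (hF : F ⊆ edgesOf ⊤) (hH : H ⊆ edgesOf ⊤) (hFH : Disjoint F H) {a C : ℝ}
    (ha : 0 ≤ a) (hC : 0 ≤ C)
    (hA : ∀ G ∈ A, F ⊆ edgesOf G ∧ 1 ≤ C * a ^ (edgesOf G ∩ H).card) :
    erProb n p A ≤ C * p ^ F.card * Real.exp (-((1 - a) * p * H.card)) := by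
  classical
  have hprod := sum_erWeight_mul_prod n p (fun e => if e ∈ H then a else 1)
    (fun e => if e ∈ F then 0 else 1)
  have hrhs : ∏ e ∈ edgesOf (⊤ : SimpleGraph (Fin n)),
      (p * (if e ∈ H then a else 1) + (1 - p) * (if e ∈ F then (0 : ℝ) else 1))
      = p ^ F.card * (1 - p + p * a) ^ H.card := by
    calc _ = ∏ e ∈ edgesOf (⊤ : SimpleGraph (Fin n)),
          ((if e ∈ F then p else 1) * (if e ∈ H then 1 - p + p * a else 1)) := by
            refine Finset.prod_congr rfl fun e _ => ?_
            by_cases hf : e ∈ F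
            · simp [hf, Finset.disjoint_left.mp hFH hf]
            · by_cases hh : e ∈ H
              · simp [hf, hh]; ring
              · simp [hf, hh]
      _ = _ := by
            rw [Finset.prod_mul_distrib, Finset.prod_ite_mem, Finset.prod_ite_mem,
              Finset.inter_eq_right.mpr hF, Finset.inter_eq_right.mpr hH, Finset.prod_const,
              Finset.prod_const]
  rw [hrhs] at hprod
  have hbase : 0 ≤ 1 - p + p * a := by have := mul_nonneg h0 ha; linarith
  have hexp : (1 - p + p * a) ^ H.card ≤ Real.exp (-((1 - a) * p * H.card)) := by
    calc (1 - p + p * a) ^ H.card ≤ (Real.exp (-((1 - a) * p))) ^ H.card := by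
          refine pow_le_pow_left₀ hbase ?_ _
          have := Real.add_one_le_exp (-((1 - a) * p))
          linarith
      _ = _ := by rw [← Real.exp_nat_mul]; congr 1; ring
  calc erProb n p A ≤ ∑ G : SimpleGraph (Fin n), C * (erWeight n p G *
        ((∏ e ∈ edgesOf G, if e ∈ H then a else 1) *
          ∏ e ∈ edgesOf (⊤ : SimpleGraph (Fin n)) \ edgesOf G, if e ∈ F then (0 : ℝ) else 1)) := by
        refine Finset.sum_le_sum fun G _ => ?_
        have hw := erWeight_nonneg h0 h1 G
        split_ifs with hG
        · obtain ⟨hFG, hCG⟩ := hA G hG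
          have hone : ∏ e ∈ edgesOf (⊤ : SimpleGraph (Fin n)) \ edgesOf G,
              (if e ∈ F then (0 : ℝ) else 1) = 1 := by
            refine Finset.prod_eq_one fun e he => ?_
            rw [if_neg fun h => (Finset.mem_sdiff.mp he).2 (hFG h)]
          rw [hone, mul_one, Finset.prod_ite_mem, Finset.prod_const]
          change erWeight n p G ≤ _
          nlinarith
        · refine mul_nonneg hC (mul_nonneg hw (mul_nonneg ?_ ?_)) <;>
            exact Finset.prod_nonneg fun e _ => by split_ifs <;> simp [ha]
    _ = C * (p ^ F.card * (1 - p + p * a) ^ H.card) := by rw [← Finset.mul_sum, hprod]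
    _ ≤ C * (p ^ F.card * Real.exp (-((1 - a) * p * H.card))) := by gcongr
    _ = _ := by ring

/-- The unordered pairs underlying a set of ordered pairs. -/
def unorient {n : ℕ} (P : Finset (Fin n × Fin n)) : Finset (Sym2 (Fin n)) :=
  P.image (fun q => s(q.1, q.2))

open Classical in
/-- The ordered pairs in `P` that are adjacent in `G`. -/
noncomputable def adjPairs {n : ℕ} (G : SimpleGraph (Fin n)) (P : Finset (Fin n × Fin n)) :
    Finset (Fin n × Fin n) :=
  P.filter (fun q => G.Adj q.1 q.2)

theorem injOn_unorient {n : ℕ} {P : Finset (Fin n × Fin n)} (hP : ∀ q ∈ P, (q.2, q.1) ∉ P) :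
    Set.InjOn (fun q : Fin n × Fin n => s(q.1, q.2)) P := by
  rintro ⟨a, b⟩ hq ⟨a', b'⟩ hq' h
  simp only [Sym2.eq_iff] at h
  rcases h with ⟨rfl, rfl⟩ | ⟨rfl, rfl⟩
  · rfl
  · exact absurd hq' (hP _ hq)

theorem card_unorient {n : ℕ} {P : Finset (Fin n × Fin n)} (hP : ∀ q ∈ P, (q.2, q.1) ∉ P) :
    (unorient P).card = P.card :=
  Finset.card_image_of_injOn (injOn_unorient hP)

theorem unorient_subset {n : ℕ} {P : Finset (Fin n × Fin n)} (hP : ∀ q ∈ P, (q.2, q.1) ∉ P) :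
    unorient P ⊆ edgesOf ⊤ := by
  intro e he
  obtain ⟨⟨a, b⟩, hq, rfl⟩ := Finset.mem_image.mp he
  rw [mem_edgesOf_top]
  intro hab
  change a = b at hab
  subst hab
  exact hP _ hq hq

theorem card_edgesOf_inter_unorient {n : ℕ} (G : SimpleGraph (Fin n))
    {P : Finset (Fin n × Fin n)} (hP : ∀ q ∈ P, (q.2, q.1) ∉ P) :
    (edgesOf G ∩ unorient P).card = (adjPairs G P).card := by
  classical
  have : edgesOf G ∩ unorient P = (adjPairs G P).image (fun q => s(q.1, q.2)) := by
    ext e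
    simp only [unorient, adjPairs, Finset.mem_inter, Finset.mem_image, Finset.mem_filter,
      mem_edgesOf]
    constructor
    · rintro ⟨he, q, hq, rfl⟩
      exact ⟨q, ⟨hq, he⟩, rfl⟩
    · rintro ⟨q, ⟨hq, he⟩, rfl⟩
      exact ⟨he, q, hq, rfl⟩
  rw [this]
  exact Finset.card_image_of_injOn ((injOn_unorient hP).mono
    (by exact_mod_cast Finset.filter_subset _ _))

theorem erProb_no_adjPairs_le {n : ℕ} {p : ℝ} (h0 : 0 ≤ p) (h1 : p ≤ 1)
    {P : Finset (Fin n × Fin n)} (hP : ∀ q ∈ P, (q.2, q.1) ∉ P) :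
    erProb n p {G | ∀ q ∈ P, ¬ G.Adj q.1 q.2} ≤ Real.exp (-(p * P.card)) := by
  classical
  have := erProb_le_of_edges h0 h1 {G | ∀ q ∈ P, ¬ G.Adj q.1 q.2} ∅ (unorient P)
    (Finset.empty_subset _) (unorient_subset hP) (Finset.disjoint_empty_left _) le_rfl zero_le_one
    (fun G hG => ⟨Finset.empty_subset _, by
      have : adjPairs G P = ∅ := Finset.filter_eq_empty_iff.mpr fun q hq => hG q hq
      rw [card_edgesOf_inter_unorient G hP, this]; simp⟩)
  simpa [card_unorient hP] using this

theorem erProb_many_adjPairs_le {n : ℕ} {p : ℝ} (h0 : 0 ≤ p) (h1 : p ≤ 1)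
    {P : Finset (Fin n × Fin n)} (hP : ∀ q ∈ P, (q.2, q.1) ∉ P) {μ : ℝ} (hμ : 0 ≤ μ) (t : ℝ) :
    erProb n p {G | t ≤ (adjPairs G P).card} ≤
      Real.exp (-(μ * t) + Real.exp μ * (p * P.card)) := by
  have := erProb_le_of_edges h0 h1 {G | t ≤ (adjPairs G P).card} ∅ (unorient P)
    (Finset.empty_subset _) (unorient_subset hP) (Finset.disjoint_empty_left _)
    (Real.exp_pos μ).le (Real.exp_pos (-(μ * t))).le
    (fun G hG => ⟨Finset.empty_subset _, by
      rw [card_edgesOf_inter_unorient G hP, ← Real.exp_nat_mul, ← Real.exp_add, Real.one_le_exp_iff]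
      have := mul_le_mul_of_nonneg_left (show t ≤ _ from hG) hμ
      linarith⟩)
  rw [card_unorient hP, Finset.card_empty, pow_zero, mul_one, ← Real.exp_add] at this
  refine this.trans (Real.exp_le_exp.mpr ?_)
  have : 0 ≤ p * P.card := by positivity
  linarith

theorem exp_neg_three_le : Real.exp (-3) ≤ 1 / 20 := by
  rw [Real.exp_neg, inv_eq_one_div]
  apply one_div_le_one_div_of_le (by norm_num)
  have h := Real.exp_one_gt_d9
  have : Real.exp 3 = Real.exp 1 ^ 3 := by rw [← Real.exp_nat_mul]; norm_num
  rw [this]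
  calc (20 : ℝ) ≤ 2.718 ^ 3 := by norm_num
    _ ≤ Real.exp 1 ^ 3 := by gcongr; linarith

theorem erProb_few_adjPairs_le {n : ℕ} {p : ℝ} (h0 : 0 ≤ p) (h1 : p ≤ 1)
    {P : Finset (Fin n × Fin n)} (hP : ∀ q ∈ P, (q.2, q.1) ∉ P) {F : Finset (Sym2 (Fin n))}
    (hF : F ⊆ edgesOf ⊤) (hFP : Disjoint F (unorient P)) (t : ℝ) :
    erProb n p {G | F ⊆ edgesOf G ∧ ((adjPairs G P).card : ℝ) ≤ t} ≤
      p ^ F.card * Real.exp (3 * t - 19 / 20 * (p * P.card)) := by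
  have := erProb_le_of_edges h0 h1 {G | F ⊆ edgesOf G ∧ ((adjPairs G P).card : ℝ) ≤ t} F
    (unorient P) hF (unorient_subset hP) hFP (Real.exp_pos (-3)).le (Real.exp_pos (3 * t)).le
    (fun G hG => ⟨hG.1, by
      rw [card_edgesOf_inter_unorient G hP, ← Real.exp_nat_mul, ← Real.exp_add, Real.one_le_exp_iff]
      have := hG.2
      linarith⟩)
  rw [card_unorient hP, mul_comm (Real.exp (3 * t)), mul_assoc, ← Real.exp_add] at this
  refine this.trans ?_
  gcongr
  have h2 : 0 ≤ p * P.card := by positivity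
  nlinarith [exp_neg_three_le]

open Classical in
theorem card_filter_product_univ {n : ℕ} (U : Finset (Fin n)) (r : Fin n → Fin n → Prop) :
    (((U ×ˢ Finset.univ).filter (fun q : Fin n × Fin n => r q.1 q.2)).card : ℝ)
      = ∑ u ∈ U, ((Finset.univ.filter (r u)).card : ℝ) := by
  rw [← Nat.cast_sum]
  simp only [Finset.card_filter, Finset.sum_product]

open Classical in
/-- The probability that the edges `F` inside a vertex set `U` are present while the vertices of
`U` have few edges leaving `U` of the kinds selected by the relation `r`. -/
theorem erProb_local_le {n : ℕ} {p : ℝ} (h0 : 0 ≤ p) (h1 : p ≤ 1) (U : Finset (Fin n))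
    (r : Fin n → Fin n → Prop) {F : Finset (Sym2 (Fin n))} (hF : F ⊆ edgesOf ⊤)
    (hFU : ∀ e ∈ F, ∀ v ∈ e, v ∈ U) (t m : ℝ)
    (hm : m ≤ ∑ u ∈ U, ((Finset.univ.filter (fun w => w ∉ U ∧ r u w)).card : ℝ)) :
    erProb n p {G | F ⊆ edgesOf G ∧
      ∑ u ∈ U, ((Finset.univ.filter (fun w => (w ∉ U ∧ r u w) ∧ G.Adj u w)).card : ℝ) ≤ t} ≤
      p ^ F.card * Real.exp (3 * t - 19 / 20 * (p * m)) := by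
  set P : Finset (Fin n × Fin n) :=
    (U ×ˢ Finset.univ).filter (fun q : Fin n × Fin n => q.2 ∉ U ∧ r q.1 q.2) with hPdef
  have hP : ∀ q ∈ P, (q.2, q.1) ∉ P := by
    intro q hq hq'
    simp only [hPdef, Finset.mem_filter, Finset.mem_product] at hq hq'
    exact hq.2.1 hq'.1.1
  have hPc : (P.card : ℝ)
      = ∑ u ∈ U, ((Finset.univ.filter (fun w => w ∉ U ∧ r u w)).card : ℝ) := by
    have h := card_filter_product_univ U (fun u w => w ∉ U ∧ r u w)
    convert h
  have hAc : ∀ G : SimpleGraph (Fin n), ((adjPairs G P).card : ℝ)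
      = ∑ u ∈ U, ((Finset.univ.filter (fun w => (w ∉ U ∧ r u w) ∧ G.Adj u w)).card : ℝ) := by
    intro G
    have h := card_filter_product_univ U (fun u w => (w ∉ U ∧ r u w) ∧ G.Adj u w)
    rw [adjPairs, hPdef, Finset.filter_filter]
    convert h
  have hdisj : Disjoint F (unorient P) := by
    rw [Finset.disjoint_left]
    intro e he he'
    obtain ⟨q, hq, rfl⟩ := Finset.mem_image.mp he'
    simp only [hPdef, Finset.mem_filter] at hq
    exact hq.2.1 (hFU _ he _ (Sym2.mem_mk_right _ _))
  have := erProb_few_adjPairs_le h0 h1 hP hF hdisj t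
  simp only [hAc] at this
  refine this.trans ?_
  rw [← hPc] at hm
  gcongr

theorem card_residue_class_ge (n r : ℕ) (hr : r < 4) :
    (n : ℝ) / 4 - 1 ≤ ((Finset.univ.filter (fun w : Fin n => w.val % 4 = r)).card : ℝ) := by
  have h : n / 4 ≤ (Finset.univ.filter (fun w : Fin n => w.val % 4 = r)).card := by
    have hlt : ∀ i : Fin (n / 4), 4 * i.val + r < n := fun i => by have := i.isLt; omega
    rw [← Fintype.card_fin (n / 4), ← Finset.card_univ]
    refine Finset.card_le_card_of_injOn (fun i => ⟨4 * i.val + r, hlt i⟩) ?_ ?_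
    · intro i _
      simp only [Finset.coe_filter, Finset.mem_univ, true_and, Set.mem_ofPred_eq]
      omega
    · intro i _ j _ hij
      simp only [Fin.mk.injEq] at hij
      exact Fin.ext (by omega)
  have h2 : (n : ℝ) ≤ 4 * ((n / 4 : ℕ) : ℝ) + 4 := by
    have : n ≤ 4 * (n / 4) + 4 := by omega
    exact_mod_cast this
  have h3 : ((n / 4 : ℕ) : ℝ) ≤
      ((Finset.univ.filter (fun w : Fin n => w.val % 4 = r)).card : ℝ) := by exact_mod_cast h
  linarith

theorem card_residue_class_sdiff_ge {n : ℕ} (U : Finset (Fin n)) (r : ℕ) (hr : r < 4) :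
    (n : ℝ) / 4 - 1 - U.card ≤
      ((Finset.univ.filter (fun w : Fin n => w ∉ U ∧ w.val % 4 = r)).card : ℝ) := by
  have h := Finset.le_card_sdiff U (Finset.univ.filter (fun w : Fin n => w.val % 4 = r))
  have he : Finset.univ.filter (fun w : Fin n => w.val % 4 = r) \ U
      = Finset.univ.filter (fun w : Fin n => w ∉ U ∧ w.val % 4 = r) := by
    ext w; simp [and_comm]
  rw [he] at h
  have h' : ((Finset.univ.filter (fun w : Fin n => w.val % 4 = r)).card : ℝ) ≤
      ((Finset.univ.filter (fun w : Fin n => w ∉ U ∧ w.val % 4 = r)).card : ℝ) + U.card := by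
    exact_mod_cast (by omega)
  have := card_residue_class_ge n r hr
  linarith

theorem card_compl_ge {n : ℕ} (U : Finset (Fin n)) :
    (n : ℝ) - U.card ≤ ((Finset.univ.filter (fun w : Fin n => w ∉ U)).card : ℝ) := by
  have h := Finset.le_card_sdiff U (Finset.univ : Finset (Fin n))
  have he : Finset.univ \ U = Finset.univ.filter (fun w : Fin n => w ∉ U) := by
    ext w; simp
  rw [he, Finset.card_univ, Fintype.card_fin] at h
  have h' : (n : ℝ) ≤ ((Finset.univ.filter (fun w : Fin n => w ∉ U)).card : ℝ) + U.card := by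
    exact_mod_cast (by omega)
  linarith

open Classical in
/-- The forward neighbors of a vertex. -/
noncomputable def forwardSet {n : ℕ} (G : SimpleGraph (Fin n)) (u : Fin n) : Finset (Fin n) :=
  Finset.univ.filter (Forward G u)

open Classical in
/-- The vertices with at least `d` forward neighbors. -/
noncomputable def goodSet {n : ℕ} (G : SimpleGraph (Fin n)) (d : ℝ) : Finset (Fin n) :=
  Finset.univ.filter (fun u => d ≤ (forwardSet G u).card)

open Classical in
/-- The neighbors of a vertex. -/
noncomputable def adjSet {n : ℕ} (G : SimpleGraph (Fin n)) (u : Fin n) : Finset (Fin n) :=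
  Finset.univ.filter (G.Adj u)

theorem mem_forwardSet {n : ℕ} {G : SimpleGraph (Fin n)} {u w : Fin n} :
    w ∈ forwardSet G u ↔ Forward G u w := by
  simp [forwardSet]

theorem mem_goodSet {n : ℕ} {G : SimpleGraph (Fin n)} {d : ℝ} {u : Fin n} :
    u ∈ goodSet G d ↔ d ≤ (forwardSet G u).card := by
  simp [goodSet]

theorem mem_adjSet {n : ℕ} {G : SimpleGraph (Fin n)} {u w : Fin n} :
    w ∈ adjSet G u ↔ G.Adj u w := by
  simp [adjSet]

/-- The pairs in `S × T` that advance the residue modulo 4 by one. -/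
def forwardPairs {n : ℕ} (S T : Finset (Fin n)) : Finset (Fin n × Fin n) :=
  (S ×ˢ T).filter (fun q => q.2.val % 4 = (q.1.val + 1) % 4)

theorem card_adjPairs_forwardPairs {n : ℕ} (G : SimpleGraph (Fin n)) (S T : Finset (Fin n)) :
    (adjPairs G (forwardPairs S T)).card = ∑ u ∈ S, (forwardSet G u ∩ T).card := by
  classical
  have h1 : adjPairs G (forwardPairs S T)
      = (S ×ˢ T).filter (fun q => Forward G q.1 q.2) := by
    ext q
    simp only [adjPairs, forwardPairs, Finset.mem_filter]
    unfold Forward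
    tauto
  have h2 : ∀ u, forwardSet G u ∩ T = T.filter (Forward G u) := by
    intro u
    ext w
    simp only [forwardSet, Finset.mem_inter, Finset.mem_filter, Finset.mem_univ, true_and]
    tauto
  simp only [h1, h2, Finset.card_filter, Finset.sum_product]

theorem forwardExpands_of_sparse {n s : ℕ} {G : SimpleGraph (Fin n)} {d : ℝ} (hsn : 16 * s ≤ n)
    (hstar : ∀ v, (adjSet G v \ goodSet G d).card < 8)
    (hsparse : ∀ S T : Finset (Fin n), 1 ≤ S.card → S.card ≤ s → T.card = 16 * S.card →
      ((adjPairs G (forwardPairs S T)).card : ℝ) < (d - 8) * S.card) :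
    ForwardExpands G (goodSet G d) s := by
  classical
  intro S hS hne hcard
  refine ⟨(goodSet G d).filter (fun w => ∃ v ∈ S, Forward G v w), Finset.filter_subset _ _,
    fun w hw => (Finset.mem_filter.mp hw).2, ?_⟩
  by_contra! hlt
  obtain ⟨T, hT, hTc⟩ := Finset.exists_superset_card_eq hlt.le
    (by rw [Fintype.card_fin]; omega)
  have h := hsparse S T (Finset.card_pos.mpr hne) hcard hTc
  rw [card_adjPairs_forwardPairs] at h
  push_cast at h
  have hv : ∀ v ∈ S, d - 8 ≤ ((forwardSet G v ∩ T).card : ℝ) := by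
    intro v hv
    have hd : d ≤ ((forwardSet G v).card : ℝ) := mem_goodSet.mp (hS hv)
    have hsub : forwardSet G v ⊆ (forwardSet G v ∩ T) ∪ (adjSet G v \ goodSet G d) := by
      intro w hw
      have hf : Forward G v w := mem_forwardSet.mp hw
      by_cases hwg : w ∈ goodSet G d
      · exact Finset.mem_union_left _ (Finset.mem_inter.mpr ⟨hw,
          hT (Finset.mem_filter.mpr ⟨hwg, v, hv, hf⟩)⟩)
      · exact Finset.mem_union_right _ (Finset.mem_sdiff.mpr
          ⟨mem_adjSet.mpr hf.1, hwg⟩)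
    have h1 := (Finset.card_le_card hsub).trans (Finset.card_union_le _ _)
    have h2 := hstar v
    have h3 : (forwardSet G v).card ≤ (forwardSet G v ∩ T).card + 8 := by omega
    have h4 : ((forwardSet G v).card : ℝ) ≤ (forwardSet G v ∩ T).card + 8 := by exact_mod_cast h3
    linarith
  have := Finset.sum_le_sum hv
  rw [Finset.sum_const, nsmul_eq_mul] at this
  linarith

/-- A pseudorandomness criterion for the proper connection number to be at most 2. -/
theorem exists_properPathColoring_of_pseudorandom {n s : ℕ} {G : SimpleGraph (Fin n)} {d : ℝ}
    (hs : 0 < s) (hsn : 16 * s ≤ n)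
    (hiso : ∀ v, ∃ w, G.Adj v w)
    (hstar : ∀ v, (adjSet G v \ goodSet G d).card < 8)
    (hbadEdge : ∀ v b, G.Adj v b → b ∉ goodSet G d → 8 < (adjSet G v).card)
    (hbadPath : ∀ v x b, v ≠ b → G.Adj v x → G.Adj x b → b ∉ goodSet G d →
      8 < (adjSet G v).card)
    (hsparse : ∀ S T : Finset (Fin n), 1 ≤ S.card → S.card ≤ s → T.card = 16 * S.card →
      ((adjPairs G (forwardPairs S T)).card : ℝ) < (d - 8) * S.card)
    (hedge : ∀ S T : Finset (Fin n), Disjoint S T → s ≤ 4 * S.card → s ≤ 4 * T.card →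
      ∃ a ∈ S, ∃ b ∈ T, G.Adj a b) :
    ∃ c : Sym2 (Fin n) → ℕ, (∀ e, c e < 2) ∧ IsProperPathColoring G c := by
  have hnbr : ∀ b, ∃ x ∈ goodSet G d, G.Adj b x := by
    intro b
    by_contra! hcon
    obtain ⟨w, hw⟩ := hiso b
    have h1 := hbadEdge b w hw fun h => hcon w h hw
    have h2 : adjSet G b \ goodSet G d = adjSet G b := by
      refine Finset.sdiff_eq_self_of_disjoint (Finset.disjoint_left.mpr fun x hx hxg => ?_)
      exact hcon x hxg (mem_adjSet.mp hx)
    have h3 := hstar b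
    rw [h2] at h3
    omega
  refine exists_properPathColoring hs (forwardExpands_of_sparse hsn hstar hsparse) hedge
    (fun b _ => hnbr b) ?_
  intro b _ b' hb' hbb'
  obtain ⟨x, hx, hbx⟩ := hnbr b
  obtain ⟨x', hx', hbx'⟩ := hnbr b'
  by_cases hxx : x = x'
  · subst hxx
    have h1 := hbadPath b x b' hbb' hbx hbx'.symm hb'
    have h2 := hstar b
    have h3 := Finset.card_sdiff_add_card_inter (adjSet G b) (goodSet G d)
    have h4 : 1 < (adjSet G b ∩ goodSet G d).card := by omega
    obtain ⟨y, hy, hyx⟩ := Finset.exists_mem_ne h4 x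
    rw [Finset.mem_inter] at hy
    exact ⟨y, hy.2, x, hx, hyx, mem_adjSet.mp hy.1, hbx'⟩
  · exact ⟨x, hx, x', hx', hxx, hbx, hbx'⟩

theorem erProb_exists_isolated_le {n : ℕ} {p : ℝ} (h0 : 0 ≤ p) (h1 : p ≤ 1) :
    erProb n p {G | ¬ ∀ v, ∃ w, G.Adj v w} ≤ n * Real.exp (-(p * (n - 1))) := by
  classical
  have := erProb_le_card_mul h0 h1 (Finset.univ : Finset (Fin n))
    {G | ¬ ∀ v, ∃ w, G.Adj v w} (fun v => {G | ∀ w, ¬ G.Adj v w})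
    (fun G hG => by
      simp only [Set.mem_ofPred_eq, not_forall, not_exists] at hG
      obtain ⟨v, hv⟩ := hG
      exact ⟨v, Finset.mem_univ _, hv⟩)
    (Real.exp (-(p * (n - 1)))) (fun v _ => by
      have hP : ∀ q ∈ ({v} : Finset (Fin n)) ×ˢ Finset.univ.erase v,
          (q.2, q.1) ∉ ({v} : Finset (Fin n)) ×ˢ Finset.univ.erase v := by
        rintro ⟨a, b⟩ hq hq'
        simp only [Finset.mem_product, Finset.mem_singleton, Finset.mem_erase] at hq hq'
        exact hq.2.1 hq'.1
      have hc : ((({v} : Finset (Fin n)) ×ˢ Finset.univ.erase v).card : ℝ) = n - 1 := by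
        rw [Finset.card_product, Finset.card_singleton, one_mul,
          Finset.card_erase_of_mem (Finset.mem_univ _), Finset.card_univ, Fintype.card_fin,
          Nat.cast_pred (Fin.pos v)]
      have h := erProb_no_adjPairs_le h0 h1 hP
      rw [hc] at h
      refine (erProb_mono h0 h1 ?_).trans h
      rintro G hG ⟨a, b⟩ hq
      simp only [Finset.mem_product, Finset.mem_singleton] at hq
      rw [hq.1]
      exact hG b)
  simpa using this

theorem exists_edge_event_le {n : ℕ} {p : ℝ} (h0 : 0 ≤ p) (h1 : p ≤ 1) (s : ℕ) :
    erProb n p {G | ¬ ∀ S T : Finset (Fin n), Disjoint S T → s ≤ 4 * S.card → s ≤ 4 * T.card →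
      ∃ a ∈ S, ∃ b ∈ T, G.Adj a b} ≤ 4 ^ n * Real.exp (-(p * s ^ 2 / 16)) := by
  classical
  have := erProb_le_card_mul h0 h1
    ((Finset.univ : Finset (Finset (Fin n) × Finset (Fin n))).filter
      (fun q => Disjoint q.1 q.2 ∧ s ≤ 4 * q.1.card ∧ s ≤ 4 * q.2.card))
    {G | ¬ ∀ S T : Finset (Fin n), Disjoint S T → s ≤ 4 * S.card → s ≤ 4 * T.card →
      ∃ a ∈ S, ∃ b ∈ T, G.Adj a b} (fun q => {G | ∀ a ∈ q.1, ∀ b ∈ q.2, ¬ G.Adj a b})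
    (fun G hG => by
      simp only [Set.mem_ofPred_eq] at hG
      push Not at hG
      obtain ⟨S, T, hd, hS, hT, h⟩ := hG
      exact ⟨(S, T), by simp [hd, hS, hT], h⟩)
    (Real.exp (-(p * s ^ 2 / 16))) (fun q hq => by
      obtain ⟨_, hd, hS, hT⟩ := Finset.mem_filter.mp hq
      have hP : ∀ r ∈ q.1 ×ˢ q.2, (r.2, r.1) ∉ q.1 ×ˢ q.2 := by
        rintro ⟨a, b⟩ hr hr'
        simp only [Finset.mem_product] at hr hr'
        exact Finset.disjoint_left.mp hd hr.1 hr'.2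
      refine (erProb_mono h0 h1 ?_).trans ((erProb_no_adjPairs_le h0 h1 hP).trans
        (Real.exp_le_exp.mpr ?_))
      · rintro G hG ⟨a, b⟩ hr
        simp only [Finset.mem_product] at hr
        exact hG a hr.1 b hr.2
      · rw [Finset.card_product]
        push_cast
        have hS' : (s : ℝ) ≤ 4 * q.1.card := by exact_mod_cast hS
        have hT' : (s : ℝ) ≤ 4 * q.2.card := by exact_mod_cast hT
        have hmul : (s : ℝ) * s ≤ (4 * q.1.card) * (4 * q.2.card) := by gcongr
        nlinarith)
  refine this.trans ?_
  gcongr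
  refine (Nat.cast_le.mpr (Finset.card_filter_le _ _)).trans ?_
  rw [Finset.card_univ, Fintype.card_prod, Fintype.card_finset, Fintype.card_fin]
  push_cast
  rw [← mul_pow]
  norm_num

theorem powersetCard_card_le_pow {n k : ℕ} :
    ((Finset.powersetCard k (Finset.univ : Finset (Fin n))).card : ℝ) ≤ (n : ℝ) ^ k := by
  rw [Finset.card_powersetCard, Finset.card_univ, Fintype.card_fin]
  exact_mod_cast Nat.choose_le_pow n k

theorem dense_forward_event_le {n : ℕ} {p : ℝ} (h0 : 0 ≤ p) (h1 : p ≤ 1) (s : ℕ) {μ : ℝ}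
    (hμ : 0 ≤ μ) (t : ℝ) :
    erProb n p {G | ¬ ∀ S T : Finset (Fin n), 1 ≤ S.card → S.card ≤ s → T.card = 16 * S.card →
      ((adjPairs G (forwardPairs S T)).card : ℝ) < t * S.card} ≤
      ∑ k ∈ Finset.Icc 1 s, (n : ℝ) ^ (17 * k) *
        Real.exp (-(μ * (t * k)) + Real.exp μ * (p * (16 * k ^ 2))) := by
  classical
  refine (erProb_le_sum h0 h1 (Finset.Icc 1 s) _ (fun k => {G | ∃ S T : Finset (Fin n),
    S.card = k ∧ T.card = 16 * k ∧ t * k ≤ (adjPairs G (forwardPairs S T)).card}) ?_).trans ?_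
  · intro G hG
    simp only [Set.mem_ofPred_eq] at hG
    push Not at hG
    obtain ⟨S, T, hS1, hSs, hT, h⟩ := hG
    exact ⟨S.card, Finset.mem_Icc.mpr ⟨hS1, hSs⟩, S, T, rfl, hT, h⟩
  · refine Finset.sum_le_sum fun k _ => ?_
    refine (erProb_le_card_mul h0 h1 (Finset.powersetCard k Finset.univ ×ˢ
      Finset.powersetCard (16 * k) Finset.univ) _ (fun q => {G | t * k ≤
        (adjPairs G (forwardPairs q.1 q.2)).card}) ?_
        (Real.exp (-(μ * (t * k)) + Real.exp μ * (p * (16 * k ^ 2)))) ?_).trans ?_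
    · rintro G ⟨S, T, hS, hT, h⟩
      exact ⟨(S, T), by simp [Finset.mem_powersetCard, hS, hT], h⟩
    · rintro ⟨S, T⟩ hq
      simp only [Finset.mem_product, Finset.mem_powersetCard] at hq
      have hP : ∀ r ∈ forwardPairs S T, (r.2, r.1) ∉ forwardPairs S T := by
        rintro ⟨a, b⟩ hr hr'
        simp only [forwardPairs, Finset.mem_filter] at hr hr'
        omega
      refine (erProb_many_adjPairs_le h0 h1 hP hμ (t * k)).trans (Real.exp_le_exp.mpr ?_)
      have hc : ((forwardPairs S T).card : ℝ) ≤ 16 * k ^ 2 := by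
        have := Finset.card_filter_le (S ×ˢ T) (fun q => q.2.val % 4 = (q.1.val + 1) % 4)
        rw [Finset.card_product, hq.1.2, hq.2.2] at this
        have h2 : (forwardPairs S T).card ≤ 16 * k ^ 2 := this.trans (le_of_eq (by ring))
        exact_mod_cast h2
      gcongr
    · rw [Finset.card_product]
      push_cast
      have : (n : ℝ) ^ (17 * k) = (n : ℝ) ^ k * (n : ℝ) ^ (16 * k) := by
        rw [← pow_add]; congr 1; ring
      rw [this]
      gcongr
      · exact powersetCard_card_le_pow
      · exact powersetCard_card_le_pow

/-- Prescribing the edges `F` inside `U`, few neighbors for the vertices of `V ⊆ U` and few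
forward neighbors for the vertices of `S ⊆ U` is unlikely. -/
theorem erProb_lowDegree_le {n : ℕ} {p : ℝ} (h0 : 0 ≤ p) (h1 : p ≤ 1) {U V S : Finset (Fin n)}
    (hV : V ⊆ U) (hS : S ⊆ U) (hVS : Disjoint V S) {F : Finset (Sym2 (Fin n))}
    (hF : F ⊆ edgesOf ⊤) (hFU : ∀ e ∈ F, ∀ v ∈ e, v ∈ U) (d : ℝ) :
    erProb n p {G | F ⊆ edgesOf G ∧ (∀ v ∈ V, (adjSet G v).card ≤ 8) ∧
      ∀ u ∈ S, ((forwardSet G u).card : ℝ) ≤ d} ≤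
      p ^ F.card * Real.exp (3 * (V.card * 8 + S.card * d) -
        19 / 20 * (p * (V.card * (n - U.card) + S.card * (n / 4 - 1 - U.card)))) := by
  classical
  have hVSU : V ∪ S ⊆ U := Finset.union_subset hV hS
  obtain ⟨r, hr⟩ : ∃ r : Fin n → Fin n → Prop, ∀ u w, r u w ↔
      u ∈ V ∨ u ∈ S ∧ w.val % 4 = (u.val + 1) % 4 := ⟨_, fun _ _ => Iff.rfl⟩
  have h := erProb_local_le h0 h1 U r hF hFU
    (V.card * 8 + S.card * d) (V.card * (n - U.card) + S.card * (n / 4 - 1 - U.card)) ?_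
  · refine (erProb_mono h0 h1 ?_).trans h
    rintro G ⟨hG, hGV, hGS⟩
    refine ⟨hG, ?_⟩
    rw [← Finset.sum_subset hVSU, Finset.sum_union hVS]
    · rw [← nsmul_eq_mul, ← nsmul_eq_mul]
      refine add_le_add (Finset.sum_le_card_nsmul _ _ _ fun v hv => ?_)
        (Finset.sum_le_card_nsmul _ _ _ fun u hu => ?_)
      · refine le_trans (Nat.cast_le.mpr (Finset.card_le_card (t := adjSet G v) ?_)) ?_
        · intro w hw
          exact mem_adjSet.mpr (Finset.mem_filter.mp hw).2.2
        · exact_mod_cast hGV v hv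
      · refine le_trans (Nat.cast_le.mpr (Finset.card_le_card (t := forwardSet G u) ?_)) (hGS u hu)
        intro w hw
        obtain ⟨_, ⟨_, huw⟩, ha⟩ := Finset.mem_filter.mp hw
        rcases (hr u w).mp huw with h | h
        · exact absurd hu (Finset.disjoint_left.mp hVS h)
        · exact mem_forwardSet.mpr ⟨ha, h.2⟩
    · intro u _ hu
      rw [Nat.cast_eq_zero, Finset.card_eq_zero, Finset.filter_eq_empty_iff]
      rintro w _ ⟨⟨_, huw⟩, _⟩
      rcases (hr u w).mp huw with h | h
      · exact hu (Finset.mem_union_left _ h)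
      · exact hu (Finset.mem_union_right _ h.1)
  · refine le_trans ?_ (Finset.sum_le_sum_of_subset_of_nonneg hVSU fun _ _ _ => Nat.cast_nonneg _)
    rw [Finset.sum_union hVS, ← nsmul_eq_mul, ← nsmul_eq_mul]
    refine add_le_add (Finset.card_nsmul_le_sum _ _ _ fun v hv => ?_)
      (Finset.card_nsmul_le_sum _ _ _ fun u hu => ?_)
    · refine (card_compl_ge U).trans (Nat.cast_le.mpr (Finset.card_le_card ?_))
      intro w hw
      exact Finset.mem_filter.mpr ⟨Finset.mem_univ _, (Finset.mem_filter.mp hw).2,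
        (hr v w).mpr (Or.inl hv)⟩
    · refine (card_residue_class_sdiff_ge U ((u.val + 1) % 4) (Nat.mod_lt _ (by norm_num))).trans
        (Nat.cast_le.mpr (Finset.card_le_card ?_))
      intro w hw
      obtain ⟨_, hw1, hw2⟩ := Finset.mem_filter.mp hw
      exact Finset.mem_filter.mpr ⟨Finset.mem_univ _, hw1, (hr u w).mpr (Or.inr ⟨hu, hw2⟩)⟩

theorem bad_star_event_le {n : ℕ} {p : ℝ} (h0 : 0 ≤ p) (h1 : p ≤ 1) (d : ℝ) :
    erProb n p {G | ¬ ∀ v, (adjSet G v \ goodSet G d).card < 8} ≤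
      n ^ 9 * (p ^ 8 * Real.exp (3 * (8 * d) - 19 / 20 * (p * (8 * (n / 4 - 10))))) := by
  classical
  refine (erProb_le_card_mul h0 h1 (((Finset.univ : Finset (Fin n)) ×ˢ
    Finset.powersetCard 8 Finset.univ).filter (fun q => q.1 ∉ q.2)) _
    (fun q => {G | q.2.image (fun u => s(q.1, u)) ⊆ edgesOf G ∧
      (∀ v ∈ (∅ : Finset (Fin n)), (adjSet G v).card ≤ 8) ∧
      ∀ u ∈ q.2, ((forwardSet G u).card : ℝ) ≤ d}) ?_
    (p ^ 8 * Real.exp (3 * (8 * d) - 19 / 20 * (p * (8 * (n / 4 - 10))))) ?_).trans ?_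
  · intro G hG
    simp only [Set.mem_ofPred_eq] at hG
    push Not at hG
    obtain ⟨v, hv⟩ := hG
    obtain ⟨S, hS, hSc⟩ := Finset.exists_subset_card_eq hv
    have hS' : ∀ u ∈ S, G.Adj v u ∧ u ∉ goodSet G d := fun u hu =>
      ⟨mem_adjSet.mp (Finset.mem_sdiff.mp (hS hu)).1, (Finset.mem_sdiff.mp (hS hu)).2⟩
    refine ⟨(v, S), ?_, ?_, by simp, ?_⟩
    · simp only [Finset.mem_filter, Finset.mem_product, Finset.mem_univ,
        Finset.mem_powersetCard, Finset.subset_univ, hSc, and_self, true_and]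
      exact fun hvS => (hS' v hvS).1.ne rfl
    · intro e he
      obtain ⟨u, hu, rfl⟩ := Finset.mem_image.mp he
      exact mem_edgesOf.mpr (hS' u hu).1
    · intro u hu
      have := (hS' u hu).2
      rw [mem_goodSet, not_le] at this
      exact this.le
  · rintro ⟨v, S⟩ hq
    simp only [Finset.mem_filter, Finset.mem_product, Finset.mem_univ, Finset.mem_powersetCard,
      Finset.subset_univ, true_and] at hq
    obtain ⟨hSc, hvS⟩ := hq
    have hcF : (S.image (fun u => s(v, u))).card = 8 := by
      rw [Finset.card_image_of_injective _ fun a b hab => Sym2.congr_right.mp hab, hSc]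
    have h := erProb_lowDegree_le h0 h1 (U := insert v S) (Finset.empty_subset _)
      (Finset.subset_insert v S) (Finset.disjoint_empty_left S)
      (F := S.image (fun u => s(v, u))) ?_ ?_ d
    · rw [hcF, hSc, Finset.card_insert_of_notMem hvS, hSc] at h
      refine h.trans (le_of_eq ?_)
      congr 2
      push_cast [Finset.card_empty]
      ring
    · intro e he
      obtain ⟨u, hu, rfl⟩ := Finset.mem_image.mp he
      exact mem_edgesOf_top.mpr fun h => hvS (h ▸ hu)
    · intro e he w hw
      obtain ⟨u, hu, rfl⟩ := Finset.mem_image.mp he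
      rcases Sym2.mem_iff.mp hw with rfl | rfl
      · exact Finset.mem_insert_self _ _
      · exact Finset.mem_insert_of_mem hu
  · gcongr
    refine (Nat.cast_le.mpr (Finset.card_filter_le _ _)).trans ?_
    rw [Finset.card_product, Finset.card_univ, Fintype.card_fin]
    push_cast
    rw [pow_succ' (n : ℝ) 8]
    gcongr
    exact powersetCard_card_le_pow

theorem bad_edge_event_le {n : ℕ} {p : ℝ} (h0 : 0 ≤ p) (h1 : p ≤ 1) (d : ℝ) :
    erProb n p {G | ¬ ∀ v b, G.Adj v b → b ∉ goodSet G d → 8 < (adjSet G v).card} ≤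
      n ^ 2 * (p * Real.exp (3 * (8 + d) - 19 / 20 * (p * (5 / 4 * n - 5)))) := by
  classical
  refine (erProb_le_card_mul h0 h1 ((Finset.univ : Finset (Fin n × Fin n)).filter
    (fun q => q.1 ≠ q.2)) _
    (fun q => {G | {s(q.1, q.2)} ⊆ edgesOf G ∧
      (∀ v ∈ ({q.1} : Finset (Fin n)), (adjSet G v).card ≤ 8) ∧
      ∀ u ∈ ({q.2} : Finset (Fin n)), ((forwardSet G u).card : ℝ) ≤ d}) ?_
    (p * Real.exp (3 * (8 + d) - 19 / 20 * (p * (5 / 4 * n - 5)))) ?_).trans ?_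
  · intro G hG
    simp only [Set.mem_ofPred_eq] at hG
    push Not at hG
    obtain ⟨v, b, hvb, hb, hv⟩ := hG
    refine ⟨(v, b), by simp [hvb.ne], ?_, by simpa using hv, ?_⟩
    · simpa [mem_edgesOf] using hvb
    · rw [mem_goodSet, not_le] at hb
      simpa using hb.le
  · rintro ⟨v, b⟩ hq
    have hne : v ≠ b := (Finset.mem_filter.mp hq).2
    have h := erProb_lowDegree_le h0 h1 (U := {v, b}) (V := {v}) (S := {b}) (by simp) (by simp)
      (by simpa using hne) (F := {s(v, b)})
      (by simpa using mem_edgesOf_top.mpr hne) (by simp) d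
    rw [Finset.card_pair hne] at h
    refine h.trans (le_of_eq ?_)
    rw [Finset.card_singleton, pow_one]
    congr 2
    push_cast [Finset.card_singleton]
    ring
  · gcongr
    refine (Nat.cast_le.mpr (Finset.card_filter_le _ _)).trans (le_of_eq ?_)
    rw [Finset.card_univ, Fintype.card_prod, Fintype.card_fin]
    push_cast
    ring

theorem bad_path_event_le {n : ℕ} {p : ℝ} (h0 : 0 ≤ p) (h1 : p ≤ 1) (d : ℝ) :
    erProb n p {G | ¬ ∀ v x b, v ≠ b → G.Adj v x → G.Adj x b → b ∉ goodSet G d →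
      8 < (adjSet G v).card} ≤
      n ^ 3 * (p ^ 2 * Real.exp (3 * (8 + d) - 19 / 20 * (p * (5 / 4 * n - 7)))) := by
  classical
  refine (erProb_le_card_mul h0 h1 ((Finset.univ : Finset (Fin n × Fin n × Fin n)).filter
    (fun q => q.1 ≠ q.2.1 ∧ q.1 ≠ q.2.2 ∧ q.2.1 ≠ q.2.2)) _
    (fun q => {G | {s(q.1, q.2.1), s(q.2.1, q.2.2)} ⊆ edgesOf G ∧
      (∀ v ∈ ({q.1} : Finset (Fin n)), (adjSet G v).card ≤ 8) ∧
      ∀ u ∈ ({q.2.2} : Finset (Fin n)), ((forwardSet G u).card : ℝ) ≤ d}) ?_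
    (p ^ 2 * Real.exp (3 * (8 + d) - 19 / 20 * (p * (5 / 4 * n - 7)))) ?_).trans ?_
  · intro G hG
    simp only [Set.mem_ofPred_eq] at hG
    push Not at hG
    obtain ⟨v, x, b, hne, hvx, hxb, hb, hv⟩ := hG
    refine ⟨(v, x, b), by simp [hne, hvx.ne, hxb.ne], ?_, by simpa using hv, ?_⟩
    · simp [Finset.insert_subset_iff, mem_edgesOf, hvx, hxb]
    · rw [mem_goodSet, not_le] at hb
      simpa using hb.le
  · rintro ⟨v, x, b⟩ hq
    obtain ⟨hvx, hvb, hxb⟩ : v ≠ x ∧ v ≠ b ∧ x ≠ b := (Finset.mem_filter.mp hq).2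
    have h := erProb_lowDegree_le h0 h1 (U := {v, x, b}) (V := {v}) (S := {b}) (by simp) (by simp)
      (by simpa using hvb) (F := {s(v, x), s(x, b)})
      (by simp [Finset.insert_subset_iff, mem_edgesOf_top, hvx, hxb]) (by simp) d
    have hF : ({s(v, x), s(x, b)} : Finset (Sym2 (Fin n))).card = 2 := by
      refine Finset.card_pair fun he => ?_
      rcases Sym2.eq_iff.mp he with ⟨h, _⟩ | ⟨h, _⟩
      · exact hvx h
      · exact hvb h
    have hU : ({v, x, b} : Finset (Fin n)).card = 3 := Finset.card_eq_three.mpr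
      ⟨v, x, b, hvx, hvb, hxb, rfl⟩
    rw [hF, hU] at h
    refine h.trans (le_of_eq ?_)
    congr 2
    push_cast [Finset.card_singleton]
    ring
  · gcongr
    refine (Nat.cast_le.mpr (Finset.card_filter_le _ _)).trans (le_of_eq ?_)
    rw [Finset.card_univ, Fintype.card_prod, Fintype.card_prod, Fintype.card_fin]
    push_cast
    ring

theorem isolated_bound {n p : ℝ} (hn : 0 < n) (h1 : p ≤ 1) :
    n * Real.exp (-(p * (n - 1))) ≤ Real.exp 1 * Real.exp (-(p * n - Real.log n)) := by
  nth_rewrite 1 [← Real.exp_log hn]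
  rw [← Real.exp_add, ← Real.exp_add, Real.exp_le_exp]
  linarith

theorem bad_star_bound {n p : ℝ} (hn : 1 ≤ n) (h0 : 0 ≤ p) (h1 : p ≤ 1)
    (hl : Real.log n ≤ p * n) (hu : p * n ≤ 2 * Real.log n) :
    n ^ 9 * (p ^ 8 * Real.exp (3 * (8 * (Real.log n / 1000)) -
      19 / 20 * (p * (8 * (n / 4 - 10))))) ≤
      2 ^ 8 * Real.exp 76 * (Real.log n ^ 8 * Real.exp (-(Real.log n / 10))) := by
  have hn0 : 0 < n := by linarith
  have hL := Real.log_nonneg hn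
  calc _ = (p * n) ^ 8 * (n * Real.exp (3 * (8 * (Real.log n / 1000)) -
      19 / 20 * (p * (8 * (n / 4 - 10))))) := by ring
    _ ≤ (2 * Real.log n) ^ 8 * (Real.exp 76 * Real.exp (-(Real.log n / 10))) := by
        refine mul_le_mul (by gcongr) ?_ (by positivity) (by positivity)
        nth_rewrite 1 [← Real.exp_log hn0]
        rw [← Real.exp_add, ← Real.exp_add, Real.exp_le_exp]
        linarith
    _ = _ := by ring

theorem bad_edge_bound {n p : ℝ} (hn : 1 ≤ n) (h1 : p ≤ 1)
    (hl : Real.log n ≤ p * n) (hu : p * n ≤ 2 * Real.log n) :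
    n ^ 2 * (p * Real.exp (3 * (8 + Real.log n / 1000) - 19 / 20 * (p * (5 / 4 * n - 5)))) ≤
      2 * Real.exp 31 * (Real.log n ^ 1 * Real.exp (-(Real.log n / 10))) := by
  have hn0 : 0 < n := by linarith
  have hL := Real.log_nonneg hn
  calc _ = (p * n) * (n * Real.exp (3 * (8 + Real.log n / 1000) -
      19 / 20 * (p * (5 / 4 * n - 5)))) := by ring
    _ ≤ (2 * Real.log n) * (Real.exp 31 * Real.exp (-(Real.log n / 10))) := by
        refine mul_le_mul hu ?_ (by positivity) (by positivity)
        nth_rewrite 1 [← Real.exp_log hn0]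
        rw [← Real.exp_add, ← Real.exp_add, Real.exp_le_exp]
        linarith
    _ = _ := by ring

theorem bad_path_bound {n p : ℝ} (hn : 1 ≤ n) (h0 : 0 ≤ p) (h1 : p ≤ 1)
    (hl : Real.log n ≤ p * n) (hu : p * n ≤ 2 * Real.log n) :
    n ^ 3 * (p ^ 2 * Real.exp (3 * (8 + Real.log n / 1000) -
      19 / 20 * (p * (5 / 4 * n - 7)))) ≤
      2 ^ 2 * Real.exp 31 * (Real.log n ^ 2 * Real.exp (-(Real.log n / 10))) := by
  have hn0 : 0 < n := by linarith
  have hL := Real.log_nonneg hn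
  calc _ = (p * n) ^ 2 * (n * Real.exp (3 * (8 + Real.log n / 1000) -
      19 / 20 * (p * (5 / 4 * n - 7)))) := by ring
    _ ≤ (2 * Real.log n) ^ 2 * (Real.exp 31 * Real.exp (-(Real.log n / 10))) := by
        refine mul_le_mul (by gcongr) ?_ (by positivity) (by positivity)
        nth_rewrite 1 [← Real.exp_log hn0]
        rw [← Real.exp_add, ← Real.exp_add, Real.exp_le_exp]
        linarith
    _ = _ := by ring

theorem dense_forward_bound {n p ε : ℝ} {s : ℕ} (hn : 1 ≤ n) (h0 : 0 ≤ p)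
    (hu : p * n ≤ 2 * Real.log n) (hL : 80000 ≤ Real.log n) (hε : ε ≤ 1)
    (hμ : Real.exp 20000 * (32 * ε) = 1) (hs : s ≤ ε * n) :
    ∑ k ∈ Finset.Icc 1 s, n ^ (17 * k) *
        Real.exp (-(20000 * ((Real.log n / 1000 - 8) * k)) +
          Real.exp 20000 * (p * (16 * k ^ 2))) ≤
      Real.exp 160000 * Real.exp (-Real.log n) := by
  have hn0 : 0 < n := by linarith
  generalize hLn : Real.log n = L at *
  have hexp : n = Real.exp L := by rw [← hLn, Real.exp_log hn0]
  have hterm : ∀ k ∈ Finset.Icc 1 s, n ^ (17 * k) *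
      Real.exp (-(20000 * ((L / 1000 - 8) * k)) + Real.exp 20000 * (p * (16 * k ^ 2))) ≤
      Real.exp (160000 - 2 * L) := by
    intro k hk
    obtain ⟨hk1, hks⟩ := Finset.mem_Icc.mp hk
    have hk1' : (1 : ℝ) ≤ k := by exact_mod_cast hk1
    have hks' : (k : ℝ) ≤ ε * n := le_trans (by exact_mod_cast hks) hs
    have h : Real.exp 20000 * (p * (16 * k ^ 2)) ≤ k * L := by
      calc Real.exp 20000 * (p * (16 * (k : ℝ) ^ 2))
          = Real.exp 20000 * 16 * p * k * k := by ring
        _ ≤ Real.exp 20000 * 16 * p * k * (ε * n) := by gcongr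
        _ = Real.exp 20000 * (32 * ε) * (k * (p * n / 2)) := by ring
        _ = k * (p * n / 2) := by rw [hμ, one_mul]
        _ ≤ k * L := by gcongr; linarith
    rw [hexp, ← Real.exp_nat_mul, ← Real.exp_add, Real.exp_le_exp]
    push_cast
    nlinarith
  refine (Finset.sum_le_card_nsmul _ _ _ hterm).trans ?_
  rw [nsmul_eq_mul, Nat.card_Icc, Nat.add_sub_cancel]
  have hsn : (s : ℝ) ≤ Real.exp L := by
    rw [← hexp]
    nlinarith
  calc (s : ℝ) * Real.exp (160000 - 2 * L) ≤ Real.exp L * Real.exp (160000 - 2 * L) := by gcongr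
    _ = _ := by
      rw [← Real.exp_add, ← Real.exp_add]
      congr 1
      ring

theorem exists_edge_bound {n : ℕ} {p ε : ℝ} {s : ℕ} (hn : 1 ≤ n) (h0 : 0 ≤ p)
    (hl : Real.log n ≤ p * n) (hε : 0 < ε) (hs : ε * n / 2 ≤ s)
    (hL : 64 * (1 + Real.log 4) ≤ ε ^ 2 * Real.log n) :
    (4 : ℝ) ^ n * Real.exp (-(p * s ^ 2 / 16)) ≤ Real.exp (-Real.log n) := by
  have hn0 : (0 : ℝ) < n := by exact_mod_cast hn
  have h4 : (4 : ℝ) ^ n = Real.exp (n * Real.log 4) := by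
    rw [Real.exp_nat_mul, Real.exp_log (by norm_num)]
  rw [h4, ← Real.exp_add, Real.exp_le_exp]
  have h1 : Real.log n ≤ n := Real.log_le_self hn0.le
  have h2 : p * (ε * n / 2) ^ 2 ≤ p * (s : ℝ) ^ 2 := by gcongr
  have h3 : ε ^ 2 * Real.log n * n ≤ ε ^ 2 * (p * n) * n := by gcongr
  have h5 := mul_le_mul_of_nonneg_right hL hn0.le
  nlinarith

/-- A union bound for the failure of a 2-coloring with proper paths to exist. -/
theorem erProb_no_properPathColoring_le {n s : ℕ} {p : ℝ} (h0 : 0 ≤ p) (h1 : p ≤ 1) (d : ℝ)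
    {μ : ℝ} (hμ : 0 ≤ μ) (hs : 0 < s) (hsn : 16 * s ≤ n) :
    erProb n p {G | ∃ c : Sym2 (Fin n) → ℕ, (∀ e, c e < 2) ∧ IsProperPathColoring G c}ᶜ ≤
      n * Real.exp (-(p * (n - 1))) +
      (n ^ 9 * (p ^ 8 * Real.exp (3 * (8 * d) - 19 / 20 * (p * (8 * (n / 4 - 10))))) +
      (n ^ 2 * (p * Real.exp (3 * (8 + d) - 19 / 20 * (p * (5 / 4 * n - 5)))) +
      (n ^ 3 * (p ^ 2 * Real.exp (3 * (8 + d) - 19 / 20 * (p * (5 / 4 * n - 7)))) +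
      (∑ k ∈ Finset.Icc 1 s, (n : ℝ) ^ (17 * k) *
        Real.exp (-(μ * ((d - 8) * k)) + Real.exp μ * (p * (16 * k ^ 2))) +
      4 ^ n * Real.exp (-(p * s ^ 2 / 16)))))) := by
  refine (erProb_mono h0 h1 ?_).trans ((erProb_union_le h0 h1 _ _).trans
    (add_le_add (erProb_exists_isolated_le h0 h1) ((erProb_union_le h0 h1 _ _).trans
    (add_le_add (bad_star_event_le h0 h1 d) ((erProb_union_le h0 h1 _ _).trans
    (add_le_add (bad_edge_event_le h0 h1 d) ((erProb_union_le h0 h1 _ _).trans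
    (add_le_add (bad_path_event_le h0 h1 d) ((erProb_union_le h0 h1 _ _).trans
    (add_le_add (dense_forward_event_le h0 h1 s hμ (d - 8))
      (exists_edge_event_le h0 h1 s)))))))))))
  intro G hG
  by_contra hcon
  simp only [Set.mem_union, Set.mem_ofPred_eq, not_or, not_not] at hcon
  obtain ⟨e1, e2, e3, e4, e5, e6⟩ := hcon
  exact hG (exists_properPathColoring_of_pseudorandom hs hsn e1 e2 e3 e4 e5 e6)

theorem tendsto_log_pow_mul_exp_neg (C : ℝ) (k : ℕ) :
    Filter.Tendsto (fun n : ℕ => C * (Real.log n ^ k * Real.exp (-(Real.log n / 10))))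
      Filter.atTop (nhds 0) := by
  have h1 : Filter.Tendsto (fun n : ℕ => Real.log n / 10) Filter.atTop Filter.atTop :=
    (Real.tendsto_log_atTop.comp tendsto_natCast_atTop_atTop).atTop_div_const (by norm_num)
  have h2 := ((Real.tendsto_pow_mul_exp_neg_atTop_nhds_zero k).comp h1).const_mul (C * 10 ^ k)
  rw [mul_zero] at h2
  refine h2.congr fun n => ?_
  simp only [Function.comp, div_pow]
  field_simp

theorem tendsto_erProb_no_properPathColoring {p : ℕ → ℝ} (hp01 : ∀ n, 0 ≤ p n ∧ p n ≤ 1)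
    (hl : Filter.Tendsto (fun n : ℕ => p n * n - Real.log n) Filter.atTop Filter.atTop)
    (hu : ∀ᶠ n : ℕ in Filter.atTop, p n * n ≤ 2 * Real.log n) :
    Filter.Tendsto (fun n : ℕ => erProb n (p n)
      {G | ∃ c : Sym2 (Fin n) → ℕ, (∀ e, c e < 2) ∧ IsProperPathColoring G c}ᶜ)
      Filter.atTop (nhds 0) := by
  obtain ⟨ε, hε⟩ : ∃ ε : ℝ, ε = Real.exp (-20000) / 32 := ⟨_, rfl⟩
  have hε0 : 0 < ε := by rw [hε]; positivity
  have hμ : Real.exp 20000 * (32 * ε) = 1 := by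
    rw [hε, mul_div_cancel₀ _ (by norm_num), ← Real.exp_add]
    norm_num
  have hε16 : 16 * ε ≤ 1 := by
    have := Real.exp_le_one_iff.mpr (show (-20000 : ℝ) ≤ 0 by norm_num)
    linarith
  have hlog : Filter.Tendsto (fun n : ℕ => Real.log n) Filter.atTop Filter.atTop :=
    Real.tendsto_log_atTop.comp tendsto_natCast_atTop_atTop
  have hexp := Real.tendsto_exp_neg_atTop_nhds_zero
  have hlim := ((hexp.comp hl).const_mul (Real.exp 1)).add
    ((tendsto_log_pow_mul_exp_neg (2 ^ 8 * Real.exp 76) 8).add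
    ((tendsto_log_pow_mul_exp_neg (2 * Real.exp 31) 1).add
    ((tendsto_log_pow_mul_exp_neg (2 ^ 2 * Real.exp 31) 2).add
    (((hexp.comp hlog).const_mul (Real.exp 160000)).add (hexp.comp hlog)))))
  simp only [mul_zero, add_zero] at hlim
  refine squeeze_zero' (Filter.Eventually.of_forall fun n =>
    erProb_nonneg (hp01 n).1 (hp01 n).2 _) ?_ hlim
  filter_upwards [hu, hl.eventually_ge_atTop 0, Filter.eventually_ge_atTop 1,
    hlog.eventually_ge_atTop 80000, hlog.eventually_ge_atTop (64 * (1 + Real.log 4) / ε ^ 2),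
    (tendsto_natCast_atTop_atTop (R := ℝ)).eventually_ge_atTop (2 / ε)]
    with n hun hln hn1 hL1 hL2 hnε
  obtain ⟨h0, h1⟩ := hp01 n
  have hn1' : (1 : ℝ) ≤ n := by exact_mod_cast hn1
  have hln' : Real.log n ≤ p n * n := by linarith
  have hL3 : 64 * (1 + Real.log 4) ≤ ε ^ 2 * Real.log n := by
    rw [div_le_iff₀ (by positivity)] at hL2
    linarith
  have hnε' : 2 ≤ ε * n := by
    rw [div_le_iff₀ hε0] at hnε
    linarith
  have hs1 : (⌊ε * n⌋₊ : ℝ) ≤ ε * n := Nat.floor_le (by positivity)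
  have hs2 : ε * n / 2 ≤ (⌊ε * n⌋₊ : ℝ) := by
    have := Nat.lt_floor_add_one (ε * n)
    linarith
  have hs0 : 0 < ⌊ε * n⌋₊ := Nat.floor_pos.mpr (by linarith)
  have hsn : 16 * ⌊ε * n⌋₊ ≤ n := by
    have : (16 : ℝ) * ⌊ε * n⌋₊ ≤ n := by nlinarith
    exact_mod_cast this
  refine (erProb_no_properPathColoring_le h0 h1 (Real.log n / 1000) (μ := 20000) (by norm_num)
    hs0 hsn).trans ?_
  exact add_le_add (isolated_bound (by linarith) h1)
    (add_le_add (bad_star_bound hn1' h0 h1 hln' hun)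
    (add_le_add (bad_edge_bound hn1' h1 hln' hun)
    (add_le_add (bad_path_bound hn1' h0 h1 hln' hun)
    (add_le_add (dense_forward_bound hn1' h0 hun hL1 (by linarith) hμ hs1)
      (exists_edge_bound hn1 h0 hln' hε0 hs2 hL3)))))

theorem IsProperPathColoring.mono {V : Type*} {G H : SimpleGraph V} (hGH : G ≤ H)
    {c : Sym2 V → ℕ} (hc : IsProperPathColoring G c) : IsProperPathColoring H c := by
  intro u v huv
  obtain ⟨w, hw, hwc⟩ := hc u v huv
  refine ⟨w.mapLe hGH, hw.mapLe hGH, ?_⟩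
  rwa [SimpleGraph.Walk.edges_mapLe_eq_edges]

/-- If `α n → +∞` and `p n ≥ (log n + α n) / n` for all large `n` (with `p n ∈ [0,1]`),
then with high probability `G(n, p n)` admits a 2-coloring of its edges in which every pair of
distinct vertices is joined by a proper path, i.e. its proper connection number is at most 2. -/
theorem er_pc_le_two_whp (α : ℕ → ℝ) (hα : Filter.Tendsto α Filter.atTop Filter.atTop)
    (p : ℕ → ℝ) (hp01 : ∀ n, 0 ≤ p n ∧ p n ≤ 1)
    (hp : ∀ᶠ n : ℕ in Filter.atTop, (Real.log n + α n) / n ≤ p n) :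
    Filter.Tendsto
      (fun n : ℕ => erProb n (p n)
        {G | ∃ c : Sym2 (Fin n) → ℕ, (∀ e, c e < 2) ∧ IsProperPathColoring G c})
      Filter.atTop (nhds 1) := by
  have hle : ∀ n : ℕ, min (p n) (2 * Real.log n / n) ≤ p n := fun n => min_le_left _ _
  have hq01 : ∀ n : ℕ, 0 ≤ min (p n) (2 * Real.log n / n) ∧
      min (p n) (2 * Real.log n / n) ≤ 1 := fun n =>
    ⟨le_min (hp01 n).1 (div_nonneg (mul_nonneg zero_le_two (Real.log_natCast_nonneg n))
      n.cast_nonneg), (hle n).trans (hp01 n).2⟩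
  have hlog : Filter.Tendsto (fun n : ℕ => Real.log n) Filter.atTop Filter.atTop :=
    Real.tendsto_log_atTop.comp tendsto_natCast_atTop_atTop
  have hlow : ∀ᶠ n : ℕ in Filter.atTop, min (α n) (Real.log n) ≤
      min (p n) (2 * Real.log n / n) * n - Real.log n := by
    filter_upwards [hp, Filter.eventually_gt_atTop 0] with n hn hn0
    have hn0' : (0 : ℝ) < n := by exact_mod_cast hn0
    rw [div_le_iff₀ hn0'] at hn
    rw [min_mul_of_nonneg _ _ hn0'.le, div_mul_cancel₀ _ hn0'.ne', ← min_sub_sub_right]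
    exact min_le_min (by linarith) (by linarith)
  have hmin : Filter.Tendsto (fun n : ℕ => min (α n) (Real.log n)) Filter.atTop Filter.atTop := by
    refine Filter.tendsto_atTop.mpr fun b => ?_
    filter_upwards [hα.eventually_ge_atTop b, hlog.eventually_ge_atTop b] with n h1 h2
    exact le_min h1 h2
  have hq := tendsto_erProb_no_properPathColoring hq01
    (Filter.tendsto_atTop_mono' _ hlow hmin) (by
      filter_upwards [Filter.eventually_gt_atTop 0] with n hn0
      have hn0' : (0 : ℝ) < n := by exact_mod_cast hn0
      rw [← le_div_iff₀ hn0']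
      exact min_le_right _ _)
  have hq' := hq.const_sub 1
  rw [sub_zero] at hq'
  refine tendsto_of_tendsto_of_tendsto_of_le_of_le hq' tendsto_const_nhds (fun n => ?_)
    fun n => erProb_le_one (hp01 n).1 (hp01 n).2 _
  have h := erProb_le_of_le (hq01 n).1 (hle n) (hp01 n).2
    {G | ∃ c : Sym2 (Fin n) → ℕ, (∀ e, c e < 2) ∧ IsProperPathColoring G c} (by
      rintro G H hGH ⟨c, hc, hG⟩
      exact ⟨c, hc, hG.mono hGH⟩)
  have hadd := erProb_add_compl n (min (p n) (2 * Real.log n / n))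
    {G | ∃ c : Sym2 (Fin n) → ℕ, (∀ e, c e < 2) ∧ IsProperPathColoring G c}
  linarith
end

section
/- Let Γ = (V,E) be a connected graph that is not Hamiltonian, and suppose Γ is a (k,2)-expander, i.e., for every vertex subset U ⊆ V with |U| ≤ k, the set N(U) of vertices outside U having a neighbor in U satisfies |N(U)| ≥ 2|U|. Then Γ has at least k²/2 holes, where a hole is an unordered pair {u,v} of distinct nonadjacent vertices of Γ such that the graph obtained from Γ by adding the edge uv is Hamiltonian or contains a path strictly longer than a longest path of Γ. -/
namespace SimpleGraph

variable {V : Type*} {G : SimpleGraph V}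

/-- The list `l` is the list of vertices of a path of `G`. -/
structure IsPathList (G : SimpleGraph V) (l : List V) : Prop where
  isChain : l.IsChain G.Adj
  nodup : l.Nodup

/-- The list `l` is the list of vertices of a longest path of `G`. -/
structure IsLongestPathList (G : SimpleGraph V) (l : List V) : Prop extends IsPathList G l where
  length_le : ∀ l', IsPathList G l' → l'.length ≤ l.length

lemma Walk.IsPath.isPathList_support {a b : V} {p : G.Walk a b} (hp : p.IsPath) :
    IsPathList G p.support :=
  ⟨p.isChain_adj_support, hp.support_nodup⟩

lemma IsPathList.isPath_ofSupport {l : List V} (hl : IsPathList G l) (hne : l ≠ []) :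
    (Walk.ofSupport l hne hl.isChain).IsPath :=
  Walk.IsPath.mk' (by rw [Walk.support_ofSupport]; exact hl.nodup)

lemma IsPathList.mono {G' : SimpleGraph V} {l : List V} (hl : IsPathList G l) (h : G ≤ G') :
    IsPathList G' l :=
  ⟨hl.isChain.imp fun _ _ hab => h hab, hl.nodup⟩

lemma IsPathList.reverse {l : List V} (hl : IsPathList G l) : IsPathList G l.reverse :=
  ⟨List.isChain_reverse.2 (hl.isChain.imp fun _ _ h => h.symm), List.nodup_reverse.2 hl.nodup⟩

lemma IsLongestPathList.reverse {l : List V} (hl : IsLongestPathList G l) :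
    IsLongestPathList G l.reverse :=
  ⟨hl.toIsPathList.reverse, fun l' h => by simpa using hl.length_le l' h⟩

lemma IsLongestPathList.of_perm {l l' : List V} (hl : IsLongestPathList G l)
    (hl' : l'.IsChain G.Adj) (h : l.Perm l') : IsLongestPathList G l' :=
  ⟨⟨hl', h.nodup_iff.1 hl.nodup⟩, fun m hm => h.length_eq ▸ hl.length_le m hm⟩

lemma exists_isLongestPathList (G : SimpleGraph V) [Fintype V] :
    ∃ l, IsLongestPathList G l := by
  set S : Set ℕ := {n | ∃ l, IsPathList G l ∧ l.length = n}
  have hS : BddAbove S := ⟨Fintype.card V, by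
    rintro _ ⟨l, hl, rfl⟩
    exact hl.nodup.length_le_card⟩
  obtain ⟨l, hl, hlen⟩ := Nat.sSup_mem (s := S) ⟨0, [], ⟨by simp, by simp⟩, rfl⟩ hS
  exact ⟨l, hl, fun l' h => hlen ▸ le_csSup hS ⟨l', h, rfl⟩⟩

lemma isHamiltonian_of_isPathList [Fintype V] [DecidableEq V] {l : List V} (hl : IsPathList G l)
    (hlen : 3 ≤ l.length) (hne : l ≠ []) (hadj : G.Adj (l.getLast hne) (l.head hne))
    (hmem : ∀ v, v ∈ l) : G.IsHamiltonian := by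
  intro _
  refine ⟨_, Walk.cons hadj (Walk.ofSupport l hne hl.isChain), ?_⟩
  have hcard : l.length = Fintype.card V := by
    rw [← List.toFinset_card_of_nodup hl.nodup, ← Finset.card_univ]
    congr 1
    ext v
    simp [hmem v]
  rw [Walk.isHamiltonianCycle_iff_isCycle_and_length_eq, Walk.isCycle_iff_isPath_tail_and_le_length]
  refine ⟨⟨?_, ?_⟩, ?_⟩
  · simpa using hl.isPath_ofSupport hne
  · simp only [Walk.length_cons, Walk.length_ofSupport]
    lia
  · simp only [Walk.length_cons, Walk.length_ofSupport]
    lia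

/-- A cycle in a connected graph is Hamiltonian or can be opened up to a longer path. -/
lemma isHamiltonian_or_exists_longer [Fintype V] [DecidableEq V] (hG : G.Connected) {l : List V}
    (hl : IsPathList G l) (hlen : 3 ≤ l.length) (hne : l ≠ [])
    (hadj : G.Adj (l.getLast hne) (l.head hne)) :
    G.IsHamiltonian ∨ ∃ l', IsPathList G l' ∧ l.length < l'.length := by
  by_cases hmem : ∀ v, v ∈ l
  · exact .inl (isHamiltonian_of_isPathList hl hlen hne hadj hmem)
  right
  push Not at hmem
  obtain ⟨v, hv⟩ := hmem
  obtain ⟨p⟩ := hG.preconnected (l.head hne) v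
  obtain ⟨⟨⟨x, y⟩, hxy⟩, -, hx, hy⟩ := p.exists_boundary_dart {z | z ∈ l} (l.head_mem hne) hv
  obtain ⟨A, B, rfl⟩ := List.append_of_mem (show x ∈ l from hx)
  have hperm : (A ++ x :: B).Perm (x :: B ++ A) := List.perm_append_comm
  refine ⟨y :: (x :: B ++ A), ⟨?_, ?_⟩, ?_⟩
  · have h := hl.isChain
    rw [List.isChain_append] at h
    have hc : List.IsChain G.Adj (x :: B ++ A) := by
      rw [List.isChain_append]
      refine ⟨h.2.1, h.1, ?_⟩
      intro a ha b hb
      have h1 : (A ++ x :: B).getLast hne = a := by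
        rw [List.getLast_append_of_ne_nil (by simp)]
        rw [List.getLast?_eq_some_getLast (by simp)] at ha
        simpa using ha
      have h2 : (A ++ x :: B).head hne = b := by
        cases A <;> simp_all
      rwa [h1, h2] at hadj
    exact List.IsChain.cons_cons hxy.symm hc
  · exact List.nodup_cons.2 ⟨fun h => hy (hperm.mem_iff.2 h), hperm.nodup_iff.1 hl.nodup⟩
  · rw [hperm.length_eq, List.length_cons]
    lia

/-- `Rotation G P Q` means that `Q` arises from `P` by rotations that keep the last vertex. -/
inductive Rotation (G : SimpleGraph V) (P : List V) : List V → Prop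
  | refl : Rotation G P P
  | step {u w : V} {B A : List V} : Rotation G P (u :: B ++ w :: A) → G.Adj u w →
      Rotation G P ((u :: B).reverse ++ w :: A)

lemma Rotation.perm {P Q : List V} (h : Rotation G P Q) : P.Perm Q := by
  induction h with
  | refl => exact .refl _
  | step _ _ ih => exact ih.trans ((List.reverse_perm _).symm.append_right _)

lemma Rotation.getLast?_eq {P Q : List V} (h : Rotation G P Q) : Q.getLast? = P.getLast? := by
  induction h with
  | refl => rfl
  | step _ _ ih => rw [← ih, List.getLast?_append_cons, List.getLast?_append_cons]

lemma Rotation.isChain {P Q : List V} (h : Rotation G P Q) (hP : P.IsChain G.Adj) :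
    Q.IsChain G.Adj := by
  induction h with
  | refl => exact hP
  | step _ hadj ih =>
    rw [List.isChain_append] at ih ⊢
    refine ⟨List.isChain_reverse.2 (ih.1.imp fun _ _ h => h.symm), ih.2.1, ?_⟩
    simpa using hadj

lemma Rotation.isLongestPathList {P Q : List V} (h : Rotation G P Q)
    (hP : IsLongestPathList G P) : IsLongestPathList G Q :=
  hP.of_perm (h.isChain hP.isChain) h.perm

/-- The first vertices of the lists obtained from `P` by rotations. -/
def rotationEnds (G : SimpleGraph V) (P : List V) : Set V :=
  {u | ∃ Q, Rotation G P (u :: Q)}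

lemma Rotation.exists_split {P B A : List V} {u w : V} (h : Rotation G P (u :: B ++ w :: A))
    (hadj : G.Adj u w) : ∃ b ∈ rotationEnds G P, ∃ C, u :: B = C ++ [b] := by
  obtain ⟨C, b, hC⟩ : ∃ C b, u :: B = C ++ [b] :=
    ⟨_, _, (List.dropLast_append_getLast (List.cons_ne_nil u B)).symm⟩
  refine ⟨b, ⟨C.reverse ++ w :: A, ?_⟩, C, hC⟩
  have := h.step hadj
  rw [hC] at this
  simpa using this

/-- A pair of vertices is consecutive in a list, in this order. -/
def Consecutive (l : List V) (x y : V) : Prop := ∃ A B, l = A ++ x :: y :: B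

lemma consecutive_iff_infix {l : List V} {x y : V} : Consecutive l x y ↔ [x, y] <:+: l := by
  simp [Consecutive, List.IsInfix, eq_comm]

lemma consecutive_cons {l : List V} {c x y : V} :
    Consecutive (c :: l) x y ↔ (x = c ∧ l.head? = some y) ∨ Consecutive l x y := by
  rw [consecutive_iff_infix, List.infix_cons_iff, consecutive_iff_infix, List.cons_prefix_cons]
  cases l with
  | nil => simp
  | cons d l => simp [List.cons_prefix_cons, eq_comm (a := d)]

lemma Consecutive.mem_left {l : List V} {x y : V} (h : Consecutive l x y) : x ∈ l := by
  obtain ⟨A, B, rfl⟩ := h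
  simp

lemma consecutive_reverse {l : List V} {x y : V} :
    Consecutive l.reverse x y ↔ Consecutive l y x := by
  rw [consecutive_iff_infix, consecutive_iff_infix, ← List.reverse_infix]
  simp

lemma consecutive_append_cons {A B : List V} {a b x y : V} :
    Consecutive (A ++ [a] ++ b :: B) x y ↔
      Consecutive (A ++ [a]) x y ∨ (x = a ∧ y = b) ∨ Consecutive (b :: B) x y := by
  induction A with
  | nil =>
    have h : ∀ x y : V, ¬ Consecutive [] x y := by simp [Consecutive]
    simp [consecutive_cons, h, eq_comm (a := b)]
  | cons c A ih =>
    rw [List.cons_append, List.cons_append, consecutive_cons, consecutive_cons, ih]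
    have : (A ++ [a] ++ b :: B).head? = (A ++ [a]).head? := by cases A <;> rfl
    rw [this]
    tauto

lemma Rotation.consecutive {P Q : List V} (h : Rotation G P Q) {w : V}
    (hw : w ∉ rotationEnds G P)
    (hP : ∀ u ∈ rotationEnds G P, ¬ Consecutive P u w ∧ ¬ Consecutive P w u) (x : V)
    (hx : Consecutive Q x w ∨ Consecutive Q w x) : Consecutive P x w ∨ Consecutive P w x := by
  induction h generalizing x with
  | refl => exact hx
  | @step u z B A hrot hadj ih =>
    have hu : u ∈ rotationEnds G P := ⟨_, hrot⟩
    obtain ⟨b, hb, C, hC⟩ := hrot.exists_split hadj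
    rw [hC] at ih
    have hwz : w ≠ z := by
      rintro rfl
      have := ih b (.inl (consecutive_append_cons.2 (.inr (.inl ⟨rfl, rfl⟩))))
      have := hP b hb
      tauto
    have hwu : w ≠ u := fun h => hw (h ▸ hu)
    apply ih
    simp only [consecutive_append_cons]
    rw [← hC]
    rw [List.reverse_cons] at hx
    simp only [consecutive_append_cons] at hx
    rw [← List.reverse_cons, consecutive_reverse, consecutive_reverse] at hx
    tauto

lemma exists_consecutive_of_adj_rotationEnds {P : List V} (hP : IsLongestPathList G P) {u w : V}
    (hu : u ∈ rotationEnds G P) (hw : w ∉ rotationEnds G P) (hadj : G.Adj u w) :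
    ∃ x ∈ rotationEnds G P, Consecutive P x w ∨ Consecutive P w x := by
  by_contra! hcon
  obtain ⟨Q, hQ⟩ := hu
  have hlong := hQ.isLongestPathList hP
  have hmem : w ∈ u :: Q := by
    by_contra hmem
    have := hlong.length_le (w :: u :: Q)
      ⟨List.IsChain.cons_cons hadj.symm hlong.isChain, List.nodup_cons.2 ⟨hmem, hlong.nodup⟩⟩
    simp at this
  obtain ⟨B, A, rfl⟩ := List.append_of_mem ((List.mem_cons.1 hmem).resolve_left hadj.ne')
  obtain ⟨b, hb, C, hC⟩ := hQ.exists_split hadj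
  have := hQ.consecutive hw hcon b (.inl (by
    rw [← List.cons_append, hC]
    exact consecutive_append_cons.2 (.inr (.inl ⟨rfl, rfl⟩))))
  have := hcon b hb
  tauto

lemma Consecutive.eq_right {l : List V} (hl : l.Nodup) {x y z : V} (hy : Consecutive l x y)
    (hz : Consecutive l x z) : y = z := by
  induction l with
  | nil => simp [Consecutive] at hy
  | cons c l ih =>
    rw [List.nodup_cons] at hl
    rw [consecutive_cons] at hy hz
    rcases hy with ⟨rfl, hy⟩ | hy <;> rcases hz with ⟨hxc, hz⟩ | hz
    · exact Option.some_inj.1 (hy.symm.trans hz)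
    · exact absurd hz.mem_left hl.1
    · exact absurd (hxc ▸ hy.mem_left) hl.1
    · exact ih hl.2 hy hz

lemma Consecutive.eq_left {l : List V} (hl : l.Nodup) {x y z : V} (hx : Consecutive l x z)
    (hy : Consecutive l y z) : x = y :=
  (consecutive_reverse.2 hx).eq_right (List.nodup_reverse.2 hl) (consecutive_reverse.2 hy)

lemma ncard_setOf_exists_rel_le {α β : Type*} {S : Set α} (hS : S.Finite)
    {r : α → β → Prop} (hr : ∀ a ∈ S, ∀ b c, r a b → r a c → b = c) :
    {b | ∃ a ∈ S, r a b}.ncard ≤ S.ncard := by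
  rcases S.eq_empty_or_nonempty with rfl | ⟨a, -⟩
  · simp
  have : Nonempty α := ⟨a⟩
  have h : ∀ b ∈ {b | ∃ a ∈ S, r a b}, ∃ a ∈ S, r a b := fun _ hb => hb
  choose! f hf hf' using h
  refine Set.ncard_le_ncard_of_injOn f hf (fun b hb c hc hbc => ?_) hS
  exact hr _ (hf b hb) b c (hf' b hb) (hbc ▸ hf' c hc)

/-- If a graph has the expansion property on sets of size at most `k`, then more than `k`
vertices arise as an end of a rotation of a longest path. -/
lemma lt_ncard_rotationEnds [Finite V] {k : ℕ}
    (hexp : ∀ U : Set V, U.ncard ≤ k →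
      2 * U.ncard ≤ {w : V | w ∉ U ∧ ∃ u ∈ U, G.Adj u w}.ncard)
    {P : List V} (hP : IsLongestPathList G P) (hne : P ≠ []) :
    k < (rotationEnds G P).ncard := by
  by_contra! hk
  set R := rotationEnds G P
  have hhead : P.head hne ∈ R := ⟨P.tail, by simpa using Rotation.refl⟩
  have hsub : {w : V | w ∉ R ∧ ∃ u ∈ R, G.Adj u w} ⊆
      {w | ∃ u ∈ R, Consecutive P u w} ∪ {w | ∃ u ∈ R \ {P.head hne}, Consecutive P w u} := by
    rintro w ⟨hw, u, hu, hadj⟩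
    obtain ⟨x, hx, h | h⟩ := exists_consecutive_of_adj_rotationEnds hP hu hw hadj
    · exact .inl ⟨x, hx, h⟩
    · refine .inr ⟨x, ⟨hx, ?_⟩, h⟩
      intro hxP
      obtain ⟨A, B, rfl⟩ := h
      have hnd := hP.nodup
      cases A with
      | nil =>
        obtain rfl : x = w := hxP
        simp at hnd
      | cons c A =>
        obtain rfl : x = c := hxP
        simp at hnd
  have h1 := ncard_setOf_exists_rel_le R.toFinite (r := fun u w => Consecutive P u w)
    fun _ _ _ _ => Consecutive.eq_right hP.nodup
  have h2 := ncard_setOf_exists_rel_le (R \ {P.head hne}).toFinite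
    (r := fun u w => Consecutive P w u) fun _ _ _ _ => Consecutive.eq_left hP.nodup
  have h3 := Set.ncard_sdiff_singleton_add_one hhead
  have h4 := (Set.ncard_le_ncard hsub).trans (Set.ncard_union_le _ _)
  have h5 := hexp R hk
  lia

lemma IsLongestPathList.three_le_length [Finite V] [Nonempty V] {k : ℕ} (hk : 1 ≤ k)
    (hexp : ∀ U : Set V, U.ncard ≤ k →
      2 * U.ncard ≤ {w : V | w ∉ U ∧ ∃ u ∈ U, G.Adj u w}.ncard)
    {P : List V} (hP : IsLongestPathList G P) : 3 ≤ P.length := by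
  obtain ⟨v⟩ := ‹Nonempty V›
  have h := hexp {v} (by simpa using hk)
  rw [Set.ncard_singleton, mul_one, Nat.succ_le_iff,
    Set.one_lt_ncard_iff] at h
  obtain ⟨a, b, ⟨-, v', hv, ha⟩, ⟨-, v'', hv', hb⟩, hab⟩ := h
  obtain rfl : v' = v := hv
  obtain rfl : v'' = v' := hv'
  refine hP.length_le [a, v'', b] ⟨?_, ?_⟩
  · simp [ha.symm, hb]
  · simp [ha.ne', hb.ne, hab]

/-- The graph whose edges are the holes of `G`. -/
def holeGraph [DecidableEq V] [Fintype V] (G : SimpleGraph V) : SimpleGraph V where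
  Adj u v := u ≠ v ∧ ¬ G.Adj u v ∧
    ((G ⊔ fromEdgeSet {s(u, v)}).IsHamiltonian ∨
      ∃ (a b : V) (q : (G ⊔ fromEdgeSet {s(u, v)}).Walk a b), q.IsPath ∧
        ∀ (a' b' : V) (p : G.Walk a' b'), p.IsPath → p.length < q.length)
  symm := ⟨fun u v h => by rw [Sym2.eq_swap, adj_comm]; exact ⟨h.1.symm, h.2⟩⟩
  loopless := ⟨fun _ h => h.1 rfl⟩

lemma IsLongestPathList.holeGraph_adj [DecidableEq V] [Fintype V] (hG : G.Connected)
    (hham : ¬ G.IsHamiltonian) {P : List V} (hP : IsLongestPathList G P) (hlen : 3 ≤ P.length)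
    (hne : P ≠ []) : (holeGraph G).Adj (P.getLast hne) (P.head hne) := by
  have hnadj : ¬ G.Adj (P.getLast hne) (P.head hne) := fun hadj => by
    rcases isHamiltonian_or_exists_longer hG hP.toIsPathList hlen hne hadj with h | ⟨l, hl, h⟩
    · exact hham h
    · exact absurd (hP.length_le l hl) (by lia)
  have hends : P.getLast hne ≠ P.head hne := by
    obtain ⟨x, y, l, rfl⟩ : ∃ x y l, P = x :: y :: l := by
      match P, hlen with
      | x :: y :: l, _ => exact ⟨x, y, l, rfl⟩
    intro h
    have hnd := (List.nodup_cons.1 hP.nodup).1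
    apply hnd
    rw [List.head_cons, List.getLast_cons (by simp)] at h
    exact h ▸ List.getLast_mem _
  refine ⟨hends, hnadj, ?_⟩
  set G' := G ⊔ fromEdgeSet {s(P.getLast hne, P.head hne)}
  have hle : G ≤ G' := le_sup_left
  refine (isHamiltonian_or_exists_longer (hG.mono hle) (hP.toIsPathList.mono hle) hlen hne
    (.inr (by simpa using hends))).imp_right ?_
  rintro ⟨l, hl, hlt⟩
  have hl0 : l ≠ [] := by rintro rfl; simp at hlt
  refine ⟨_, _, _, hl.isPath_ofSupport hl0, fun a b p hp => ?_⟩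
  have := hP.length_le _ hp.isPathList_support
  rw [Walk.length_support] at this
  rw [Walk.length_ofSupport]
  lia

lemma rotationEnds_subset_neighborSet_holeGraph [DecidableEq V] [Fintype V] (hG : G.Connected)
    (hham : ¬ G.IsHamiltonian) {P : List V} (hP : IsLongestPathList G P) (hlen : 3 ≤ P.length)
    (hne : P ≠ []) : rotationEnds G P ⊆ (holeGraph G).neighborSet (P.getLast hne) := by
  rintro u ⟨Q, hQ⟩
  have h := (hQ.isLongestPathList hP).holeGraph_adj hG hham (hQ.perm.length_eq ▸ hlen) (by simp)
  have hlast := hQ.getLast?_eq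
  rw [List.getLast?_eq_some_getLast (by simp), List.getLast?_eq_some_getLast hne,
    Option.some_inj] at hlast
  rwa [hlast] at h

lemma sq_le_two_mul_ncard_edgeSet [Fintype V] (H : SimpleGraph V) {k : ℕ} {S : Set V}
    (hS : k ≤ S.ncard) (hdeg : ∀ u ∈ S, k ≤ (H.neighborSet u).ncard) :
    k ^ 2 ≤ 2 * H.edgeSet.ncard := by
  classical
  have hsum := H.sum_degrees_eq_twice_card_edges
  rw [← coe_edgeFinset, Set.ncard_coe_finset, ← hsum]
  calc k ^ 2 ≤ S.toFinset.card * k := by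
        rw [sq, ← Set.ncard_eq_toFinset_card']
        exact Nat.mul_le_mul_right k hS
    _ ≤ ∑ u ∈ S.toFinset, H.degree u := by
        rw [← smul_eq_mul]
        refine Finset.card_nsmul_le_sum _ _ _ fun u hu => ?_
        have := hdeg u (by simpa using hu)
        rwa [← coe_neighborFinset, Set.ncard_coe_finset] at this
    _ ≤ _ := Finset.sum_le_univ_sum_of_nonneg fun _ => Nat.zero_le _

end SimpleGraph

/-- Pósa's lemma: a connected non-Hamiltonian `(k,2)`-expander has at least `k²/2` holes,
where a hole is a nonadjacent pair `{u,v}` whose addition as an edge yields a Hamiltonian graph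
or a graph with a path longer than every path of `Γ`. -/
theorem posa_holes {V : Type*} [Fintype V] [DecidableEq V] (Γ : SimpleGraph V) (k : ℕ)
    (hconn : Γ.Connected) (hnotham : ¬ Γ.IsHamiltonian)
    (hexp : ∀ U : Set V, U.ncard ≤ k →
      2 * U.ncard ≤ {w : V | w ∉ U ∧ ∃ u ∈ U, Γ.Adj u w}.ncard) :
    ((k : ℝ) ^ 2 / 2) ≤
      (({e : Sym2 V | ∃ u v : V, e = s(u, v) ∧ u ≠ v ∧ ¬ Γ.Adj u v ∧
          ((Γ ⊔ SimpleGraph.fromEdgeSet {s(u, v)}).IsHamiltonian ∨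
            ∃ (a b : V) (q : (Γ ⊔ SimpleGraph.fromEdgeSet {s(u, v)}).Walk a b), q.IsPath ∧
              ∀ (a' b' : V) (p : Γ.Walk a' b'), p.IsPath → p.length < q.length)}).ncard : ℝ) := by
  have hset : {e : Sym2 V | ∃ u v : V, e = s(u, v) ∧ u ≠ v ∧ ¬ Γ.Adj u v ∧
      ((Γ ⊔ SimpleGraph.fromEdgeSet {s(u, v)}).IsHamiltonian ∨
        ∃ (a b : V) (q : (Γ ⊔ SimpleGraph.fromEdgeSet {s(u, v)}).Walk a b), q.IsPath ∧
          ∀ (a' b' : V) (p : Γ.Walk a' b'), p.IsPath → p.length < q.length)} =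
      Γ.holeGraph.edgeSet := by
    ext e
    constructor
    · rintro ⟨u, v, rfl, h⟩
      exact h
    · induction e with | h u v =>
      exact fun h => ⟨u, v, rfl, h⟩
  rw [hset]
  suffices k ^ 2 ≤ 2 * Γ.holeGraph.edgeSet.ncard by
    have : ((k ^ 2 : ℕ) : ℝ) ≤ ((2 * Γ.holeGraph.edgeSet.ncard : ℕ) : ℝ) := Nat.cast_le.2 this
    push_cast at this
    linarith
  rcases Nat.eq_zero_or_pos k with rfl | hk
  · simp
  have := hconn.nonempty
  obtain ⟨P, hP⟩ := Γ.exists_isLongestPathList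
  have hends {Q : List V} (hQ : Γ.IsLongestPathList Q) (hne : Q ≠ []) :
      k ≤ (Γ.holeGraph.neighborSet (Q.getLast hne)).ncard :=
    (SimpleGraph.lt_ncard_rotationEnds hexp hQ hne).le.trans <| Set.ncard_le_ncard <|
      SimpleGraph.rotationEnds_subset_neighborSet_holeGraph hconn hnotham hQ
        (hQ.three_le_length hk hexp) hne
  have hne : P ≠ [] := by
    rintro rfl
    simpa using hP.three_le_length hk hexp
  refine Γ.holeGraph.sq_le_two_mul_ncard_edgeSet
    (SimpleGraph.lt_ncard_rotationEnds hexp hP hne).le ?_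
  rintro u ⟨Q, hQ⟩
  simpa using hends (hQ.isLongestPathList hP).reverse (by simp)
end

section
/- If a graph G has two edge-disjoint spanning trees, then the proper connection number of G satisfies pc(G) ≤ 4. -/
namespace SimpleGraph

variable {V : Type*} {G : SimpleGraph V}

/-- The parity of the smaller of the distances from `r` to the two ends of an edge. -/
noncomputable def levelParity (T : SimpleGraph V) (r : V) : Sym2 V → ℕ :=
  Sym2.lift ⟨fun a b => min (T.dist a r) (T.dist b r) % 2, fun a b => by simp only [min_comm]⟩

lemma levelParity_mk (T : SimpleGraph V) (r a b : V) :
    T.levelParity r s(a, b) = min (T.dist a r) (T.dist b r) % 2 := rfl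

lemma levelParity_lt_two (T : SimpleGraph V) (r : V) (e : Sym2 V) : T.levelParity r e < 2 := by
  induction e with | _ a b => exact Nat.mod_lt _ two_pos

lemma Walk.isChain_levelParity_of_length_eq_dist {u r : V} (p : G.Walk u r)
    (hp : p.length = G.dist u r) : (p.edges.map (G.levelParity r)).IsChain (· ≠ ·) := by
  induction p with
  | nil => simp
  | @cons a b r h p ih =>
    have hle : G.dist b r ≤ p.length := dist_le p
    have htri : G.dist a r ≤ G.dist b r + 1 := by
      obtain ⟨q, hq⟩ := p.reachable.exists_walk_length_eq_dist
      simpa [hq] using dist_le (q.cons h)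
    rw [length_cons] at hp
    have hb : p.length = G.dist b r := by omega
    cases p with
    | nil => simp
    | @cons _ d _ h' p =>
      have hle' : G.dist d r ≤ p.length := dist_le p
      have htri' : G.dist b r ≤ G.dist d r + 1 := by
        obtain ⟨q, hq⟩ := p.reachable.exists_walk_length_eq_dist
        simpa [hq] using dist_le (q.cons h')
      rw [length_cons] at hb hp
      have := ih hb
      simp only [edges_cons, List.map_cons, List.isChain_cons_cons] at this ⊢
      refine ⟨?_, this⟩
      rw [levelParity_mk, levelParity_mk]
      omega

/-- A properly colored path in colors below `m` and one in colors at least `m` that meet at an end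
can be combined, after cutting both at a common vertex, into a properly colored path. -/
lemma Walk.exists_isPath_isChain_of_color_lt_of_le {c : Sym2 V → ℕ} {m : ℕ} {u r v : V}
    (p : G.Walk u r) (q : G.Walk r v) (hp : p.IsPath) (hq : q.IsPath)
    (hpc : (p.edges.map c).IsChain (· ≠ ·)) (hqc : (q.edges.map c).IsChain (· ≠ ·))
    (hpm : ∀ e ∈ p.edges, c e < m) (hqm : ∀ e ∈ q.edges, m ≤ c e) :
    ∃ w : G.Walk u v, w.IsPath ∧ (w.edges.map c).IsChain (· ≠ ·) ∧
      (∀ x ∈ w.support, x ∈ p.support ∨ x ∈ q.support) ∧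
      ∀ y ∈ (w.edges.map c).head?, m ≤ y ∨ y ∈ (p.edges.map c).head? := by
  classical
  induction p with
  | nil =>
    refine ⟨q, hq, hqc, fun x hx => Or.inr hx, fun y hy => Or.inl ?_⟩
    obtain ⟨e, he, rfl⟩ := List.mem_map.1 (List.mem_of_mem_head? hy)
    exact hqm e he
  | @cons a b r h p ih =>
    by_cases ha : a ∈ q.support
    · refine ⟨q.dropUntil a ha, hq.dropUntil ha, ?_,
        fun x hx => Or.inr (q.support_dropUntil_subset_support ha hx), fun y hy => Or.inl ?_⟩
      · rw [← q.take_spec ha, edges_append, List.map_append] at hqc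
        exact hqc.right_of_append
      · obtain ⟨e, he, rfl⟩ := List.mem_map.1 (List.mem_of_mem_head? hy)
        exact hqm e (q.edges_dropUntil_subset_edges ha he)
    · rw [cons_isPath_iff] at hp
      rw [edges_cons, List.map_cons, List.isChain_cons] at hpc
      have hab : c s(a, b) < m := hpm _ (by simp)
      obtain ⟨w, hw, hwc, hws, hwh⟩ :=
        ih q hp.1 hq hpc.2 hqc (fun e he => hpm e (by simp [he])) hqm
      refine ⟨w.cons h, ?_, ?_, ?_, ?_⟩
      · rw [cons_isPath_iff]
        exact ⟨hw, fun hx => (hws a hx).elim hp.2 ha⟩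
      · rw [edges_cons, List.map_cons, List.isChain_cons]
        refine ⟨fun y hy => ?_, hwc⟩
        rcases hwh y hy with hy | hy
        · omega
        · exact hpc.1 y hy
      · intro x hx
        rw [support_cons, List.mem_cons] at hx ⊢
        rcases hx with rfl | hx
        · exact Or.inl (Or.inl rfl)
        · exact (hws x hx).imp_left Or.inr
      · intro y hy
        simpa using Or.inr hy

lemma exists_isPath_isChain_levelParity {T : SimpleGraph V} (hT : T.Connected) (hTG : T ≤ G)
    (u r : V) : ∃ p : G.Walk u r, p.IsPath ∧ (∀ e ∈ p.edges, e ∈ T.edgeSet) ∧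
      (p.edges.map (T.levelParity r)).IsChain (· ≠ ·) := by
  obtain ⟨p, hp⟩ := hT.exists_walk_length_eq_dist u r
  refine ⟨p.mapLe hTG, (p.isPath_of_length_eq_dist hp).mapLe hTG, ?_, ?_⟩
  · intro e he
    rw [Walk.edges_mapLe_eq_edges] at he
    exact p.edges_subset_edgeSet he
  · rw [Walk.edges_mapLe_eq_edges]
    exact p.isChain_levelParity_of_length_eq_dist hp

open Classical in
/-- Color the edges of `T₁` by parity of level with colors `0, 1`, all others by parity of level
in `T₂` with colors `2, 3`. -/
noncomputable def twoLevelColoring (T₁ T₂ : SimpleGraph V) (r : V) (e : Sym2 V) : ℕ :=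
  if e ∈ T₁.edgeSet then T₁.levelParity r e else T₂.levelParity r e + 2

lemma twoLevelColoring_lt_four (T₁ T₂ : SimpleGraph V) (r : V) (e : Sym2 V) :
    twoLevelColoring T₁ T₂ r e < 4 := by
  have h₁ := T₁.levelParity_lt_two r e
  have h₂ := T₂.levelParity_lt_two r e
  unfold twoLevelColoring
  split_ifs <;> omega

lemma isProperPathColoring_twoLevelColoring {T₁ T₂ : SimpleGraph V} (h₁ : T₁ ≤ G) (h₂ : T₂ ≤ G)
    (hT₁ : T₁.Connected) (hT₂ : T₂.Connected) (hd : Disjoint T₁.edgeSet T₂.edgeSet) (r : V) :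
    IsProperPathColoring G (twoLevelColoring T₁ T₂ r) := by
  intro u v _
  obtain ⟨p, hp, hpT, hpc⟩ := exists_isPath_isChain_levelParity hT₁ h₁ u r
  obtain ⟨q, hq, hqT, hqc⟩ := exists_isPath_isChain_levelParity hT₂ h₂ v r
  have hpe : ∀ e ∈ p.edges, twoLevelColoring T₁ T₂ r e = T₁.levelParity r e :=
    fun e he => if_pos (hpT e he)
  have hqe : ∀ e ∈ q.edges, twoLevelColoring T₁ T₂ r e = T₂.levelParity r e + 2 :=
    fun e he => if_neg fun h => Set.disjoint_left.1 hd h (hqT e he)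
  obtain ⟨w, hw, hwc, -⟩ := p.exists_isPath_isChain_of_color_lt_of_le (m := 2) q.reverse
    (c := twoLevelColoring T₁ T₂ r) hp hq.reverse
    (by rwa [List.map_congr_left hpe])
    (by
      rw [Walk.edges_reverse, List.map_reverse, List.isChain_reverse, List.map_congr_left hqe]
      rw [List.isChain_map] at hqc ⊢
      exact hqc.imp fun a b hab => by omega)
    (fun e he => by rw [hpe e he]; exact T₁.levelParity_lt_two r e)
    (fun e he => by
      rw [Walk.edges_reverse, List.mem_reverse] at he
      rw [hqe e he]; omega)
  exact ⟨w, hw, hwc⟩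

end SimpleGraph

/-- If a graph has two edge-disjoint spanning trees, then its proper connection number is at
most 4. -/
theorem pc_le_four_of_two_edge_disjoint_spanning_trees {V : Type*} [Fintype V]
    (G : SimpleGraph V)
    (h : ∃ T₁ T₂ : SimpleGraph V, T₁ ≤ G ∧ T₂ ≤ G ∧ T₁.IsTree ∧ T₂.IsTree ∧
      Disjoint T₁.edgeSet T₂.edgeSet) :
    properConnectionNumber G ≤ 4 := by
  obtain ⟨T₁, T₂, h₁, h₂, hT₁, hT₂, hd⟩ := h
  obtain ⟨r⟩ := hT₁.connected.nonempty
  exact Nat.sInf_le ⟨T₁.twoLevelColoring T₂ r, T₁.twoLevelColoring_lt_four T₂ r,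
    SimpleGraph.isProperPathColoring_twoLevelColoring h₁ h₂ hT₁.connected hT₂.connected hd r⟩
end
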